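/- Let μ be a Borel probability measure on SL₂(ℝ) with a finite exponential moment whose support generates a Zariski dense subgroup, and let ν be the unique μ-stationary measure on X = ℙ(ℝ²). Let φ : X ∖ {[1:0]} → ℝ be the affine chart φ(ℝ(v₁,v₂)) = v₁/v₂. If the point [1:0] = ℝ(1,0) does not belong to the support of ν, then φ_*ν is a Rajchman measure on ℝ: ∫_X e^{i φ(x) ξ} dν(x) → 0 as |ξ| → ∞. -/

import Mathlib

open MeasureTheory Filter

noncomputable section

abbrev SL2 := Matrix.SpecialLinearGroup (Fin 2) ℝ

abbrev PX := Projectivization ℝ (Fin 2 → ℝ)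

instance : TopologicalSpace SL2 := instTopologicalSpaceSubtype
instance : TopologicalSpace PX := instTopologicalSpaceQuotient
instance : MeasurableSpace SL2 := borel _
instance : MeasurableSpace PX := borel _

/-- Euclidean norm on ℝ². -/
def enorm2 (v : Fin 2 → ℝ) : ℝ := Real.sqrt (v 0 ^ 2 + v 1 ^ 2)

/-- Operator norm of g ∈ SL₂(ℝ) w.r.t. the Euclidean norm on ℝ². -/
def opNorm (g : SL2) : ℝ :=
  ‖Matrix.toEuclideanCLM (𝕜 := ℝ) (n := Fin 2) (g : Matrix (Fin 2) (Fin 2) ℝ)‖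

/-- Cartan projection κ(g) = log ‖g‖. -/
def kappa (g : SL2) : ℝ := Real.log (opNorm g)

/-- The projective action of SL₂(ℝ) on ℙ(ℝ²). -/
def act (g : SL2) (x : PX) : PX :=
  Projectivization.map ((Matrix.SpecialLinearGroup.toLin' g).toLinearMap)
    (LinearEquiv.injective _) x

/-- The norm cocycle σ(g, ℝv) = log (‖gv‖/‖v‖). -/
def cocycle (g : SL2) (x : PX) : ℝ :=
  Real.log (enorm2 ((g : Matrix (Fin 2) (Fin 2) ℝ).mulVec x.rep) / enorm2 x.rep)

/-- The sine distance d(ℝv, ℝw) = |det(v,w)|/(‖v‖‖w‖) on ℙ(ℝ²). -/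
def projDist (x y : PX) : ℝ :=
  |x.rep 0 * y.rep 1 - x.rep 1 * y.rep 0| / (enorm2 x.rep * enorm2 y.rep)

/-- An angle θ(x) ∈ ℝ representing x = ℝ(cos θ, sin θ). -/
def pangle (x : PX) : ℝ := Complex.arg (x.rep 0 + x.rep 1 * Complex.I)

/-- The (topological) support of a measure. -/
def measSupp (μ : Measure SL2) : Set SL2 :=
  {g | ∀ U : Set SL2, IsOpen U → g ∈ U → 0 < μ U}

/-- μ has a finite exponential moment. -/
def HasExpMoment (μ : Measure SL2) : Prop :=
  ∃ ε₁ > (0 : ℝ), ∫⁻ g, ENNReal.ofReal (opNorm g ^ ε₁) ∂μ < ⊤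

/-- The group generated by the support of μ is Zariski dense in SL₂(ℝ),
equivalently it is not solvable. -/
def ZariskiDense (μ : Measure SL2) : Prop :=
  ¬ IsSolvable (Subgroup.closure (measSupp μ))

/-- ν is μ-stationary: μ ∗ ν = ν. -/
def IsMuStationary (μ : Measure SL2) (ν : Measure PX) : Prop :=
  μ.bind (fun g => ν.map (act g)) = ν

/-- The product g₁ ⋯ gₙ of a word (g₁, …, gₙ). -/
def word {n : ℕ} (g : Fin n → SL2) : SL2 := (List.ofFn g).prod

/-- The product measure μ^{⊗n} on words of length n. -/
def μpi (μ : Measure SL2) (n : ℕ) : Measure (Fin n → SL2) := Measure.pi fun _ => μ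


set_option linter.all false
open scoped commutatorElement ENNReal


lemma sl_det (g : SL2) : g.1 0 0 * g.1 1 1 - g.1 0 1 * g.1 1 0 = 1 := by
  have := g.2
  rwa [Matrix.det_fin_two] at this

lemma sl_mul00 (g h : SL2) : (g * h).1 0 0 = g.1 0 0 * h.1 0 0 + g.1 0 1 * h.1 1 0 := by
  simp [Matrix.mul_apply, Fin.sum_univ_two]
lemma sl_mul01 (g h : SL2) : (g * h).1 0 1 = g.1 0 0 * h.1 0 1 + g.1 0 1 * h.1 1 1 := by
  simp [Matrix.mul_apply, Fin.sum_univ_two]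
lemma sl_mul10 (g h : SL2) : (g * h).1 1 0 = g.1 1 0 * h.1 0 0 + g.1 1 1 * h.1 1 0 := by
  simp [Matrix.mul_apply, Fin.sum_univ_two]
lemma sl_mul11 (g h : SL2) : (g * h).1 1 1 = g.1 1 0 * h.1 0 1 + g.1 1 1 * h.1 1 1 := by
  simp [Matrix.mul_apply, Fin.sum_univ_two]
lemma sl_inv00 (g : SL2) : (g⁻¹).1 0 0 = g.1 1 1 := by
  simp [Matrix.SpecialLinearGroup.SL2_inv_expl]
lemma sl_inv01 (g : SL2) : (g⁻¹).1 0 1 = - g.1 0 1 := by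
  simp [Matrix.SpecialLinearGroup.SL2_inv_expl]
lemma sl_inv10 (g : SL2) : (g⁻¹).1 1 0 = - g.1 1 0 := by
  simp [Matrix.SpecialLinearGroup.SL2_inv_expl]
lemma sl_inv11 (g : SL2) : (g⁻¹).1 1 1 = g.1 0 0 := by
  simp [Matrix.SpecialLinearGroup.SL2_inv_expl]
lemma sl_one00 : (1 : SL2).1 0 0 = 1 := by simp
lemma sl_one01 : (1 : SL2).1 0 1 = 0 := by simp
lemma sl_one10 : (1 : SL2).1 1 0 = 0 := by simp
lemma sl_one11 : (1 : SL2).1 1 1 = 1 := by simp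

lemma sl_ext {g h : SL2} (h00 : g.1 0 0 = h.1 0 0) (h01 : g.1 0 1 = h.1 0 1)
    (h10 : g.1 1 0 = h.1 1 0) (h11 : g.1 1 1 = h.1 1 1) : g = h := by
  apply Subtype.ext
  ext i j
  fin_cases i <;> fin_cases j <;> assumption

/-- the matrix with given entries -/
def mk2 (a b c d : ℝ) (h : a * d - b * c = 1) : SL2 :=
  ⟨!![a, b; c, d], by rw [Matrix.det_fin_two_of]; exact h⟩

@[simp] lemma mk2_00 (a b c d : ℝ) (h) : (mk2 a b c d h).1 0 0 = a := by simp [mk2]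
@[simp] lemma mk2_01 (a b c d : ℝ) (h) : (mk2 a b c d h).1 0 1 = b := by simp [mk2]
@[simp] lemma mk2_10 (a b c d : ℝ) (h) : (mk2 a b c d h).1 1 0 = c := by simp [mk2]
@[simp] lemma mk2_11 (a b c d : ℝ) (h) : (mk2 a b c d h).1 1 1 = d := by simp [mk2]

def tr2 (g : SL2) : ℝ := g.1 0 0 + g.1 1 1

lemma solv_of_comm (H : Subgroup SL2)
    (h : ∀ a ∈ H, ∀ b ∈ H, ∀ c ∈ H, ∀ d ∈ H, ⁅a, b⁆ * ⁅c, d⁆ = ⁅c, d⁆ * ⁅a, b⁆) :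
    IsSolvable H := by
  refine ⟨⟨2, ?_⟩⟩
  rw [derivedSeries_succ, derivedSeries_succ, derivedSeries_zero]
  rw [Subgroup.commutator_eq_bot_iff_le_centralizer]
  rw [Subgroup.commutator_def, Subgroup.centralizer_closure, Subgroup.closure_le]
  rintro x ⟨a, -, b, -, rfl⟩
  simp only [SetLike.mem_coe, Subgroup.mem_iInf, Subgroup.mem_centralizer_singleton_iff]
  rintro y ⟨c, -, d, -, rfl⟩
  have := h a a.2 b b.2 c c.2 d d.2
  apply Subtype.ext
  simp only [Subgroup.coe_mul]
  first
    | exact this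
    | exact this.symm

lemma solv_conj (H : Subgroup SL2) (T : SL2)
    (h : IsSolvable (H.map (MulAut.conj T).toMonoidHom)) : IsSolvable H := by
  have e := (H.equivMapOfInjective (MulAut.conj T).toMonoidHom (MulAut.conj T).injective)
  have : Group.IsSolvable (H.map (MulAut.conj T).toMonoidHom) := h
  exact Group.isSolvable_of_isSolvable_injective (f := e.toMonoidHom) e.injective

lemma solv_upper (H : Subgroup SL2) (T : SL2) (h : ∀ g ∈ H, (T * g * T⁻¹).1 1 0 = 0) :
    IsSolvable H := by
  apply solv_conj H T
  have hH : ∀ g ∈ H.map (MulAut.conj T).toMonoidHom, g.1 1 0 = 0 := by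
    rintro _ ⟨g, hg, rfl⟩
    exact h g hg
  generalize H.map (MulAut.conj T).toMonoidHom = K at *
  have key : ∀ a ∈ K, ∀ b ∈ K, (⁅a, b⁆).1 1 0 = 0 ∧ (⁅a, b⁆).1 0 0 = 1 ∧ (⁅a, b⁆).1 1 1 = 1 := by
    intro a ha b hb
    have h1 := hH a ha
    have h2 := hH b hb
    have d1 := sl_det a
    have d2 := sl_det b
    rw [h1] at d1; rw [h2] at d2
    simp only [commutatorElement_def, sl_mul00, sl_mul10, sl_mul11, sl_mul01, sl_inv00, sl_inv01,
      sl_inv10, sl_inv11, h1, h2]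
    refine ⟨by ring, ?_, ?_⟩ <;> linear_combination b.1 0 0 * b.1 1 1 * d1 + d2
  apply solv_of_comm
  intro a ha b hb c hc d hd
  obtain ⟨p1, p2, p3⟩ := key a ha b hb
  obtain ⟨q1, q2, q3⟩ := key c hc d hd
  apply sl_ext <;> simp only [sl_mul00, sl_mul10, sl_mul11, sl_mul01, p1, p2, p3, q1, q2, q3] <;> ring

lemma solv_torus (H : Subgroup SL2) (T : SL2)
    (h : ∀ g ∈ H, ((T * g * T⁻¹).1 0 1 = 0 ∧ (T * g * T⁻¹).1 1 0 = 0) ∨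
      ((T * g * T⁻¹).1 0 0 = 0 ∧ (T * g * T⁻¹).1 1 1 = 0)) :
    IsSolvable H := by
  apply solv_conj H T
  have hH : ∀ g ∈ H.map (MulAut.conj T).toMonoidHom, (g.1 0 1 = 0 ∧ g.1 1 0 = 0) ∨
      (g.1 0 0 = 0 ∧ g.1 1 1 = 0) := by
    rintro _ ⟨g, hg, rfl⟩
    exact h g hg
  generalize H.map (MulAut.conj T).toMonoidHom = K at *
  have key : ∀ a ∈ K, ∀ b ∈ K, (⁅a, b⁆).1 1 0 = 0 ∧ (⁅a, b⁆).1 0 1 = 0 := by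
    intro a ha b hb
    simp only [commutatorElement_def, sl_mul00, sl_mul10, sl_mul11, sl_mul01, sl_inv00, sl_inv01,
      sl_inv10, sl_inv11]
    rcases hH a ha with ⟨h1, h2⟩ | ⟨h1, h2⟩ <;> rcases hH b hb with ⟨h3, h4⟩ | ⟨h3, h4⟩ <;>
      rw [h1, h2, h3, h4] <;> constructor <;> ring
  apply solv_of_comm
  intro a ha b hb c hc d hd
  obtain ⟨p1, p2⟩ := key a ha b hb
  obtain ⟨q1, q2⟩ := key c hc d hd
  apply sl_ext <;> simp only [sl_mul00, sl_mul10, sl_mul11, sl_mul01, p1, p2, q1, q2] <;> ring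

/-- A subgroup preserving a line is solvable. -/
lemma solv_line (H : Subgroup SL2) (v0 v1 : ℝ) (hv : v0 ≠ 0 ∨ v1 ≠ 0)
    (h : ∀ g ∈ H, v0 * (g.1 1 0 * v0 + g.1 1 1 * v1) - v1 * (g.1 0 0 * v0 + g.1 0 1 * v1) = 0) :
    IsSolvable H := by
  have hn : v0 ^ 2 + v1 ^ 2 ≠ 0 := by
    rcases hv with hv | hv <;> positivity
  have hT : v0 / (v0 ^ 2 + v1 ^ 2) * v0 - v1 / (v0 ^ 2 + v1 ^ 2) * (-v1) = 1 := by
    field_simp; ring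
  apply solv_upper H (mk2 (v0 / (v0 ^ 2 + v1 ^ 2)) (v1 / (v0 ^ 2 + v1 ^ 2)) (-v1) v0 hT)
  intro g hg
  simp only [sl_mul00, sl_mul10, sl_mul11, sl_mul01, sl_inv00, sl_inv01,
      sl_inv10, sl_inv11, mk2_00, mk2_01, mk2_10, mk2_11]
  linear_combination h g hg

lemma solv_abelian (H : Subgroup SL2) (h : ∀ a ∈ H, ∀ b ∈ H, a * b = b * a) : IsSolvable H := by
  apply solv_of_comm
  intro a ha b hb c hc d hd
  have hm : ∀ a ∈ H, ∀ b ∈ H, ⁅a, b⁆ ∈ H := fun a ha b hb => by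
    rw [commutatorElement_def]
    exact H.mul_mem (H.mul_mem (H.mul_mem ha hb) (H.inv_mem ha)) (H.inv_mem hb)
  exact h _ (hm a ha b hb) _ (hm c hc d hd)



lemma comm_trace (A B : SL2) : tr2 (A * B * A⁻¹ * B⁻¹) - 2 =
    (A.1 0 1 * B.1 1 0 - B.1 0 1 * A.1 1 0) ^ 2 +
    (B.1 0 1 * (A.1 0 0 - A.1 1 1) + A.1 0 1 * (B.1 1 1 - B.1 0 0)) *
    (A.1 1 0 * (B.1 0 0 - B.1 1 1) - B.1 1 0 * (A.1 0 0 - A.1 1 1)) := by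
  have d1 := sl_det A
  have d2 := sl_det B
  simp only [tr2, sl_mul00, sl_mul10, sl_mul11, sl_mul01, sl_inv00, sl_inv01,
      sl_inv10, sl_inv11]
  generalize A.1 0 0 = a at *
  generalize A.1 0 1 = b at *
  generalize A.1 1 0 = c at *
  generalize A.1 1 1 = d at *
  generalize B.1 0 0 = e at *
  generalize B.1 0 1 = f at *
  generalize B.1 1 0 = g at *
  generalize B.1 1 1 = h at *
  linear_combination (2 * (e * h - f * g)) * d1 + 2 * d2

lemma solv_elliptic (H : Subgroup SL2) (htr : ∀ g ∈ H, |tr2 g| ≤ 2) (A : SL2) (hA : A ∈ H)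
    (hA2 : |tr2 A| < 2) : IsSolvable H := by
  have d1 := sl_det A
  have hD : (A.1 0 0 - A.1 1 1) ^ 2 + 4 * A.1 0 1 * A.1 1 0 < 0 := by
    have : tr2 A ^ 2 < 4 := by
      have := sq_lt_sq' (abs_lt.mp hA2).1 (abs_lt.mp hA2).2
      linarith
    unfold tr2 at this
    nlinarith
  have hc : A.1 1 0 ≠ 0 := by
    intro h0
    rw [h0] at hD
    nlinarith [sq_nonneg (A.1 0 0 - A.1 1 1)]
  have key : ∀ B ∈ H, ∃ s t : ℝ, B.1 0 0 = s + t * A.1 0 0 ∧ B.1 0 1 = t * A.1 0 1 ∧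
      B.1 1 0 = t * A.1 1 0 ∧ B.1 1 1 = s + t * A.1 1 1 := by
    intro B hB
    have h1 := comm_trace A B
    have h2 := (abs_le.mp (htr _ (H.mul_mem (H.mul_mem (H.mul_mem hA hB) (H.inv_mem hA))
      (H.inv_mem hB)))).2
    generalize tr2 (A * B * A⁻¹ * B⁻¹) = tt at *
    generalize A.1 0 0 = a at *
    generalize A.1 0 1 = b at *
    generalize A.1 1 0 = c at *
    generalize A.1 1 1 = d at *
    generalize B.1 0 0 = e at *
    generalize B.1 0 1 = f at *
    generalize B.1 1 0 = g at *
    generalize B.1 1 1 = h at *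
    set r := c * (e - h) - g * (a - d) with hr
    set p := b * g - f * c with hp
    set q := f * (a - d) + b * (h - e) with hq
    have rel : p * (a - d) + q * c + r * b = 0 := by rw [hr, hp, hq]; ring
    have h3 : p ^ 2 + q * r ≤ 0 := by linarith
    have h4 : 4 * c ^ 2 * (p ^ 2 + q * r) = (2 * c * p - (a - d) * r) ^ 2
        - ((a - d) ^ 2 + 4 * b * c) * r ^ 2 := by
      linear_combination 4 * c * r * rel
    have h5 : 4 * c ^ 2 * (p ^ 2 + q * r) ≤ 0 := by
      apply mul_nonpos_of_nonneg_of_nonpos <;> [positivity; exact h3]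
    have hr0 : r = 0 := by
      by_contra hne
      have : 0 < r ^ 2 := by positivity
      nlinarith [sq_nonneg (2 * c * p - (a - d) * r)]
    have hp0 : p = 0 := by
      rw [hr0] at h4 h5
      have : (2 * c * p) ^ 2 ≤ 0 := by nlinarith
      have h6 : 2 * c * p = 0 := by nlinarith [sq_nonneg (2 * c * p)]
      simpa [hc] using h6
    refine ⟨h - g / c * d, g / c, ?_, ?_, ?_, ?_⟩
    · field_simp
      linear_combination hr0 - hr
    · field_simp
      linear_combination hp - hp0
    · field_simp
    · ring
  apply solv_abelian
  intro B hB C hC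
  obtain ⟨s, t, b1, b2, b3, b4⟩ := key B hB
  obtain ⟨s', t', c1, c2, c3, c4⟩ := key C hC
  apply sl_ext <;> simp only [sl_mul00, sl_mul10, sl_mul11, sl_mul01, b1, b2, b3, b4, c1, c2, c3, c4]
    <;> ring

lemma bdd_lin (x y : ℝ) (h : ∀ n : ℕ, |x + n * y| ≤ 2) : y = 0 := by
  by_contra hy
  obtain ⟨n, hn⟩ := exists_nat_gt ((4 : ℝ) / |y|)
  have hy' : 0 < |y| := abs_pos.mpr hy
  rw [div_lt_iff₀ hy'] at hn
  have h0 := h 0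
  have h1 := h n
  simp at h0
  have : |(n : ℝ) * y| ≤ 4 := by
    calc |(n : ℝ) * y| = |(x + n * y) - x| := by ring_nf
      _ ≤ |x + n * y| + |x| := abs_sub _ _
      _ ≤ 4 := by linarith
  rw [abs_mul, Nat.abs_cast] at this
  linarith

lemma solv_parab (H : Subgroup SL2) (htr : ∀ g ∈ H, |tr2 g| = 2) : IsSolvable H := by
  by_cases hall : ∀ A ∈ H, A.1 0 1 = 0 ∧ A.1 1 0 = 0
  · apply solv_abelian
    intro B hB C hC
    obtain ⟨b1, b2⟩ := hall B hB
    obtain ⟨c1, c2⟩ := hall C hC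
    apply sl_ext <;> simp only [sl_mul00, sl_mul10, sl_mul11, sl_mul01, b1, b2, c1, c2] <;> ring
  push Not at hall
  obtain ⟨P, hP, hP'⟩ := hall
  obtain ⟨ε, hε, hεt⟩ : ∃ ε : ℝ, ε * ε = 1 ∧ P.1 0 0 + P.1 1 1 = 2 * ε := by
    have := htr P hP
    unfold tr2 at this
    rcases (abs_eq (by norm_num)).mp this with h | h
    · exact ⟨1, by norm_num, by linarith⟩
    · exact ⟨-1, by norm_num, by linarith⟩
  have hd := sl_det P
  set p := ε * P.1 0 0 - 1 with hp
  set q := ε * P.1 0 1 with hq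
  set r := ε * P.1 1 0 with hr
  have hε0 : ε ≠ 0 := by rintro rfl; norm_num at hε
  have e00 : P.1 0 0 = ε * (1 + p) := by rw [hp]; linear_combination (-P.1 0 0) * hε
  have e01 : P.1 0 1 = ε * q := by rw [hq]; linear_combination (-P.1 0 1) * hε
  have e10 : P.1 1 0 = ε * r := by rw [hr]; linear_combination (-P.1 1 0) * hε
  have e11 : P.1 1 1 = ε * (1 - p) := by linear_combination hεt - e00
  have hdet : p ^ 2 + q * r = 0 := by
    rw [e00, e01, e10, e11] at hd
    linear_combination -hd + (1 - p ^ 2 - q * r) * hε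
  clear_value p q r
  have hpow : ∀ n : ℕ, (P ^ n).1 0 0 = ε ^ n * (1 + n * p) ∧ (P ^ n).1 0 1 = ε ^ n * (n * q) ∧
      (P ^ n).1 1 0 = ε ^ n * (n * r) ∧ (P ^ n).1 1 1 = ε ^ n * (1 - n * p) := by
    intro n
    induction n with
    | zero => simp
    | succ n ih =>
      obtain ⟨i1, i2, i3, i4⟩ := ih
      rw [pow_succ, sl_mul00, sl_mul01, sl_mul10, sl_mul11, i1, i2, i3, i4, e00, e01, e10, e11,
        pow_succ]
      push_cast
      refine ⟨?_, ?_, ?_, ?_⟩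
      · linear_combination ε ^ n * ε * n * hdet
      · ring
      · ring
      · linear_combination ε ^ n * ε * n * hdet
  have hN : ∀ B ∈ H, p * B.1 0 0 + q * B.1 1 0 + r * B.1 0 1 - p * B.1 1 1 = 0 := by
    intro B hB
    apply bdd_lin (tr2 B)
    intro n
    have h1 := htr _ (H.mul_mem (H.pow_mem hP n) hB)
    obtain ⟨i1, i2, i3, i4⟩ := hpow n
    have h2 : tr2 (P ^ n * B) = ε ^ n * (tr2 B + n * (p * B.1 0 0 + q * B.1 1 0 + r * B.1 0 1 - p * B.1 1 1)) := by
      simp only [tr2, sl_mul00, sl_mul10, sl_mul11, sl_mul01, i1, i2, i3, i4]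
      ring
    rw [h2, abs_mul, abs_pow] at h1
    have h3 : |ε| = 1 := by
      have : |ε| * |ε| = 1 := by rw [← abs_mul, hε, abs_one]
      nlinarith [abs_nonneg ε]
    rw [h3, one_pow, one_mul] at h1
    exact h1.le
  by_cases hq0 : q = 0
  · have hp0 : p = 0 := by rw [hq0] at hdet; simpa using hdet
    have hr0 : r ≠ 0 := by
      intro h
      exact hP' (by rw [e01, hq0, mul_zero]) (by rw [e10, h, mul_zero])
    apply solv_line H 0 1 (Or.inr one_ne_zero)
    intro g hg
    have := hN g hg
    rw [hp0, hq0] at this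
    have : g.1 0 1 = 0 := by
      have h : r * g.1 0 1 = 0 := by linarith
      simpa [hr0] using h
    rw [this]; ring
  · apply solv_line H q (-p) (Or.inl hq0)
    intro g hg
    linear_combination q * hN g hg - g.1 0 1 * hdet

lemma hyp_exists (H : Subgroup SL2) (h : ¬ IsSolvable H) : ∃ γ ∈ H, 2 < |tr2 γ| := by
  by_contra hcon
  push Not at hcon
  by_cases hell : ∃ A ∈ H, |tr2 A| < 2
  · obtain ⟨A, hA, hA2⟩ := hell
    exact h (solv_elliptic H hcon A hA hA2)
  · push Not at hell
    exact h (solv_parab H fun g hg => le_antisymm (hcon g hg) (hell g hg))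

lemma diag_of_rows (γ : SL2) (l m x0 x1 y0 y1 : ℝ) (hlm : l * m = 1)
    (hx0 : x0 * γ.1 0 0 + x1 * γ.1 1 0 = l * x0) (hx1 : x0 * γ.1 0 1 + x1 * γ.1 1 1 = l * x1)
    (hy0 : y0 * γ.1 0 0 + y1 * γ.1 1 0 = m * y0) (hy1 : y0 * γ.1 0 1 + y1 * γ.1 1 1 = m * y1)
    (hd : x0 * y1 - x1 * y0 ≠ 0) :
    ∃ T : SL2, (T * γ * T⁻¹).1 0 0 = l ∧ (T * γ * T⁻¹).1 0 1 = 0 ∧ (T * γ * T⁻¹).1 1 0 = 0 ∧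
      (T * γ * T⁻¹).1 1 1 = m := by
  set δ := x0 * y1 - x1 * y0 with hδ
  refine ⟨mk2 (x0 / δ) (x1 / δ) y0 y1 (by field_simp; rw [hδ]), ?_⟩
  simp only [sl_mul00, sl_mul10, sl_mul11, sl_mul01, sl_inv00, sl_inv01,
      sl_inv10, sl_inv11, mk2_00, mk2_01, mk2_10, mk2_11]
  refine ⟨?_, ?_, ?_, ?_⟩
  · field_simp
    linear_combination y1 * hx0 - y0 * hx1 - l * hδ
  · field_simp
    linear_combination -x1 * hx0 + x0 * hx1
  · linear_combination y1 * hy0 - y0 * hy1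
  · field_simp
    linear_combination -x1 * hy0 + x0 * hy1 - m * hδ

lemma diag_exists (γ : SL2) (h : 2 < |tr2 γ|) : ∃ (T : SL2) (l : ℝ), 1 < |l| ∧
    (T * γ * T⁻¹).1 0 0 = l ∧ (T * γ * T⁻¹).1 0 1 = 0 ∧ (T * γ * T⁻¹).1 1 0 = 0 ∧
      (T * γ * T⁻¹).1 1 1 = l⁻¹ := by
  have hd := sl_det γ
  -- eigenvalues
  obtain ⟨l, m, hlm, hsum, hl⟩ : ∃ l m : ℝ, l * m = 1 ∧ l + m = tr2 γ ∧ 1 < |l| := by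
    have hs : 4 < tr2 γ ^ 2 := by
      have := sq_abs (tr2 γ); nlinarith
    have hq := Real.sq_sqrt (show 0 ≤ tr2 γ ^ 2 - 4 by linarith)
    have hq0 := Real.sqrt_nonneg (tr2 γ ^ 2 - 4)
    set w := Real.sqrt (tr2 γ ^ 2 - 4)
    by_cases hp : 0 ≤ tr2 γ
    · rw [abs_of_nonneg hp] at h
      refine ⟨(tr2 γ + w) / 2, (tr2 γ - w) / 2, by nlinarith, by ring, ?_⟩
      rw [abs_of_nonneg (by linarith)]; linarith
    · push Not at hp
      rw [abs_of_neg hp] at h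
      refine ⟨(tr2 γ - w) / 2, (tr2 γ + w) / 2, by nlinarith, by ring, ?_⟩
      rw [abs_of_neg (by linarith)]; linarith
  have hl0 : l ≠ 0 := by rintro rfl; simp at hl; linarith
  have hm : m = l⁻¹ := by field_simp; linarith
  have hlm' : l ≠ m := by
    rintro rfl
    have : |l| * |l| = 1 := by rw [← abs_mul, hlm, abs_one]
    nlinarith
  unfold tr2 at hsum
  have hchar : l * l - (γ.1 0 0 + γ.1 1 1) * l + 1 = 0 := by rw [← hsum]; linear_combination hlm * (-1)
  have hcharm : m * m - (γ.1 0 0 + γ.1 1 1) * m + 1 = 0 := by rw [← hsum]; linear_combination hlm * (-1)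
  by_cases hc : γ.1 1 0 = 0
  · rw [hc] at hd
    have : (l - γ.1 0 0) * (l - γ.1 1 1) = 0 := by linear_combination hchar + hd
    rcases mul_eq_zero.mp this with h1 | h1
    · have hla : γ.1 0 0 = l := by linarith
      have hmd : γ.1 1 1 = m := by linarith
      obtain ⟨T, hT⟩ := diag_of_rows γ l m (γ.1 0 0 - γ.1 1 1) (γ.1 0 1) 0 1 hlm (by rw [hc, hla]; ring)
        (by rw [hla, hmd]; ring) (by rw [hc]; ring) (by rw [hmd]; ring)
        (by rw [hla, hmd]; simpa [sub_eq_zero] using hlm')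
      exact ⟨T, l, hl, by rw [← hm]; exact hT⟩
    · have hla : γ.1 1 1 = l := by linarith
      have hmd : γ.1 0 0 = m := by linarith
      obtain ⟨T, hT⟩ := diag_of_rows γ l m 0 1 (γ.1 0 0 - γ.1 1 1) (γ.1 0 1) hlm (by rw [hc]; ring) (by rw [hla]; ring)
        (by rw [hc, hmd]; ring)
        (by rw [hla, hmd]; ring)
        (by rw [hla, hmd]; simpa [sub_eq_zero] using hlm')
      exact ⟨T, l, hl, by rw [← hm]; exact hT⟩
  · obtain ⟨T, hT⟩ := diag_of_rows γ l m (γ.1 1 0) (l - γ.1 0 0) (γ.1 1 0) (m - γ.1 0 0) hlm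
      (by ring) (by linear_combination -hchar - hd) (by ring) (by linear_combination -hcharm - hd)
      (by
        intro h0
        have : γ.1 1 0 * (m - l) = 0 := by linarith
        rcases mul_eq_zero.mp this with h | h
        · exact hc h
        · exact hlm' (by linarith))
    exact ⟨T, l, hl, by rw [← hm]; exact hT⟩


/-- sum of absolute values of entries -/
def nm (g : SL2) : ℝ := |g.1 0 0| + |g.1 0 1| + |g.1 1 0| + |g.1 1 1|

lemma nm_ge_one (g : SL2) : 1 ≤ nm g := by
  have hd := sl_det g
  by_contra h
  push Not at h
  unfold nm at h
  have h1 : |g.1 0 0 * g.1 1 1| + |g.1 0 1 * g.1 1 0| ≥ 1 := by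
    calc (1:ℝ) = |g.1 0 0 * g.1 1 1 - g.1 0 1 * g.1 1 0| := by rw [hd]; simp
      _ ≤ _ := abs_sub _ _
  rw [abs_mul, abs_mul] at h1
  have := abs_nonneg (g.1 0 0)
  have := abs_nonneg (g.1 0 1)
  have := abs_nonneg (g.1 1 0)
  have := abs_nonneg (g.1 1 1)
  nlinarith [mul_nonneg (abs_nonneg (g.1 0 0)) (abs_nonneg (g.1 0 1)), mul_nonneg (abs_nonneg (g.1 0 0)) (abs_nonneg (g.1 1 0)),
   mul_nonneg (abs_nonneg (g.1 1 1)) (abs_nonneg (g.1 0 1)), mul_nonneg (abs_nonneg (g.1 1 1)) (abs_nonneg (g.1 1 0)),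
   mul_nonneg (abs_nonneg (g.1 0 0)) (abs_nonneg (g.1 1 1)), mul_nonneg (abs_nonneg (g.1 0 1)) (abs_nonneg (g.1 1 0))]

lemma line_closure (A : Set SL2) (v0 v1 : ℝ) (hv : v0 ≠ 0 ∨ v1 ≠ 0)
    (h : ∀ g ∈ A, v0 * (g.1 1 0 * v0 + g.1 1 1 * v1) - v1 * (g.1 0 0 * v0 + g.1 0 1 * v1) = 0) :
    IsSolvable (Subgroup.closure A) := by
  apply solv_line _ v0 v1 hv
  have eig : ∀ g : SL2, v0 * (g.1 1 0 * v0 + g.1 1 1 * v1) - v1 * (g.1 0 0 * v0 + g.1 0 1 * v1) = 0 →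
      ∃ t : ℝ, g.1 0 0 * v0 + g.1 0 1 * v1 = t * v0 ∧ g.1 1 0 * v0 + g.1 1 1 * v1 = t * v1 := by
    intro g hg
    by_cases h0 : v0 = 0
    · have h1 : v1 ≠ 0 := by rcases hv with hv | hv; exact absurd h0 hv; exact hv
      refine ⟨(g.1 1 0 * v0 + g.1 1 1 * v1) / v1, ?_, by field_simp⟩
      field_simp; linarith
    · refine ⟨(g.1 0 0 * v0 + g.1 0 1 * v1) / v0, by field_simp, ?_⟩
      field_simp; linarith
  intro g hg
  induction hg using Subgroup.closure_induction with
  | mem x hx => exact h x hx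
  | one => simp; ring
  | mul x y _ _ hx hy =>
    obtain ⟨t, h1, h2⟩ := eig x hx
    obtain ⟨s, h3, h4⟩ := eig y hy
    simp only [sl_mul00, sl_mul10, sl_mul11, sl_mul01]
    linear_combination (v0 * x.1 1 0 - v1 * x.1 0 0) * h3 + (v0 * x.1 1 1 - v1 * x.1 0 1) * h4 + s * hx
  | inv x _ hx =>
    simp only [sl_inv00, sl_inv01, sl_inv10, sl_inv11]
    linear_combination -hx

lemma nilp_line (A : Set SL2) (p q r : ℝ) (hdet : p ^ 2 + q * r = 0) (hne : ¬ (p = 0 ∧ q = 0 ∧ r = 0))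
    (hN : ∀ B ∈ A, p * B.1 0 0 + q * B.1 1 0 + r * B.1 0 1 - p * B.1 1 1 = 0) :
    IsSolvable (Subgroup.closure A) := by
  by_cases hq0 : q = 0
  · have hp0 : p = 0 := by rw [hq0] at hdet; simpa using hdet
    have hr0 : r ≠ 0 := fun h => hne ⟨hp0, hq0, h⟩
    apply line_closure A 0 1 (Or.inr one_ne_zero)
    intro g hg
    have := hN g hg
    rw [hp0, hq0] at this
    have : g.1 0 1 = 0 := by
      have h : r * g.1 0 1 = 0 := by linarith
      simpa [hr0] using h
    rw [this]; ring
  · apply line_closure A q (-p) (Or.inl hq0)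
    intro g hg
    linear_combination q * hN g hg - g.1 0 1 * hdet

lemma semi_hyp (S : Submonoid SL2) (hS : ¬ IsSolvable (Subgroup.closure (S : Set SL2)))
    (hunb : ∀ C : ℝ, ∃ s ∈ S, C ≤ nm s) : ∃ a ∈ S, 2 < |tr2 a| := by
  by_contra hcon
  push Not at hcon
  apply hS
  choose s hsS hs using fun n : ℕ => hunb (n + 1)
  have hpos : ∀ n, 0 < nm (s n) := fun n => lt_of_lt_of_le one_pos (nm_ge_one _)
  let x : ℕ → (Fin 2 → Fin 2 → ℝ) := fun n i j => (s n).1 i j / nm (s n)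
  have hx : ∀ n, x n ∈ Metric.closedBall (0 : Fin 2 → Fin 2 → ℝ) 1 := by
    intro n
    rw [mem_closedBall_zero_iff, pi_norm_le_iff_of_nonneg zero_le_one]
    intro i
    rw [pi_norm_le_iff_of_nonneg zero_le_one]
    intro j
    simp only [x, Real.norm_eq_abs, abs_div, abs_of_pos (hpos n)]
    rw [div_le_one (hpos n)]
    have := abs_nonneg ((s n).1 0 0)
    have := abs_nonneg ((s n).1 0 1)
    have := abs_nonneg ((s n).1 1 0)
    have := abs_nonneg ((s n).1 1 1)
    unfold nm
    fin_cases i <;> fin_cases j <;> simp only [Fin.zero_eta, Fin.mk_one, Fin.isValue] <;> linarith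
  obtain ⟨L, -, φ, hφ, hL⟩ := (isCompact_closedBall (0 : Fin 2 → Fin 2 → ℝ) 1).tendsto_subseq hx
  have hij : ∀ i j, Tendsto (fun n => (s (φ n)).1 i j / nm (s (φ n))) atTop (nhds (L i j)) := by
    intro i j
    exact (tendsto_pi_nhds.mp ((tendsto_pi_nhds.mp hL) i)) j
  have hnm : Tendsto (fun n => nm (s (φ n))) atTop atTop := by
    apply tendsto_atTop_mono (fun n => hs (φ n))
    exact (tendsto_natCast_atTop_atTop.comp hφ.tendsto_atTop).atTop_add tendsto_const_nhds
  have hinv : Tendsto (fun n => (nm (s (φ n)))⁻¹) atTop (nhds 0) := tendsto_inv_atTop_zero.comp hnm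
  have hsum : |L 0 0| + |L 0 1| + |L 1 0| + |L 1 1| = 1 := by
    have h1 := (((hij 0 0).abs.add (hij 0 1).abs).add (hij 1 0).abs).add (hij 1 1).abs
    refine tendsto_nhds_unique h1 ?_
    refine tendsto_const_nhds.congr fun n => ?_
    have := hpos (φ n)
    simp only [abs_div, abs_of_pos this]
    rw [← add_div, ← add_div, ← add_div]
    exact (div_self this.ne').symm
  have hdet : L 0 0 * L 1 1 - L 0 1 * L 1 0 = 0 := by
    have h1 := ((hij 0 0).mul (hij 1 1)).sub ((hij 0 1).mul (hij 1 0))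
    refine tendsto_nhds_unique h1 ?_
    have h2 := hinv.mul hinv
    rw [mul_zero] at h2
    refine h2.congr fun n => ?_
    have := hpos (φ n)
    have hd := sl_det (s (φ n))
    field_simp
    exact hd.symm
  have htr : ∀ t ∈ S, L 0 0 * t.1 0 0 + L 0 1 * t.1 1 0 + L 1 0 * t.1 0 1 + L 1 1 * t.1 1 1 = 0 := by
    intro t ht
    have h1 := ((((hij 0 0).mul_const (t.1 0 0)).add ((hij 0 1).mul_const (t.1 1 0))).add
      ((hij 1 0).mul_const (t.1 0 1))).add ((hij 1 1).mul_const (t.1 1 1))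
    refine tendsto_nhds_unique h1 ?_
    have h2 := hinv.const_mul 2
    rw [mul_zero] at h2
    refine squeeze_zero_norm (fun n => ?_) h2
    have h3 := hcon _ (S.mul_mem (hsS (φ n)) ht)
    have := hpos (φ n)
    have h4 : (s (φ n)).1 0 0 / nm (s (φ n)) * t.1 0 0 + (s (φ n)).1 0 1 / nm (s (φ n)) * t.1 1 0
      + (s (φ n)).1 1 0 / nm (s (φ n)) * t.1 0 1 + (s (φ n)).1 1 1 / nm (s (φ n)) * t.1 1 1
       = tr2 (s (φ n) * t) * (nm (s (φ n)))⁻¹ := by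
      simp only [tr2, sl_mul00, sl_mul11]
      field_simp
      ring
    rw [h4, Real.norm_eq_abs, abs_mul, abs_of_pos (inv_pos.mpr this)]
    gcongr
  have h1 := htr 1 S.one_mem
  simp only [sl_one00, sl_one01, sl_one10, sl_one11] at h1
  have hL11 : L 1 1 = - L 0 0 := by linarith
  rw [hL11] at hdet
  apply nilp_line _ (L 0 0) (L 0 1) (L 1 0) (by linear_combination -hdet)
  · rintro ⟨h1, h2, h3⟩
    rw [hL11, h1, h2, h3] at hsum
    simp at hsum
  · intro B hB
    have := htr B hB
    rw [hL11] at this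
    linarith

lemma torus_closure (A : Set SL2)
    (h : ∀ g ∈ A, (g.1 0 1 = 0 ∧ g.1 1 0 = 0) ∨ (g.1 0 0 = 0 ∧ g.1 1 1 = 0)) :
    IsSolvable (Subgroup.closure A) := by
  apply solv_torus _ 1
  intro g hg
  simp only [one_mul, inv_one, mul_one]
  induction hg using Subgroup.closure_induction with
  | mem x hx => exact h x hx
  | one => simp
  | mul x y _ _ hx hy =>
    simp only [sl_mul00, sl_mul10, sl_mul11, sl_mul01]
    rcases hx with ⟨h1, h2⟩ | ⟨h1, h2⟩ <;> rcases hy with ⟨h3, h4⟩ | ⟨h3, h4⟩ <;>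
      simp [h1, h2, h3, h4]
  | inv x _ hx =>
    simp only [sl_inv00, sl_inv01, sl_inv10, sl_inv11]
    rcases hx with ⟨h1, h2⟩ | ⟨h1, h2⟩ <;> simp [h1, h2]

lemma generic_aux (S : Submonoid SL2) (hS : ¬ IsSolvable (Subgroup.closure (S : Set SL2)))
    (a : SL2) (haS : a ∈ S) (l : ℝ) (hl : 1 < |l|) (a00 : a.1 0 0 = l) (a01 : a.1 0 1 = 0)
    (a10 : a.1 1 0 = 0) (a11 : a.1 1 1 = l⁻¹) :
    ∃ s ∈ S, s.1 0 0 ≠ 0 ∧ s.1 0 1 ≠ 0 ∧ s.1 1 0 ≠ 0 := by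
  by_contra hcon
  push Not at hcon
  have hl0 : l ≠ 0 := by rintro rfl; simp at hl; linarith
  have hl2 : l ^ 2 ≠ 1 := by
    intro h
    have := sq_abs l
    nlinarith
  apply hS
  by_cases hx : ∀ x ∈ S, x.1 0 1 = 0
  · apply line_closure _ 0 1 (Or.inr one_ne_zero)
    intro g hg
    rw [hx g hg]; ring
  by_cases hy : ∀ x ∈ S, x.1 1 0 = 0
  · apply line_closure _ 1 0 (Or.inl one_ne_zero)
    intro g hg
    rw [hy g hg]; ring
  push Not at hx hy
  obtain ⟨y, hyS, hy⟩ := hy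
  have gen : ∀ u v : ℝ, u ≠ 0 → ¬ (u + v = 0 ∧ u * l + v * l⁻¹ = 0) := by
    rintro u v hu ⟨h1, h2⟩
    field_simp at h2
    have : u * (l ^ 2 - 1) = 0 := by linear_combination h2 - h1
    rcases mul_eq_zero.mp this with h | h
    · exact hu h
    · exact hl2 (by linarith)
  have hx00 : ∀ x ∈ S, x.1 0 1 ≠ 0 → x.1 0 0 = 0 := by
    intro x hxS hx
    by_contra h00
    have h10 : x.1 1 0 = 0 := hcon x hxS h00 hx
    have hd := sl_det x
    rw [h10] at hd
    have h11 : x.1 1 1 ≠ 0 := by rintro h; rw [h] at hd; simp at hd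
    have hz := hcon _ (S.mul_mem hxS hyS)
    have hz' := hcon _ (S.mul_mem (S.mul_mem hxS haS) hyS)
    simp only [sl_mul00, sl_mul10, sl_mul11, sl_mul01, a00, a01, a10, a11, h10, mul_zero, zero_mul, add_zero, zero_add] at hz hz'
    by_cases hy00 : y.1 0 0 = 0
    · have hd := sl_det y
      rw [hy00] at hd
      have hy01 : y.1 0 1 ≠ 0 := by rintro h; rw [h] at hd; simp at hd
      simp only [hy00, mul_zero, zero_add] at hz hz'
      apply gen (x.1 0 0 * y.1 0 1) (x.1 0 1 * y.1 1 1) (mul_ne_zero h00 hy01)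
      constructor
      · by_contra h
        exact mul_ne_zero h11 hy (hz (mul_ne_zero hx hy) h)
      · by_contra h
        exact mul_ne_zero (mul_ne_zero h11 (inv_ne_zero hl0)) hy
          (hz' (mul_ne_zero (mul_ne_zero hx (inv_ne_zero hl0)) hy) (fun h' => h (by linear_combination h')))
    · have hy01 : y.1 0 1 = 0 := by
        by_contra h
        exact hy (hcon y hyS hy00 h)
      have hd := sl_det y
      rw [hy01] at hd
      have hy11 : y.1 1 1 ≠ 0 := by rintro h; rw [h] at hd; simp at hd
      simp only [hy01, mul_zero, zero_add] at hz hz'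
      apply gen (x.1 0 0 * y.1 0 0) (x.1 0 1 * y.1 1 0) (mul_ne_zero h00 hy00)
      constructor
      · by_contra h
        exact mul_ne_zero h11 hy (hz h (mul_ne_zero hx hy11))
      · by_contra h
        exact mul_ne_zero (mul_ne_zero h11 (inv_ne_zero hl0)) hy
          (hz' (fun h' => h (by linear_combination h')) (mul_ne_zero (mul_ne_zero hx (inv_ne_zero hl0)) hy11))
  have hx11 : ∀ x ∈ S, x.1 0 1 ≠ 0 → x.1 1 1 = 0 := by
    intro x hxS hx
    have h00 := hx00 x hxS hx
    by_contra h11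
    have hd := sl_det x
    rw [h00] at hd
    have h10 : x.1 1 0 ≠ 0 := by rintro h; rw [h] at hd; simp at hd
    have hz := hcon _ (S.mul_mem hxS hxS)
    simp only [sl_mul00, sl_mul10, sl_mul11, sl_mul01, h00, mul_zero, zero_mul, add_zero, zero_add] at hz
    exact mul_ne_zero h11 h10 (hz (mul_ne_zero hx h10) (mul_ne_zero hx h11))
  obtain ⟨x, hxS, hx⟩ := hx
  apply torus_closure
  intro g hg
  by_cases h01 : g.1 0 1 = 0
  · left
    refine ⟨h01, ?_⟩
    by_contra h10
    have hd := sl_det g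
    rw [h01] at hd
    have g00 : g.1 0 0 ≠ 0 := by rintro h; rw [h] at hd; simp at hd
    have g11 : g.1 1 1 ≠ 0 := by rintro h; rw [h] at hd; simp at hd
    have x00 := hx00 x hxS hx
    have x11 := hx11 x hxS hx
    have hd := sl_det x
    rw [x00] at hd
    have x10 : x.1 1 0 ≠ 0 := by rintro h; rw [h] at hd; simp at hd
    have hz := hcon _ (S.mul_mem hxS hg)
    simp only [sl_mul00, sl_mul10, sl_mul11, sl_mul01, x00, x11, h01, mul_zero, zero_mul, add_zero, zero_add] at hz
    exact mul_ne_zero x10 g00 (hz (mul_ne_zero hx h10) (mul_ne_zero hx g11))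
  · right
    exact ⟨hx00 g hg h01, hx11 g hg h01⟩

lemma generic_exists (S : Submonoid SL2) (hS : ¬ IsSolvable (Subgroup.closure (S : Set SL2)))
    (T a : SL2) (haS : a ∈ S) (l : ℝ) (hl : 1 < |l|) (a00 : (T * a * T⁻¹).1 0 0 = l)
    (a01 : (T * a * T⁻¹).1 0 1 = 0)
    (a10 : (T * a * T⁻¹).1 1 0 = 0) (a11 : (T * a * T⁻¹).1 1 1 = l⁻¹) :
    ∃ s ∈ S, (T * s * T⁻¹).1 0 0 ≠ 0 ∧ (T * s * T⁻¹).1 0 1 ≠ 0 ∧ (T * s * T⁻¹).1 1 0 ≠ 0 := by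
  have hS' : ¬ IsSolvable (Subgroup.closure
      ((S.map (MulAut.conj T).toMonoidHom : Submonoid SL2) : Set SL2)) := by
    intro h
    apply hS
    apply solv_conj _ T
    rw [MonoidHom.map_closure]
    exact h
  obtain ⟨_, ⟨s, hs, rfl⟩, h⟩ := generic_aux _ hS' (T * a * T⁻¹) ⟨a, haS, rfl⟩ l hl a00 a01 a10 a11
  exact ⟨s, hs, h⟩

instance : BorelSpace SL2 := ⟨rfl⟩
instance : BorelSpace PX := ⟨rfl⟩
instance : SecondCountableTopology (Matrix (Fin 2) (Fin 2) ℝ) :=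
  inferInstanceAs (SecondCountableTopology (Fin 2 → Fin 2 → ℝ))
instance : TopologicalSpace.MetrizableSpace (Matrix (Fin 2) (Fin 2) ℝ) :=
  inferInstanceAs (TopologicalSpace.MetrizableSpace (Fin 2 → Fin 2 → ℝ))
instance : SecondCountableTopology SL2 := TopologicalSpace.Subtype.secondCountableTopology _
instance : TopologicalSpace.MetrizableSpace SL2 :=
  TopologicalSpace.MetrizableSpace.subtype _

lemma cont_entry (i j : Fin 2) : Continuous fun g : SL2 => g.1 i j :=
  (continuous_subtype_val (p := fun A : Matrix (Fin 2) (Fin 2) ℝ => A.det = 1)).matrix_elem i j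

lemma cont_sl {X : Type*} [TopologicalSpace X] {F : X → SL2} (h : ∀ i j, Continuous fun x => (F x).1 i j) :
    Continuous F := by
  apply Continuous.subtype_mk (p := fun A : Matrix (Fin 2) (Fin 2) ℝ => A.det = 1) (f := fun x => (F x).1)
  exact continuous_matrix h

instance : ContinuousMul SL2 := by
  constructor
  apply cont_sl
  intro i j
  have h1 := fun i j => (cont_entry i j).comp (continuous_fst (X := SL2) (Y := SL2))
  have h2 := fun i j => (cont_entry i j).comp (continuous_snd (X := SL2) (Y := SL2))
  fin_cases i <;> fin_cases j
  · exact (((h1 0 0).mul (h2 0 0)).add ((h1 0 1).mul (h2 1 0))).congr fun p => (sl_mul00 _ _).symm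
  · exact (((h1 0 0).mul (h2 0 1)).add ((h1 0 1).mul (h2 1 1))).congr fun p => (sl_mul01 _ _).symm
  · exact (((h1 1 0).mul (h2 0 0)).add ((h1 1 1).mul (h2 1 0))).congr fun p => (sl_mul10 _ _).symm
  · exact (((h1 1 0).mul (h2 0 1)).add ((h1 1 1).mul (h2 1 1))).congr fun p => (sl_mul11 _ _).symm

instance : ContinuousInv SL2 := by
  constructor
  apply cont_sl
  intro i j
  fin_cases i <;> fin_cases j
  · exact (cont_entry 1 1).congr fun p => (sl_inv00 _).symm
  · exact (cont_entry 0 1).neg.congr fun p => (sl_inv01 _).symm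
  · exact (cont_entry 1 0).neg.congr fun p => (sl_inv10 _).symm
  · exact (cont_entry 0 0).congr fun p => (sl_inv11 _).symm

instance : MeasurableMul₂ SL2 := ⟨continuous_mul.measurable⟩

/-- row action -/
def ra (u : ℝ × ℝ) (g : SL2) : ℝ × ℝ :=
  (u.1 * g.1 0 0 + u.2 * g.1 1 0, u.1 * g.1 0 1 + u.2 * g.1 1 1)

lemma ra_one (u : ℝ × ℝ) : ra u 1 = u := by simp [ra]

lemma ra_mul (u : ℝ × ℝ) (g h : SL2) : ra u (g * h) = ra (ra u g) h := by
  ext <;> simp only [ra, sl_mul00, sl_mul10, sl_mul11, sl_mul01] <;> ring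

lemma ra_smul (c : ℝ) (u : ℝ × ℝ) (g : SL2) : ra (c • u) g = c • ra u g := by
  ext <;> simp only [ra, Prod.smul_fst, Prod.smul_snd, smul_eq_mul] <;> ring

lemma ra_neg (u : ℝ × ℝ) (g : SL2) : ra (-u) g = - ra u g := by
  ext <;> simp only [ra, Prod.fst_neg, Prod.snd_neg] <;> ring

lemma ra_sub (u v : ℝ × ℝ) (g : SL2) : ra (u - v) g = ra u g - ra v g := by
  ext <;> simp only [ra, Prod.fst_sub, Prod.snd_sub] <;> ring

lemma ra_inv (u : ℝ × ℝ) (g : SL2) : ra (ra u g) g⁻¹ = u := by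
  rw [← ra_mul, mul_inv_cancel, ra_one]

lemma ra_ne {u : ℝ × ℝ} (hu : u ≠ 0) (g : SL2) : ra u g ≠ 0 := by
  intro h
  apply hu
  rw [← ra_inv u g, h]
  simp [ra]

lemma nm_inv (g : SL2) : nm g⁻¹ = nm g := by
  simp only [nm, sl_inv00, sl_inv01, sl_inv10, sl_inv11, abs_neg]; ring

lemma nm_pos (g : SL2) : 0 < nm g := lt_of_lt_of_le one_pos (nm_ge_one g)

lemma ra_norm_le (u : ℝ × ℝ) (g : SL2) : ‖ra u g‖ ≤ nm g * ‖u‖ := by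
  have h1 : |u.1| ≤ ‖u‖ := norm_fst_le u
  have h2 : |u.2| ≤ ‖u‖ := norm_snd_le u
  have a := abs_nonneg (g.1 0 0)
  have b := abs_nonneg (g.1 0 1)
  have c := abs_nonneg (g.1 1 0)
  have d := abs_nonneg (g.1 1 1)
  rw [Prod.norm_def]
  unfold nm ra
  simp only [Real.norm_eq_abs]
  apply max_le
  · refine (abs_add_le _ _).trans ?_
    rw [abs_mul, abs_mul]
    nlinarith [mul_le_mul_of_nonneg_right h1 a, mul_le_mul_of_nonneg_right h2 c, norm_nonneg u,
      mul_nonneg b (norm_nonneg u), mul_nonneg d (norm_nonneg u)]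
  · refine (abs_add_le _ _).trans ?_
    rw [abs_mul, abs_mul]
    nlinarith [mul_le_mul_of_nonneg_right h1 b, mul_le_mul_of_nonneg_right h2 d, norm_nonneg u,
      mul_nonneg a (norm_nonneg u), mul_nonneg c (norm_nonneg u)]

lemma ra_norm_ge (u : ℝ × ℝ) (g : SL2) : ‖u‖ ≤ nm g * ‖ra u g‖ := by
  have := ra_norm_le (ra u g) g⁻¹
  rwa [ra_inv, nm_inv] at this

lemma cont_ra : Continuous fun p : (ℝ × ℝ) × SL2 => ra p.1 p.2 := by
  unfold ra
  have h2 := fun i j => (cont_entry i j).comp (continuous_snd (X := ℝ × ℝ) (Y := SL2))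
  have h3 := fun i j => (h2 i j)
  simp only [Function.comp_def] at h3
  have := h3 0 0
  have := h3 0 1
  have := h3 1 0
  have := h3 1 1
  fun_prop

lemma cont_ra_right (u : ℝ × ℝ) : Continuous fun g => ra u g :=
  cont_ra.comp (by fun_prop : Continuous fun g : SL2 => (u, g))

lemma cont_ra_left (g : SL2) : Continuous fun u => ra u g :=
  cont_ra.comp (by fun_prop : Continuous fun u : ℝ × ℝ => (u, g))

lemma cont_nm : Continuous nm := by
  unfold nm
  exact (((cont_entry 0 0).abs.add (cont_entry 0 1).abs).add (cont_entry 1 0).abs).add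
    (cont_entry 1 1).abs

lemma meas_ra : Measurable fun p : (ℝ × ℝ) × SL2 => ra p.1 p.2 := cont_ra.measurable

/-- closed sets of full measure contain the support -/
lemma supp_sub_closed (μ : Measure SL2) (C : Set SL2) (hC : IsClosed C) (h : μ Cᶜ = 0) :
    measSupp μ ⊆ C := by
  intro g hg
  by_contra hgC
  have := hg Cᶜ hC.isOpen_compl hgC
  exact this.ne' h

lemma supp_closed (μ : Measure SL2) : IsClosed (measSupp μ) := by
  rw [← isOpen_compl_iff, isOpen_iff_forall_mem_open]
  intro g hg
  simp only [measSupp, Set.mem_compl_iff, Set.mem_setOf_eq, not_forall, not_lt, nonpos_iff_eq_zero] at hg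
  obtain ⟨U, hU, hgU, h0⟩ := hg
  refine ⟨U, ?_, hU, hgU⟩
  intro x hx hxs
  exact (hxs U hU hx).ne' h0

lemma supp_full (μ : Measure SL2) : μ (measSupp μ)ᶜ = 0 := by
  apply measure_null_of_locally_null
  intro g hg
  simp only [measSupp, Set.mem_compl_iff, Set.mem_setOf_eq, not_forall, not_lt, nonpos_iff_eq_zero] at hg
  obtain ⟨U, hU, hgU, h0⟩ := hg
  exact ⟨U, mem_nhdsWithin_of_mem_nhds (hU.mem_nhds hgU), h0⟩


/-- convolution powers -/
def mus (μ : Measure SL2) : ℕ → Measure SL2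
  | 0 => Measure.dirac 1
  | n + 1 => (μ.prod (mus μ n)).map fun p => p.1 * p.2

instance mus_prob (μ : Measure SL2) [IsProbabilityMeasure μ] (n : ℕ) : IsProbabilityMeasure (mus μ n) := by
  induction n with
  | zero => unfold mus; infer_instance
  | succ n ih =>
    unfold mus
    exact Measure.isProbabilityMeasure_map measurable_mul.aemeasurable

/-- Green measure -/
def green (μ : Measure SL2) : Measure SL2 := Measure.sum (mus μ)

instance green_sfinite (μ : Measure SL2) [IsProbabilityMeasure μ] : SFinite (green μ) := by
  unfold green; infer_instance

section
variable (μ : Measure SL2) [IsProbabilityMeasure μ]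

lemma lint_mus_zero {F : SL2 → ℝ≥0∞} (hF : Measurable F) : ∫⁻ g, F g ∂(mus μ 0) = F 1 := by
  unfold mus
  exact lintegral_dirac' _ hF

lemma lint_mus_succ {F : SL2 → ℝ≥0∞} (hF : Measurable F) (n : ℕ) :
    ∫⁻ g, F g ∂(mus μ (n + 1)) = ∫⁻ g, ∫⁻ h, F (g * h) ∂(mus μ n) ∂μ := by
  conv_lhs => rw [mus]
  rw [lintegral_map hF measurable_mul, lintegral_prod (fun p : SL2 × SL2 => F (p.1 * p.2)) (hF.comp measurable_mul).aemeasurable]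

lemma lint_green (F : SL2 → ℝ≥0∞) : ∫⁻ g, F g ∂(green μ) = ∑' n, ∫⁻ g, F g ∂(mus μ n) := by
  unfold green
  rw [lintegral_sum_measure]

lemma meas_lint_mus {F : SL2 → ℝ≥0∞} (hF : Measurable F) (n : ℕ) :
    Measurable fun g => ∫⁻ h, F (g * h) ∂(mus μ n) :=
  (hF.comp measurable_mul).lintegral_prod_right'

lemma meas_lint_green {F : SL2 → ℝ≥0∞} (hF : Measurable F) :
    Measurable fun g => ∫⁻ h, F (g * h) ∂(green μ) :=
  (hF.comp measurable_mul).lintegral_prod_right'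

lemma meas_lint_mu {F : SL2 → ℝ≥0∞} (hF : Measurable F) :
    Measurable fun g => ∫⁻ h, F (g * h) ∂μ :=
  (hF.comp measurable_mul).lintegral_prod_right'

lemma green_eq {F : SL2 → ℝ≥0∞} (hF : Measurable F) :
    ∫⁻ g, F g ∂(green μ) = F 1 + ∫⁻ g, ∫⁻ h, F (g * h) ∂(green μ) ∂μ := by
  rw [lint_green, tsum_eq_zero_add' ENNReal.summable, lint_mus_zero μ hF]
  congr 1
  simp_rw [lint_green, lint_mus_succ μ hF]
  rw [lintegral_tsum]
  intro n
  exact (meas_lint_mus μ hF n).aemeasurable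

lemma riesz_n {s Y : SL2 → ℝ≥0∞} (hs : Measurable s) (hY : Measurable Y)
    (h : ∀ b, s b + ∫⁻ g, Y (b * g) ∂μ ≤ Y b) (n : ℕ) : ∀ b,
    ∑ i ∈ Finset.range n, ∫⁻ g, s (b * g) ∂(mus μ i) + ∫⁻ g, Y (b * g) ∂(mus μ n) ≤ Y b := by
  induction n with
  | zero =>
    intro b
    rw [Finset.range_zero, Finset.sum_empty, zero_add, lint_mus_zero μ (F := fun g => Y (b * g)) (hY.comp (measurable_const_mul b))]
    simp
  | succ n ih =>
    intro b
    have hsb : Measurable fun g => s (b * g) := hs.comp (measurable_const_mul b)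
    have hYb : Measurable fun g => Y (b * g) := hY.comp (measurable_const_mul b)
    rw [Finset.sum_range_succ', lint_mus_zero μ hsb, lint_mus_succ μ hYb]
    simp_rw [lint_mus_succ μ hsb]
    rw [← lintegral_finsetSum _ (fun i _ => meas_lint_mus μ hsb i), mul_one, add_right_comm,
      ← lintegral_add_left (Finset.measurable_sum _ fun i _ => meas_lint_mus μ hsb i), add_comm]
    refine le_trans ?_ (h b)
    gcongr with g
    simpa only [mul_assoc] using ih (b * g)

lemma riesz {s Y : SL2 → ℝ≥0∞} (hs : Measurable s) (hY : Measurable Y)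
    (h : ∀ b, s b + ∫⁻ g, Y (b * g) ∂μ ≤ Y b) (b : SL2) :
    ∫⁻ g, s (b * g) ∂(green μ) ≤ Y b := by
  rw [lint_green, ENNReal.tsum_eq_iSup_nat]
  refine iSup_le fun n => ?_
  exact le_trans le_self_add (riesz_n μ hs hY h n b)

lemma superharm_n {Y : SL2 → ℝ≥0∞} (hY : Measurable Y)
    (h : ∀ b, ∫⁻ g, Y (b * g) ∂μ ≤ Y b) (n : ℕ) (b : SL2) :
    ∫⁻ g, Y (b * g) ∂(mus μ n) ≤ Y b := by
  have := riesz_n μ (s := fun _ => 0) measurable_const hY (by simpa using h) n b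
  simpa using this

lemma mus_supp (S : Submonoid SL2) (hSc : IsClosed (S : Set SL2)) (hS : measSupp μ ⊆ S) (n : ℕ) :
    mus μ n (S : Set SL2)ᶜ = 0 := by
  have hm : MeasurableSet (S : Set SL2)ᶜ := hSc.measurableSet.compl
  have hμ : ∀ᵐ g ∂μ, g ∈ S := by
    refine measure_mono_null ?_ (supp_full μ)
    intro g hg hg'
    exact hg (hS hg')
  induction n with
  | zero =>
    unfold mus
    rw [Measure.dirac_apply' _ hm]
    simp [S.one_mem]
  | succ n ih =>
    rw [← lintegral_indicator_one hm, lint_mus_succ μ (measurable_one.indicator hm)]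
    rw [lintegral_eq_zero_iff (meas_lint_mus μ (measurable_one.indicator hm) n)]
    filter_upwards [hμ] with g hg
    rw [Pi.zero_apply, lintegral_eq_zero_iff (f := fun h => (S : Set SL2)ᶜ.indicator 1 (g * h)) ((measurable_one.indicator hm).comp (measurable_const_mul g))]
    have : ∀ᵐ h ∂(mus μ n), h ∈ S := ih
    filter_upwards [this] with h hh
    simp [S.mul_mem hg hh]
end


/-- linear form at (x,1) -/
def dt (u : ℝ × ℝ) (x : ℝ) : ℝ := u.1 * x + u.2
def mx (x : ℝ) : ℝ := max |x| 1
def r0 (g : SL2) : ℝ × ℝ := (g.1 0 0, g.1 0 1)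
def r1 (g : SL2) : ℝ × ℝ := (g.1 1 0, g.1 1 1)
def mob (g : SL2) (x : ℝ) : ℝ := dt (r0 g) x / dt (r1 g) x

lemma mx_ge_one (x : ℝ) : 1 ≤ mx x := le_max_right _ _
lemma mx_pos (x : ℝ) : 0 < mx x := lt_of_lt_of_le one_pos (mx_ge_one x)
lemma abs_le_mx (x : ℝ) : |x| ≤ mx x := le_max_left _ _

lemma r0_ne (g : SL2) : r0 g ≠ 0 := by
  intro h
  have hd := sl_det g
  have h1 : g.1 0 0 = 0 := congrArg Prod.fst h
  have h2 : g.1 0 1 = 0 := congrArg Prod.snd h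
  rw [h1, h2] at hd; simp at hd

lemma r1_ne (g : SL2) : r1 g ≠ 0 := by
  intro h
  have hd := sl_det g
  have h1 : g.1 1 0 = 0 := congrArg Prod.fst h
  have h2 : g.1 1 1 = 0 := congrArg Prod.snd h
  rw [h1, h2] at hd; simp at hd

lemma r1_mul (g h : SL2) : r1 (g * h) = ra (r1 g) h := by
  ext <;> simp only [r1, ra, sl_mul10, sl_mul11]

lemma r0_mul (g h : SL2) : r0 (g * h) = ra (r0 g) h := by
  ext <;> simp only [r0, ra, sl_mul00, sl_mul01]

lemma dt_ra (u : ℝ × ℝ) (g : SL2) (x : ℝ) (hx : dt (r1 g) x ≠ 0) :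
    dt (ra u g) x = dt (r1 g) x * dt u (mob g x) := by
  have : dt (r1 g) x * mob g x = dt (r0 g) x := by unfold mob; field_simp
  have h2 : dt (r1 g) x * dt u (mob g x) = u.1 * (dt (r1 g) x * mob g x) + u.2 * dt (r1 g) x := by
    unfold dt; ring
  rw [h2, this]
  simp only [dt, ra, r0, r1]
  ring

lemma mob_mul (g h : SL2) (x : ℝ) (hx : dt (r1 h) x ≠ 0) : mob (g * h) x = mob g (mob h x) := by
  conv_lhs => unfold mob
  rw [r0_mul, r1_mul, dt_ra _ _ _ hx, dt_ra _ _ _ hx, mul_div_mul_left _ _ hx]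
  rfl

lemma mob_one (x : ℝ) : mob 1 x = x := by simp [mob, dt, r0, r1]

lemma dt_le (u : ℝ × ℝ) (x : ℝ) : |dt u x| ≤ 2 * ‖u‖ * mx x := by
  have h1 : |u.1| ≤ ‖u‖ := norm_fst_le u
  have h2 : |u.2| ≤ ‖u‖ := norm_snd_le u
  unfold dt
  refine (abs_add_le _ _).trans ?_
  rw [abs_mul]
  have := mul_le_mul h1 (abs_le_mx x) (abs_nonneg _) (norm_nonneg u)
  nlinarith [mx_ge_one x, norm_nonneg u]

lemma meas_dt : Measurable fun p : (ℝ × ℝ) × ℝ => dt p.1 p.2 := by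
  unfold dt; fun_prop
lemma cont_dt : Continuous fun p : (ℝ × ℝ) × ℝ => dt p.1 p.2 := by
  unfold dt; fun_prop
lemma cont_mx : Continuous mx := by
  unfold mx; fun_prop
lemma cont_r0 : Continuous r0 := (cont_entry 0 0).prodMk (cont_entry 0 1)
lemma cont_r1 : Continuous r1 := (cont_entry 1 0).prodMk (cont_entry 1 1)
lemma meas_mob : Measurable fun p : SL2 × ℝ => mob p.1 p.2 := by
  unfold mob
  exact (meas_dt.comp ((cont_r0.measurable.comp measurable_fst).prodMk measurable_snd)).div
    (meas_dt.comp ((cont_r1.measurable.comp measurable_fst).prodMk measurable_snd))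
lemma meas_mob' (g : SL2) : Measurable (mob g) := meas_mob.comp (measurable_const.prodMk measurable_id)

section
variable (μ : Measure SL2) [IsProbabilityMeasure μ] (τ : Measure ℝ) [IsProbabilityMeasure τ]
  [NullSingletonClass τ]

lemma dt_ae {u : ℝ × ℝ} (hu : u ≠ 0) : ∀ᵐ x ∂τ, dt u x ≠ 0 := by
  have : {x | ¬ (dt u x ≠ 0)}.Subsingleton := by
    intro x hx y hy
    simp only [ne_eq, not_not, Set.mem_setOf_eq, dt] at hx hy
    by_cases h : u.1 = 0
    · exfalso; apply hu
      ext
      · exact h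
      · simpa [h] using hx
    · have : u.1 * (x - y) = 0 := by linarith
      rcases mul_eq_zero.mp this with h' | h'
      · exact absurd h' h
      · linarith
  exact this.measure_zero τ

lemma norm_ge_sub (u : ℝ × ℝ) (u' : ℝ × ℝ) (x : ℝ) : |dt u x| ≤ |dt u' x| + 2 * ‖u - u'‖ * mx x := by
  have h : dt u x = dt u' x + dt (u - u') x := by simp [dt]; ring
  rw [h]
  exact (abs_add_le _ _).trans (add_le_add le_rfl (dt_le _ _))

lemma nonconc {ε : ℝ≥0∞} (hε : 0 < ε) : ∃ κ > (0:ℝ), ∀ u : ℝ × ℝ, u ≠ 0 →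
    τ {x | |dt u x| ≤ κ * ‖u‖ * mx x} ≤ ε := by
  have key : ∃ κ > (0:ℝ), ∀ u ∈ Metric.sphere (0 : ℝ × ℝ) 1, τ {x | |dt u x| ≤ κ * mx x} ≤ ε := by
    refine (isCompact_sphere (0 : ℝ × ℝ) 1).induction_on
      (p := fun V => ∃ κ > (0:ℝ), ∀ u ∈ V, τ {x | |dt u x| ≤ κ * mx x} ≤ ε) ?_ ?_ ?_ ?_
    · exact ⟨1, one_pos, by simp⟩
    · rintro s t hst ⟨κ, hκ, h⟩
      exact ⟨κ, hκ, fun u hu => h u (hst hu)⟩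
    · rintro s t ⟨κ, hκ, h⟩ ⟨κ', hκ', h'⟩
      refine ⟨min κ κ', lt_min hκ hκ', ?_⟩
      rintro u (hu | hu)
      · refine le_trans (measure_mono ?_) (h u hu)
        intro x hx
        exact le_trans hx (mul_le_mul_of_nonneg_right (min_le_left _ _) (mx_pos x).le)
      · refine le_trans (measure_mono ?_) (h' u hu)
        intro x hx
        exact le_trans hx (mul_le_mul_of_nonneg_right (min_le_right _ _) (mx_pos x).le)
    · intro u hu
      have hu0 : u ≠ 0 := by rintro rfl; simp at hu
      let A : ℕ → Set ℝ := fun n => {x | |dt u x| ≤ 3 * ((1:ℝ) / (n + 1)) * mx x}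
      have hA : Tendsto (fun n => τ (A n)) atTop (nhds (τ (⋂ n, A n))) := by
        apply tendsto_measure_iInter_atTop
        · intro n
          apply MeasurableSet.nullMeasurableSet
          apply measurableSet_le
          · exact (meas_dt.comp (measurable_const.prodMk measurable_id)).abs
          · exact cont_mx.measurable.const_mul _
        · intro m n hmn x hx
          have hx' : |dt u x| ≤ 3 * ((1:ℝ) / (n + 1)) * mx x := hx
          refine le_trans hx' ?_
          apply mul_le_mul_of_nonneg_right _ (mx_pos x).le
          have := Nat.one_div_le_one_div (α := ℝ) hmn
          linarith
        · exact ⟨0, measure_ne_top _ _⟩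
      have h0 : τ (⋂ n, A n) = 0 := by
        refine measure_mono_null ?_ (dt_ae τ hu0)
        intro x hx
        simp only [Set.mem_compl_iff, Set.mem_setOf_eq, not_not]
        have h1 : ∀ n : ℕ, |dt u x| ≤ 3 * ((1:ℝ) / (n + 1)) * mx x := fun n => Set.mem_iInter.mp hx n
        have h2 : Tendsto (fun n : ℕ => 3 * ((1:ℝ) / (n + 1)) * mx x) atTop (nhds (3 * 0 * mx x)) :=
          (tendsto_one_div_add_atTop_nhds_zero_nat.const_mul 3).mul_const _
        have h3 := ge_of_tendsto' h2 h1
        simp only [mul_zero, zero_mul] at h3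
        simpa using abs_nonpos_iff.mp h3
      rw [h0] at hA
      obtain ⟨n, hn⟩ := (hA.eventually (Iic_mem_nhds hε)).exists
      refine ⟨Metric.ball u (1 / (n + 1)), mem_nhdsWithin_of_mem_nhds (Metric.ball_mem_nhds _ (by positivity)), 1 / (n + 1), by positivity, ?_⟩
      intro u' hu'
      refine le_trans (measure_mono ?_) hn
      intro x hx
      have h1 := norm_ge_sub u u' x
      have h2 : ‖u - u'‖ ≤ 1 / (n + 1) := by
        rw [Metric.mem_ball, dist_comm, dist_eq_norm] at hu'; exact hu'.le
      have h3 : 2 * ‖u - u'‖ * mx x ≤ 2 * (1 / (n + 1)) * mx x := by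
        apply mul_le_mul_of_nonneg_right _ (mx_pos x).le
        linarith
      simp only [Set.mem_setOf_eq, A] at hx ⊢
      linarith
  obtain ⟨κ, hκ, h⟩ := key
  refine ⟨κ, hκ, fun u hu => ?_⟩
  have hn : 0 < ‖u‖ := norm_pos_iff.mpr hu
  have := h (‖u‖⁻¹ • u) (by simp [norm_smul, hn.ne'])
  refine le_trans (measure_mono ?_) this
  intro x hx
  have h1 : dt (‖u‖⁻¹ • u) x = ‖u‖⁻¹ * dt u x := by simp [dt]; ring
  simp only [Set.mem_setOf_eq] at hx ⊢
  rw [h1, abs_mul, abs_of_pos (inv_pos.mpr hn), inv_mul_le_iff₀ hn]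
  linarith

variable (hst : (μ.prod τ).map (fun p => mob p.1 p.2) = τ)
include hst

lemma st_lint {F : ℝ → ℝ≥0∞} (hF : Measurable F) :
    ∫⁻ x, F x ∂τ = ∫⁻ g, ∫⁻ x, F (mob g x) ∂τ ∂μ := by
  conv_lhs => rw [← hst]
  rw [lintegral_map hF meas_mob, lintegral_prod (fun p : SL2 × ℝ => F (mob p.1 p.2))
    (hF.comp meas_mob).aemeasurable]

lemma st_lint_mul {F : ℝ → ℝ≥0∞} (hF : Measurable F) (b : SL2) :
    ∫⁻ x, F (mob b x) ∂τ = ∫⁻ g, ∫⁻ x, F (mob (b * g) x) ∂τ ∂μ := by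
  rw [st_lint μ τ hst (F := fun x => F (mob b x)) (hF.comp (meas_mob' b))]
  refine lintegral_congr fun g => lintegral_congr_ae ?_
  filter_upwards [dt_ae τ (r1_ne g)] with x hx
  rw [mob_mul _ _ _ hx]

lemma st_int_mul {F : ℝ → ℝ} (hF : Measurable F) (C : ℝ) (hC : ∀ x, |F x| ≤ C) (b : SL2) :
    ∫ x, F (mob b x) ∂τ = ∫ g, ∫ x, F (mob (b * g) x) ∂τ ∂μ := by
  have h1 : ∫ x, F (mob b x) ∂τ = ∫ g, ∫ x, F (mob b (mob g x)) ∂τ ∂μ := by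
    conv_lhs => rw [← hst]
    have hm : Measurable fun x => F (mob b x) := hF.comp (meas_mob' b)
    rw [integral_map meas_mob.aemeasurable hm.aestronglyMeasurable]
    rw [integral_prod]
    refine Integrable.of_bound (hm.comp meas_mob).aestronglyMeasurable C (Eventually.of_forall fun p => hC _)
  rw [h1]
  refine integral_congr_ae (Eventually.of_forall fun g => integral_congr_ae ?_)
  filter_upwards [dt_ae τ (r1_ne g)] with x hx
  rw [mob_mul _ _ _ hx]

/-- the harmonic function detecting bad group elements -/
lemma bad_exists {ε : ℝ≥0∞} (hε : 0 < ε) : ∃ δ > (0:ℝ), ∀ u : ℝ × ℝ, u ≠ 0 →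
    ∃ D : SL2 → ℝ≥0∞, Measurable D ∧ (∀ b, ∫⁻ g, D (b * g) ∂μ = D b) ∧
      D 1 ≤ ε ∧ ∀ b, ‖ra u b‖ < δ * (nm b * ‖u‖) → 1 ≤ 2 * D b := by
  obtain ⟨κ, hκ, hκ'⟩ := nonconc τ hε
  obtain ⟨κ₂, hκ₂, hκ₂'⟩ := nonconc τ (ε := 1 / 2) (by norm_num)
  refine ⟨κ * κ₂ / 8, by positivity, fun u hu => ?_⟩
  have hun : 0 < ‖u‖ := norm_pos_iff.mpr hu
  let A : Set ℝ := {x | |dt u x| ≤ κ * ‖u‖ * mx x}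
  have hAm : MeasurableSet A := by
    apply measurableSet_le
    · exact (meas_dt.comp (measurable_const.prodMk measurable_id)).abs
    · exact cont_mx.measurable.const_mul _
  have hFm : Measurable (A.indicator (1 : ℝ → ℝ≥0∞)) := measurable_one.indicator hAm
  refine ⟨fun b => ∫⁻ x, A.indicator 1 (mob b x) ∂τ, ?_, ?_, ?_, ?_⟩
  · exact (hFm.comp meas_mob).lintegral_prod_right'
  · intro b
    exact (st_lint_mul μ τ hst hFm b).symm
  · simp only [mob_one]
    rw [lintegral_indicator_one hAm]
    exact hκ' u hu
  · intro b hb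
    -- larger row
    obtain ⟨w, hw0, hwn, hwd⟩ : ∃ w : ℝ × ℝ, w ≠ 0 ∧ nm b ≤ 4 * ‖w‖ ∧
        ∀ x, dt (r1 b) x ≠ 0 → |dt w x| ≤ |dt (r1 b) x| * mx (mob b x) := by
      have e0 : ∀ x, dt (r1 b) x ≠ 0 → |dt (r0 b) x| ≤ |dt (r1 b) x| * mx (mob b x) := by
        intro x hx
        have : dt (r0 b) x = dt (r1 b) x * mob b x := by unfold mob; field_simp
        rw [this, abs_mul]
        exact mul_le_mul_of_nonneg_left (abs_le_mx _) (abs_nonneg _)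
      have e1 : ∀ x, dt (r1 b) x ≠ 0 → |dt (r1 b) x| ≤ |dt (r1 b) x| * mx (mob b x) := by
        intro x hx
        exact le_mul_of_one_le_right (abs_nonneg _) (mx_ge_one _)
      have a1 : |b.1 0 0| ≤ ‖r0 b‖ := norm_fst_le (r0 b)
      have a2 : |b.1 0 1| ≤ ‖r0 b‖ := norm_snd_le (r0 b)
      have a3 : |b.1 1 0| ≤ ‖r1 b‖ := norm_fst_le (r1 b)
      have a4 : |b.1 1 1| ≤ ‖r1 b‖ := norm_snd_le (r1 b)
      rcases le_total ‖r0 b‖ ‖r1 b‖ with h | h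
      · exact ⟨r1 b, r1_ne b, by unfold nm; linarith, e1⟩
      · exact ⟨r0 b, r0_ne b, by unfold nm; linarith, e0⟩
    have hm : MeasurableSet (mob b ⁻¹' A) := (meas_mob' b) hAm
    have hD : ∫⁻ x, A.indicator 1 (mob b x) ∂τ = τ (mob b ⁻¹' A) := by
      rw [← lintegral_indicator_one hm]; rfl
    have hcompl : τ (mob b ⁻¹' A)ᶜ ≤ 1 / 2 := by
      refine le_trans (measure_mono_ae ?_) (hκ₂' w hw0)
      filter_upwards [dt_ae τ (r1_ne b)] with x hx hxA
      have hxA' : κ * ‖u‖ * mx (mob b x) < |dt u (mob b x)| := by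
        by_contra hcon
        exact hxA (not_lt.mp hcon)
      have h1 := dt_ra u b x hx
      have h2 := dt_le (ra u b) x
      rw [h1, abs_mul] at h2
      have hd : 0 < |dt (r1 b) x| := abs_pos.mpr hx
      have h3 := mul_le_mul_of_nonneg_left hxA'.le hd.le
      have h4 := hwd x hx
      have h5 : κ * ‖u‖ * |dt w x| ≤ 2 * ‖ra u b‖ * mx x := by
        have := mul_le_mul_of_nonneg_left h4 (show 0 ≤ κ * ‖u‖ by positivity)
        linarith
      have h6 : 2 * ‖ra u b‖ * mx x ≤ 2 * (κ * κ₂ / 8 * (4 * ‖w‖ * ‖u‖)) * mx x := by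
        have := mx_pos x
        have h7 : ‖ra u b‖ ≤ κ * κ₂ / 8 * (4 * ‖w‖ * ‖u‖) := by
          refine hb.le.trans ?_
          gcongr
        gcongr
      have h8 : (κ * ‖u‖) * |dt w x| ≤ (κ * ‖u‖) * (κ₂ * ‖w‖ * mx x) := by
        linarith
      exact le_of_mul_le_mul_left h8 (by positivity)
    simp only [hD]
    have h9 : (1 : ℝ≥0∞) = τ (mob b ⁻¹' A) + τ (mob b ⁻¹' A)ᶜ := by
      rw [measure_add_measure_compl hm, measure_univ]
    have h10 : (1 : ℝ≥0∞) ≤ τ (mob b ⁻¹' A) + 1 / 2 := by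
      rw [h9]
      gcongr
      rw [← h9]; exact hcompl
    have h11 : (1:ℝ≥0∞) / 2 ≤ τ (mob b ⁻¹' A) := by
      have h12 : (1 : ℝ≥0∞) / 2 + 1 / 2 ≤ τ (mob b ⁻¹' A) + 1 / 2 := by
        rw [ENNReal.add_halves]; exact h10
      exact (ENNReal.add_le_add_iff_right (by norm_num)).mp h12
    calc (1 : ℝ≥0∞) = 2 * (1 / 2) := by rw [ENNReal.mul_div_cancel] <;> norm_num
      _ ≤ _ := by gcongr
end


def KK (u : ℝ × ℝ) (p : ℝ × ℝ) : ℝ := (p.1 - p.2) / (dt u p.1 * dt u p.2)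

def hh (τ : Measure ℝ) (u : ℝ × ℝ) : ℝ := ∫ p, Real.cos (KK u p) ∂(τ.prod τ)

lemma meas_KK : Measurable fun q : (ℝ × ℝ) × (ℝ × ℝ) => KK q.1 q.2 := by
  unfold KK dt; fun_prop

lemma KK_neg (u p) : KK (-u) p = KK u p := by
  unfold KK dt
  simp only [Prod.fst_neg, Prod.snd_neg]
  congr 1; ring

section
variable (μ : Measure SL2) [IsProbabilityMeasure μ] (τ : Measure ℝ) [IsProbabilityMeasure τ]
  [NullSingletonClass τ]

lemma cosKK_int (u) : Integrable (fun p => Real.cos (KK u p)) (τ.prod τ) := by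
  refine Integrable.of_bound (C := 1) ?_ (Eventually.of_forall fun p => Real.abs_cos_le_one _)
  exact (Real.measurable_cos.comp (meas_KK.comp (measurable_const.prodMk measurable_id))).aestronglyMeasurable

lemma hh_meas : Measurable (hh τ) := by
  unfold hh
  have : StronglyMeasurable (fun q : (ℝ × ℝ) × (ℝ × ℝ) => Real.cos (KK q.1 q.2)) :=
    (Real.measurable_cos.comp meas_KK).stronglyMeasurable
  exact this.integral_prod_right'.measurable

lemma hh_le_one (u) : hh τ u ≤ 1 := by
  have h := integral_mono (cosKK_int τ u) (integrable_const (1:ℝ)) (fun p => Real.cos_le_one _)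
  simpa [hh] using h

lemma hh_neg (u) : hh τ (-u) = hh τ u := by
  unfold hh; simp_rw [KK_neg]

lemma dt_ae_prod {u : ℝ × ℝ} (hu : u ≠ 0) : ∀ᵐ p ∂(τ.prod τ), dt u p.1 ≠ 0 ∧ dt u p.2 ≠ 0 := by
  have h1 : ∀ᵐ p ∂(τ.prod τ), dt u p.1 ≠ 0 := Measure.quasiMeasurePreserving_fst.ae (dt_ae τ hu)
  have h2 : ∀ᵐ p ∂(τ.prod τ), dt u p.2 ≠ 0 := Measure.quasiMeasurePreserving_snd.ae (dt_ae τ hu)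
  filter_upwards [h1, h2] with p a b using ⟨a, b⟩

lemma ne_ae_prod : ∀ᵐ p ∂(τ.prod τ), p.1 ≠ p.2 := by
  have hm : MeasurableSet {p : ℝ × ℝ | p.1 ≠ p.2} := (measurableSet_eq_fun measurable_fst measurable_snd).compl
  rw [Measure.ae_prod_iff_ae_ae hm]
  refine Eventually.of_forall fun x => ?_
  have : τ {x} = 0 := measure_singleton x
  filter_upwards [measure_eq_zero_iff_ae_notMem.mp this] with y hy
  intro h; exact hy h.symm

lemma hh_cont : ContinuousOn (hh τ) {0}ᶜ := by
  intro u hu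
  apply ContinuousAt.continuousWithinAt
  have hu0 : u ≠ 0 := hu
  unfold hh
  apply continuousAt_of_dominated (bound := fun _ => 1)
  · exact Eventually.of_forall fun v => (cosKK_int τ v).aestronglyMeasurable
  · exact Eventually.of_forall fun v => Eventually.of_forall fun p => Real.abs_cos_le_one _
  · exact integrable_const _
  · filter_upwards [dt_ae_prod τ hu0] with p hp
    apply Real.continuous_cos.continuousAt.comp
    unfold KK
    apply ContinuousAt.div continuousAt_const
    · unfold dt; fun_prop
    · exact mul_ne_zero hp.1 hp.2

def AA (τ : Measure ℝ) (b : SL2) : ℝ := ∫ x, Real.cos (mob b x) ∂τ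
def BB (τ : Measure ℝ) (b : SL2) : ℝ := ∫ x, Real.sin (mob b x) ∂τ

lemma mob_sub (b : SL2) (x y : ℝ) (hx : dt (r1 b) x ≠ 0) (hy : dt (r1 b) y ≠ 0) :
    mob b x - mob b y = KK (r1 b) (x, y) := by
  unfold mob KK
  rw [div_sub_div _ _ hx hy]
  congr 1
  have := sl_det b
  simp only [dt, r0, r1]
  linear_combination (x - y) * this

lemma hh_eq (b : SL2) : hh τ (r1 b) = AA τ b ^ 2 + BB τ b ^ 2 := by
  have hc : Integrable (fun x => Real.cos (mob b x)) τ :=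
    Integrable.of_bound (Real.measurable_cos.comp (meas_mob' b)).aestronglyMeasurable 1
      (Eventually.of_forall fun p => Real.abs_cos_le_one _)
  have hs : Integrable (fun x => Real.sin (mob b x)) τ :=
    Integrable.of_bound (Real.measurable_sin.comp (meas_mob' b)).aestronglyMeasurable 1
      (Eventually.of_forall fun p => Real.abs_sin_le_one _)
  have h1 : hh τ (r1 b) = ∫ p, (Real.cos (mob b p.1) * Real.cos (mob b p.2) +
      Real.sin (mob b p.1) * Real.sin (mob b p.2)) ∂(τ.prod τ) := by
    unfold hh
    refine integral_congr_ae ?_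
    filter_upwards [dt_ae_prod τ (r1_ne b)] with p hp
    rw [← Real.cos_sub, mob_sub b _ _ hp.1 hp.2]
  rw [h1, integral_add (hc.mul_prod hc) (hs.mul_prod hs),
    integral_prod_mul (fun x => Real.cos (mob b x)) (fun x => Real.cos (mob b x)),
    integral_prod_mul (fun x => Real.sin (mob b x)) (fun x => Real.sin (mob b x))]
  unfold AA BB
  ring

lemma exists_r1 {u : ℝ × ℝ} (hu : u ≠ 0) : ∃ b : SL2, r1 b = u := by
  have hn : u.1 ^ 2 + u.2 ^ 2 ≠ 0 := by
    intro h
    apply hu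
    ext
    · simp only [Prod.fst_zero]; nlinarith [sq_nonneg u.1, sq_nonneg u.2]
    · simp only [Prod.snd_zero]; nlinarith [sq_nonneg u.1, sq_nonneg u.2]
  refine ⟨mk2 (u.2 / (u.1 ^ 2 + u.2 ^ 2)) (-u.1 / (u.1 ^ 2 + u.2 ^ 2)) u.1 u.2 (by field_simp; ring), ?_⟩
  ext <;> simp [r1]

lemma hh_nonneg {u : ℝ × ℝ} (hu : u ≠ 0) : 0 ≤ hh τ u := by
  obtain ⟨b, rfl⟩ := exists_r1 hu
  rw [hh_eq]; positivity

lemma AA_meas : Measurable (AA τ) := by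
  have : StronglyMeasurable (fun q : SL2 × ℝ => Real.cos (mob q.1 q.2)) :=
    (Real.measurable_cos.comp meas_mob).stronglyMeasurable
  exact this.integral_prod_right'.measurable
lemma BB_meas : Measurable (BB τ) := by
  have : StronglyMeasurable (fun q : SL2 × ℝ => Real.sin (mob q.1 q.2)) :=
    (Real.measurable_sin.comp meas_mob).stronglyMeasurable
  exact this.integral_prod_right'.measurable
lemma AA_le (b) : |AA τ b| ≤ 1 := by
  have := norm_integral_le_of_norm_le_const (μ := τ) (f := fun x => Real.cos (mob b x)) (C := 1)
    (Eventually.of_forall fun p => Real.abs_cos_le_one _)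
  simpa [AA] using this
lemma BB_le (b) : |BB τ b| ≤ 1 := by
  have := norm_integral_le_of_norm_le_const (μ := τ) (f := fun x => Real.sin (mob b x)) (C := 1)
    (Eventually.of_forall fun p => Real.abs_sin_le_one _)
  simpa [BB] using this

/-- the defect Ph - h -/
def q0 (μ : Measure SL2) (τ : Measure ℝ) (u : ℝ × ℝ) : ℝ := ∫ g, hh τ (ra u g) ∂μ - hh τ u

variable (hst : (μ.prod τ).map (fun p => mob p.1 p.2) = τ)
include hst

lemma AA_harm (b) : ∫ g, AA τ (b * g) ∂μ = AA τ b :=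
  (st_int_mul μ τ hst Real.measurable_cos 1 Real.abs_cos_le_one b).symm
lemma BB_harm (b) : ∫ g, BB τ (b * g) ∂μ = BB τ b :=
  (st_int_mul μ τ hst Real.measurable_sin 1 Real.abs_sin_le_one b).symm

lemma q0_eq (b) : q0 μ τ (r1 b) = ∫ g, ((AA τ (b * g) - AA τ b) ^ 2 + (BB τ (b * g) - BB τ b) ^ 2) ∂μ := by
  have hA : Measurable fun g => AA τ (b * g) := (AA_meas τ).comp (measurable_const_mul b)
  have hB : Measurable fun g => BB τ (b * g) := (BB_meas τ).comp (measurable_const_mul b)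
  have iA : Integrable (fun g => AA τ (b * g)) μ :=
    Integrable.of_bound hA.aestronglyMeasurable 1 (Eventually.of_forall fun _ => AA_le τ _)
  have iB : Integrable (fun g => BB τ (b * g)) μ :=
    Integrable.of_bound hB.aestronglyMeasurable 1 (Eventually.of_forall fun _ => BB_le τ _)
  have iA2 : Integrable (fun g => AA τ (b * g) ^ 2 + BB τ (b * g) ^ 2) μ := by
    refine Integrable.of_bound ((hA.pow_const 2).add (hB.pow_const 2)).aestronglyMeasurable 1 (Eventually.of_forall fun g => ?_)
    rw [← hh_eq, Real.norm_eq_abs, abs_of_nonneg (hh_nonneg τ (r1_ne _))]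
    exact hh_le_one τ _
  have e : ∀ g, ((AA τ (b * g) - AA τ b) ^ 2 + (BB τ (b * g) - BB τ b) ^ 2) =
      (AA τ (b * g) ^ 2 + BB τ (b * g) ^ 2) - (2 * AA τ b * AA τ (b * g) + 2 * BB τ b * BB τ (b * g)) +
      (AA τ b ^ 2 + BB τ b ^ 2) := fun g => by ring
  simp_rw [e]
  rw [integral_add, integral_sub iA2, integral_add (iA.const_mul _) (iB.const_mul _), integral_const_mul,
    integral_const_mul, AA_harm μ τ hst, BB_harm μ τ hst]
  · unfold q0
    simp_rw [← r1_mul, hh_eq]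
    simp
    ring
  · exact (iA.const_mul _).add (iB.const_mul _)
  · exact iA2.sub ((iA.const_mul _).add (iB.const_mul _))
  · exact integrable_const _

lemma q0_nonneg {u : ℝ × ℝ} (hu : u ≠ 0) : 0 ≤ q0 μ τ u := by
  obtain ⟨b, rfl⟩ := exists_r1 hu
  rw [q0_eq μ τ hst]
  exact integral_nonneg fun g => by positivity

lemma q0_zero_ae (b) (h : q0 μ τ (r1 b) = 0) : ∀ᵐ g ∂μ, AA τ (b * g) = AA τ b ∧ BB τ (b * g) = BB τ b := by
  rw [q0_eq μ τ hst, integral_eq_zero_iff_of_nonneg] at h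
  · filter_upwards [h] with g hg
    simp only [Pi.zero_apply] at hg
    constructor
    · nlinarith [sq_nonneg (AA τ (b * g) - AA τ b), sq_nonneg (BB τ (b * g) - BB τ b)]
    · nlinarith [sq_nonneg (AA τ (b * g) - AA τ b), sq_nonneg (BB τ (b * g) - BB τ b)]
  · intro g; simp only [Pi.zero_apply]; positivity
  · have hA : Measurable fun g => AA τ (b * g) := (AA_meas τ).comp (measurable_const_mul b)
    have hB : Measurable fun g => BB τ (b * g) := (BB_meas τ).comp (measurable_const_mul b)
    refine Integrable.of_bound (((hA.sub_const _).pow_const 2).add ((hB.sub_const _).pow_const 2)).aestronglyMeasurable 8 (Eventually.of_forall fun g => ?_)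
    have := abs_le.mp (AA_le τ b)
    have := abs_le.mp (AA_le τ (b * g))
    have := abs_le.mp (BB_le τ b)
    have := abs_le.mp (BB_le τ (b * g))
    rw [Real.norm_eq_abs, abs_of_nonneg (by positivity)]
    nlinarith
end


section
variable (μ : Measure SL2) [IsProbabilityMeasure μ] (τ : Measure ℝ) [IsProbabilityMeasure τ]
  [NullSingletonClass τ]

lemma one_sub_cos_le (t : ℝ) : 1 - Real.cos t ≤ |t| := by
  by_cases h : |t| ≤ 2
  · have h1 := Real.one_sub_sq_div_two_le_cos (x := t)
    have := sq_abs t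
    nlinarith [abs_nonneg t]
  · have := Real.neg_one_le_cos t
    linarith

lemma sub_le_mx (x y : ℝ) : |x - y| ≤ 2 * (mx x * mx y) := by
  have h1 := abs_sub x y
  have h2 := abs_le_mx x
  have h3 := abs_le_mx y
  have h4 := mx_ge_one x
  have h5 := mx_ge_one y
  nlinarith

lemma hh_infty : Tendsto (hh τ) (Bornology.cobounded (ℝ × ℝ)) (nhds 1) := by
  rw [Metric.tendsto_nhds]
  intro ε hε
  obtain ⟨κ, hκ, hκ'⟩ := nonconc τ (ε := ENNReal.ofReal (ε / 8)) (by simpa using hε)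
  have hev : ∀ᶠ u in Bornology.cobounded (ℝ × ℝ), 1 + 8 / (κ ^ 2 * ε) < ‖u‖ :=
    tendsto_norm_cobounded_atTop.eventually_gt_atTop _
  filter_upwards [hev] with u hu
  have hpos : 0 < 8 / (κ ^ 2 * ε) := by positivity
  have hu1 : 1 < ‖u‖ := by linarith
  have hu0 : u ≠ 0 := by rintro rfl; simp at hu1; linarith
  have hun : 0 < ‖u‖ := by linarith
  set B : Set ℝ := {x | |dt u x| ≤ κ * ‖u‖ * mx x} with hB
  have hBm : MeasurableSet B := by
    apply measurableSet_le
    · exact (meas_dt.comp (measurable_const.prodMk measurable_id)).abs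
    · exact cont_mx.measurable.const_mul _
  have hBt : τ.real B ≤ ε / 8 := ENNReal.toReal_le_of_le_ofReal (by positivity) (hκ' u hu0)
  have hi : Integrable (B.indicator (fun _ => (2:ℝ))) τ := (integrable_const _).indicator hBm
  have hone : Integrable (fun _ : ℝ => (1:ℝ)) τ := integrable_const _
  have hi1 : Integrable (fun p : ℝ × ℝ => B.indicator (fun _ => (2:ℝ)) p.1) (τ.prod τ) := by
    simpa using hi.mul_prod hone
  have hi2 : Integrable (fun p : ℝ × ℝ => B.indicator (fun _ => (2:ℝ)) p.2) (τ.prod τ) := by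
    simpa using hone.mul_prod hi
  have e1 : ∫ p : ℝ × ℝ, B.indicator (fun _ => (2:ℝ)) p.1 ∂(τ.prod τ) = τ.real B * 2 := by
    have := integral_prod_mul (μ := τ) (ν := τ) (B.indicator (fun _ => (2:ℝ))) (fun _ : ℝ => (1:ℝ))
    simp only [mul_one, integral_const, probReal_univ, smul_eq_mul] at this
    rw [this, integral_indicator_const _ hBm, smul_eq_mul]
  have e2 : ∫ p : ℝ × ℝ, B.indicator (fun _ => (2:ℝ)) p.2 ∂(τ.prod τ) = τ.real B * 2 := by
    have := integral_prod_mul (μ := τ) (ν := τ) (fun _ : ℝ => (1:ℝ)) (B.indicator (fun _ => (2:ℝ)))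
    simp only [one_mul, integral_const, probReal_univ, smul_eq_mul] at this
    rw [this, integral_indicator_const _ hBm, smul_eq_mul]
  have hbound : ∀ p : ℝ × ℝ, 1 - Real.cos (KK u p) ≤ B.indicator (fun _ => (2:ℝ)) p.1 +
      B.indicator (fun _ => (2:ℝ)) p.2 + 2 / (κ ^ 2 * ‖u‖ ^ 2) := by
    intro p
    have hc := Real.neg_one_le_cos (KK u p)
    have hq : 0 ≤ 2 / (κ ^ 2 * ‖u‖ ^ 2) := by positivity
    by_cases h1 : p.1 ∈ B
    · rw [Set.indicator_of_mem h1]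
      have : 0 ≤ B.indicator (fun _ => (2:ℝ)) p.2 := Set.indicator_nonneg (fun _ _ => by norm_num) _
      linarith
    by_cases h2 : p.2 ∈ B
    · rw [Set.indicator_of_mem h2]
      have : 0 ≤ B.indicator (fun _ => (2:ℝ)) p.1 := Set.indicator_nonneg (fun _ _ => by norm_num) _
      linarith
    rw [Set.indicator_of_notMem h1, Set.indicator_of_notMem h2, zero_add, zero_add]
    refine (one_sub_cos_le _).trans ?_
    simp only [hB, Set.mem_setOf_eq, not_le] at h1 h2
    have m1 := mx_pos p.1
    have m2 := mx_pos p.2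
    have h3 : κ ^ 2 * ‖u‖ ^ 2 * (mx p.1 * mx p.2) ≤ |dt u p.1| * |dt u p.2| := by
      calc _ = (κ * ‖u‖ * mx p.1) * (κ * ‖u‖ * mx p.2) := by ring
        _ ≤ _ := by gcongr
    have h4 := sub_le_mx p.1 p.2
    have hp : 0 < |dt u p.1| * |dt u p.2| := lt_of_lt_of_le (by positivity) h3
    unfold KK
    rw [abs_div, abs_mul, div_le_div_iff₀ hp (by positivity)]
    calc |p.1 - p.2| * (κ ^ 2 * ‖u‖ ^ 2) ≤ 2 * (mx p.1 * mx p.2) * (κ ^ 2 * ‖u‖ ^ 2) := by gcongr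
      _ = 2 * (κ ^ 2 * ‖u‖ ^ 2 * (mx p.1 * mx p.2)) := by ring
      _ ≤ _ := by gcongr
  have hIntg := integral_mono ((integrable_const (1:ℝ)).sub (cosKK_int τ u))
    ((hi1.add hi2).add (integrable_const (2 / (κ ^ 2 * ‖u‖ ^ 2)))) hbound
  have e3 : ∫ p, (1 - Real.cos (KK u p)) ∂(τ.prod τ) = 1 - hh τ u := by
    rw [integral_sub (integrable_const _) (cosKK_int τ u)]; simp [hh]
  have e4 : ∫ p : ℝ × ℝ, (B.indicator (fun _ => (2:ℝ)) p.1 +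
      B.indicator (fun _ => (2:ℝ)) p.2 + 2 / (κ ^ 2 * ‖u‖ ^ 2)) ∂(τ.prod τ) = τ.real B * 2 + τ.real B * 2
        + 2 / (κ ^ 2 * ‖u‖ ^ 2) := by
    have hi12 : Integrable (fun p : ℝ × ℝ => B.indicator (fun _ => (2:ℝ)) p.1 +
      B.indicator (fun _ => (2:ℝ)) p.2) (τ.prod τ) := hi1.add hi2
    rw [integral_add hi12 (integrable_const _), integral_add hi1 hi2, e1, e2]; simp
  have hIntg' : 1 - hh τ u ≤ τ.real B * 2 + τ.real B * 2 + 2 / (κ ^ 2 * ‖u‖ ^ 2) := by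
    rw [← e3, ← e4]; exact hIntg
  have h5 : 2 / (κ ^ 2 * ‖u‖ ^ 2) ≤ ε / 4 := by
    rw [div_le_div_iff₀ (by positivity) (by norm_num)]
    have h6 : 8 / (κ ^ 2 * ε) ≤ ‖u‖ ^ 2 := by nlinarith
    rw [div_le_iff₀ (by positivity)] at h6
    linarith
  rw [Real.dist_eq, abs_sub_comm, abs_of_nonneg (by linarith [hh_le_one τ u])]
  linarith

/-- logarithmic-type average -/
def hbar (τ : Measure ℝ) (u : ℝ × ℝ) : ℝ := ∫ s in Set.Icc (1:ℝ) 2, hh τ ((√s)⁻¹ • u)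

lemma KK_scale (u p) {s : ℝ} (hs : 0 < s) : KK ((√s)⁻¹ • u) p = s * KK u p := by
  unfold KK
  have h1 : ∀ x, dt ((√s)⁻¹ • u) x = (√s)⁻¹ * dt u x := fun x => by simp [dt]; ring
  rw [h1, h1]
  have h2 : (√s)⁻¹ * dt u p.1 * ((√s)⁻¹ * dt u p.2) = s⁻¹ * (dt u p.1 * dt u p.2) := by
    have : (√s)⁻¹ * (√s)⁻¹ = s⁻¹ := by rw [← mul_inv, Real.mul_self_sqrt hs.le]
    rw [← this]; ring
  rw [h2, div_mul_eq_div_div, div_inv_eq_mul]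
  ring

lemma cos_avg_le (K : ℝ) (hK : K ≠ 0) : ∫ s in Set.Icc (1:ℝ) 2, Real.cos (s * K) ≤ min 1 (2 / |K|) := by
  rw [integral_Icc_eq_integral_Ioc, ← intervalIntegral.integral_of_le (by norm_num)]
  apply le_min
  · have := intervalIntegral.norm_integral_le_of_norm_le_const (a := 1) (b := 2) (C := 1)
      (f := fun s : ℝ => Real.cos (s * K)) (fun s _ => Real.abs_cos_le_one _)
    have h2 := (abs_le.1 (by simpa using this)).2
    norm_num at h2
    exact h2
  · rw [intervalIntegral.integral_comp_mul_right (fun x => Real.cos x) hK, integral_cos, smul_eq_mul]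
    refine (le_abs_self _).trans ?_
    rw [abs_mul, abs_inv, div_eq_inv_mul]
    gcongr
    have h1 := Real.abs_sin_le_one (2 * K)
    have h2 := Real.abs_sin_le_one (1 * K)
    have h3 := abs_sub (Real.sin (2 * K)) (Real.sin (1 * K))
    linarith

lemma KK_lower {u p : ℝ × ℝ} (h1 : dt u p.1 ≠ 0) (h2 : dt u p.2 ≠ 0) :
    2 / |KK u p| ≤ 8 * ‖u‖ ^ 2 * (mx p.1 * mx p.2) / |p.1 - p.2| := by
  unfold KK
  rw [abs_div, abs_mul, div_div_eq_mul_div]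
  apply div_le_div_of_nonneg_right _ (abs_nonneg _)
  have h1 := dt_le u p.1
  have h2 := dt_le u p.2
  have m1 := mx_pos p.1
  have m2 := mx_pos p.2
  calc 2 * (|dt u p.1| * |dt u p.2|) ≤ 2 * ((2 * ‖u‖ * mx p.1) * (2 * ‖u‖ * mx p.2)) := by gcongr
    _ = _ := by ring

lemma hbar_le {u : ℝ × ℝ} (hu : u ≠ 0) : hbar τ u ≤
    ∫ p : ℝ × ℝ, min 1 (8 * ‖u‖ ^ 2 * (mx p.1 * mx p.2) / |p.1 - p.2|) ∂(τ.prod τ) := by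
  have hI : Integrable (Function.uncurry fun (p : ℝ × ℝ) (s : ℝ) => Real.cos (s * KK u p))
      ((τ.prod τ).prod (volume.restrict (Set.Icc (1:ℝ) 2))) := by
    refine Integrable.of_bound (C := 1) ?_ (Eventually.of_forall fun p => Real.abs_cos_le_one _)
    apply Measurable.aestronglyMeasurable
    apply Real.measurable_cos.comp
    exact measurable_snd.mul (meas_KK.comp (measurable_const.prodMk measurable_fst))
  have h1 : hbar τ u = ∫ p, (∫ s in Set.Icc (1:ℝ) 2, Real.cos (s * KK u p)) ∂(τ.prod τ) := by
    rw [integral_integral_swap hI]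
    unfold hbar
    refine setIntegral_congr_fun measurableSet_Icc fun s hs => ?_
    simp only [hh]
    simp_rw [KK_scale u _ (lt_of_lt_of_le one_pos hs.1)]
  rw [h1]
  have hpos : ∀ p : ℝ × ℝ, 0 ≤ 8 * ‖u‖ ^ 2 * (mx p.1 * mx p.2) / |p.1 - p.2| := fun p => by
    have m1 := mx_pos p.1
    have m2 := mx_pos p.2
    positivity
  apply integral_mono_ae hI.integral_prod_left
  · refine Integrable.of_bound (C := 1) ?_ (Eventually.of_forall fun p => ?_)
    · apply Measurable.aestronglyMeasurable
      apply measurable_const.min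
      have m1 : Measurable fun p : ℝ × ℝ => mx p.1 := cont_mx.measurable.comp measurable_fst
      have m2 : Measurable fun p : ℝ × ℝ => mx p.2 := cont_mx.measurable.comp measurable_snd
      have m3 : Measurable fun p : ℝ × ℝ => |p.1 - p.2| := (measurable_fst.sub measurable_snd).abs
      exact ((m1.mul m2).const_mul _).div m3
    · rw [Real.norm_eq_abs, abs_of_nonneg (le_min zero_le_one (hpos p))]; exact min_le_left _ _
  · filter_upwards [dt_ae_prod τ hu, ne_ae_prod τ] with p hp hne
    have hK : KK u p ≠ 0 := div_ne_zero (sub_ne_zero.2 hne) (mul_ne_zero hp.1 hp.2)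
    refine (cos_avg_le _ hK).trans ?_
    exact min_le_min_left _ (KK_lower hp.1 hp.2)

lemma hbar_nonneg (u : ℝ × ℝ) (hu : u ≠ 0) : 0 ≤ hbar τ u := by
  unfold hbar
  apply setIntegral_nonneg measurableSet_Icc
  intro s hs
  apply hh_nonneg
  have : 0 < √s := Real.sqrt_pos.2 (lt_of_lt_of_le one_pos hs.1)
  exact smul_ne_zero (by positivity) hu

lemma hbar_tendsto : Tendsto (hbar τ) (nhdsWithin 0 {0}ᶜ) (nhds 0) := by
  have hpos : ∀ (u p : ℝ × ℝ), 0 ≤ 8 * ‖u‖ ^ 2 * (mx p.1 * mx p.2) / |p.1 - p.2| := fun u p => by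
    have m1 := mx_pos p.1
    have m2 := mx_pos p.2
    positivity
  have hlim : Tendsto (fun u : ℝ × ℝ => ∫ p : ℝ × ℝ,
      min 1 (8 * ‖u‖ ^ 2 * (mx p.1 * mx p.2) / |p.1 - p.2|) ∂(τ.prod τ)) (nhdsWithin 0 {0}ᶜ)
      (nhds (∫ p : ℝ × ℝ, 0 ∂(τ.prod τ))) := by
    apply tendsto_integral_filter_of_dominated_convergence (fun _ => 1)
    · refine Eventually.of_forall fun u => ?_
      apply Measurable.aestronglyMeasurable
      apply measurable_const.min
      have m1 : Measurable fun p : ℝ × ℝ => mx p.1 := cont_mx.measurable.comp measurable_fst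
      have m2 : Measurable fun p : ℝ × ℝ => mx p.2 := cont_mx.measurable.comp measurable_snd
      have m3 : Measurable fun p : ℝ × ℝ => |p.1 - p.2| := (measurable_fst.sub measurable_snd).abs
      exact ((m1.mul m2).const_mul _).div m3
    · refine Eventually.of_forall fun u => Eventually.of_forall fun p => ?_
      rw [Real.norm_eq_abs, abs_of_nonneg (le_min zero_le_one (hpos u p))]; exact min_le_left _ _
    · exact integrable_const _
    · refine Eventually.of_forall fun p => ?_
      have hc : Continuous fun u : ℝ × ℝ => min 1 (8 * ‖u‖ ^ 2 * (mx p.1 * mx p.2) / |p.1 - p.2|) := by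
        fun_prop
      have := (hc.tendsto 0).mono_left (nhdsWithin_le_nhds (s := {0}ᶜ))
      simpa using this
  rw [integral_zero] at hlim
  apply squeeze_zero' _ _ hlim
  · filter_upwards [self_mem_nhdsWithin] with u hu using hbar_nonneg τ u hu
  · filter_upwards [self_mem_nhdsWithin] with u hu using hbar_le τ hu

lemma hh_abs_le {u : ℝ × ℝ} (hu : u ≠ 0) : |hh τ u| ≤ 1 := by
  rw [abs_of_nonneg (hh_nonneg τ hu)]; exact hh_le_one τ u

lemma q0_cont : ContinuousOn (q0 μ τ) {0}ᶜ := by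
  apply ContinuousOn.sub _ (hh_cont τ)
  intro u hu
  apply tendsto_integral_filter_of_dominated_convergence (fun _ => 1)
  · refine Eventually.of_forall fun u => ?_
    exact ((hh_meas τ).comp (cont_ra_right u).measurable).aestronglyMeasurable
  · filter_upwards [self_mem_nhdsWithin] with v hv
    refine Eventually.of_forall fun g => ?_
    exact hh_abs_le τ (ra_ne hv g)
  · exact integrable_const _
  · refine Eventually.of_forall fun g => ?_
    have h1 := (hh_cont τ (ra u g) (ra_ne hu g)).continuousAt (isOpen_compl_singleton.mem_nhds (ra_ne hu g))
    exact (h1.tendsto.comp ((cont_ra_left g).tendsto u)).mono_left nhdsWithin_le_nhds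

lemma q0_meas : Measurable (q0 μ τ) := by
  apply Measurable.sub _ (hh_meas τ)
  apply StronglyMeasurable.measurable
  apply StronglyMeasurable.integral_prod_right (f := fun (u : ℝ × ℝ) (g : SL2) => hh τ (ra u g))
  exact ((hh_meas τ).comp meas_ra).stronglyMeasurable

lemma q0_le {u : ℝ × ℝ} (hu : u ≠ 0) : q0 μ τ u ≤ 1 - hh τ u := by
  unfold q0
  have : ∫ g, hh τ (ra u g) ∂μ ≤ ∫ g, 1 ∂μ := by
    apply integral_mono_of_nonneg (Eventually.of_forall fun g => hh_nonneg τ (ra_ne hu g)) (integrable_const _)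
    exact Eventually.of_forall fun g => hh_le_one τ _
  simp at this
  linarith
end


section
variable (μ : Measure SL2) [IsProbabilityMeasure μ] (τ : Measure ℝ) [IsProbabilityMeasure τ]
  [NullSingletonClass τ]

lemma map_mob_mul (a c : SL2) : τ.map (mob (a * c)) = (τ.map (mob c)).map (mob a) := by
  rw [Measure.map_map (meas_mob' a) (meas_mob' c)]
  apply Measure.map_congr
  filter_upwards [dt_ae τ (r1_ne c)] with x hx
  exact mob_mul a c x hx

lemma map_mob_one : τ.map (mob 1) = τ := by
  have : mob 1 = id := funext mob_one
  rw [this, Measure.map_id]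

lemma charFun_map_mob (g : SL2) (ξ : ℝ) : charFun (τ.map (mob g)) ξ =
    ∫ x, Complex.exp (ξ * mob g x * Complex.I) ∂τ := by
  rw [charFun_apply_real, integral_map (meas_mob' g).aemeasurable]
  apply Continuous.aestronglyMeasurable
  fun_prop

lemma mob_continuousAt (g : SL2) (x : ℝ) (hx : dt (r1 g) x ≠ 0) : ContinuousAt (fun g => mob g x) g := by
  unfold mob
  apply ContinuousAt.div
  · exact (cont_dt.comp (cont_r0.prodMk continuous_const)).continuousAt
  · exact (cont_dt.comp (cont_r1.prodMk continuous_const)).continuousAt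
  · exact hx

lemma meas_expmob (g : SL2) (ξ : ℝ) : Measurable fun x => Complex.exp (ξ * mob g x * Complex.I) := by
  have : Continuous fun y : ℝ => Complex.exp (ξ * y * Complex.I) := by fun_prop
  exact this.measurable.comp (meas_mob' g)

lemma norm_expmob (g : SL2) (ξ x : ℝ) : ‖Complex.exp (ξ * mob g x * Complex.I)‖ ≤ 1 := by
  rw [← Complex.ofReal_mul, Complex.norm_exp_ofReal_mul_I]

lemma charFun_cont_g (ξ : ℝ) : Continuous fun g => charFun (τ.map (mob g)) ξ := by
  simp_rw [charFun_map_mob]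
  rw [continuous_iff_continuousAt]
  intro g
  apply tendsto_integral_filter_of_dominated_convergence (fun _ => 1)
  · exact Eventually.of_forall fun g => (meas_expmob g ξ).aestronglyMeasurable
  · exact Eventually.of_forall fun g => Eventually.of_forall fun x => norm_expmob g ξ x
  · exact integrable_const _
  · filter_upwards [dt_ae τ (r1_ne g)] with x hx
    have h1 := mob_continuousAt g x hx
    have : Continuous fun y : ℝ => Complex.exp (ξ * y * Complex.I) := by fun_prop
    exact (this.tendsto _).comp h1

instance isprob_map_mob (g : SL2) : IsProbabilityMeasure (τ.map (mob g)) :=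
  Measure.isProbabilityMeasure_map (meas_mob' g).aemeasurable

lemma closed_I : IsClosed {g : SL2 | τ.map (mob g) = τ} := by
  have : {g : SL2 | τ.map (mob g) = τ} = ⋂ ξ : ℝ, {g | charFun (τ.map (mob g)) ξ = charFun τ ξ} := by
    ext g
    simp only [Set.mem_setOf_eq, Set.mem_iInter]
    constructor
    · intro h ξ; rw [h]
    · intro h; exact Measure.ext_of_charFun (funext h)
  rw [this]
  exact isClosed_iInter fun ξ => isClosed_eq (charFun_cont_g τ ξ) continuous_const

lemma minv_closure (h : ∀ᵐ g ∂μ, τ.map (mob g) = τ) {g : SL2} (hg : g ∈ Subgroup.closure (measSupp μ)) :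
    τ.map (mob g) = τ := by
  have hs := supp_sub_closed μ _ (closed_I τ) h
  induction hg using Subgroup.closure_induction with
  | mem x hx => exact hs hx
  | one => exact map_mob_one τ
  | mul x y _ _ hx hy => rw [map_mob_mul, hy, hx]
  | inv x _ hx =>
    have h1 := map_mob_mul τ x⁻¹ x
    rw [inv_mul_cancel, map_mob_one, hx] at h1
    exact h1.symm

lemma no_inv (γ : SL2) (h2 : 2 < |tr2 γ|) : τ.map (mob γ) ≠ τ := by
  intro hinv
  obtain ⟨T, l, hl, h00, h01, h10, h11⟩ := diag_exists γ h2
  set τ' := τ.map (mob T) with hτ'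
  have hl0 : l ≠ 0 := by rintro rfl; simp at hl; linarith
  have hmob : ∀ x, mob (T * γ * T⁻¹) x = l ^ 2 * x := by
    intro x
    simp only [mob, dt, r0, r1, h00, h01, h10, h11]
    field_simp
    simp
  have hτ'inv : τ'.map (fun x => l ^ 2 * x) = τ' := by
    have e : (fun x => l ^ 2 * x) = mob (T * γ * T⁻¹) := funext fun x => (hmob x).symm
    rw [e, hτ', ← map_mob_mul]
    rw [show T * γ * T⁻¹ * T = T * γ by group, map_mob_mul, hinv]
  have h0 : ∀ᵐ x ∂τ', x ≠ 0 := by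
    refine (ae_map_iff (meas_mob' T).aemeasurable (p := fun x : ℝ => x ≠ 0) (measurableSet_singleton (0:ℝ)).compl).2 ?_
    filter_upwards [dt_ae τ (r0_ne T), dt_ae τ (r1_ne T)] with x hx hx'
    exact div_ne_zero hx hx'
  have hm : ∀ c : ℝ, Measurable fun x : ℝ => (1 + (c * x) ^ 2)⁻¹ := fun c => by fun_prop
  have hb : ∀ c x : ℝ, ‖(1 + (c * x) ^ 2)⁻¹‖ ≤ 1 := fun c x => by
    rw [Real.norm_eq_abs, abs_of_pos (by positivity)]
    apply inv_le_one_of_one_le₀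
    nlinarith [sq_nonneg (c * x)]
  have hc : ∀ n : ℕ, ∫ x, (1 + ((l ^ 2) ^ n * x) ^ 2)⁻¹ ∂τ' = ∫ x, (1 + (1 * x) ^ 2)⁻¹ ∂τ' := by
    intro n
    induction n with
    | zero => simp
    | succ n ih =>
      rw [← ih]
      conv_rhs => rw [← hτ'inv]
      have e1 := integral_map (μ := τ') (φ := fun x : ℝ => l ^ 2 * x) (by fun_prop)
        (hm ((l ^ 2) ^ n)).aestronglyMeasurable
      rw [e1]
      congr 1; ext x; ring
  have hlim : Tendsto (fun n : ℕ => ∫ x, (1 + ((l ^ 2) ^ n * x) ^ 2)⁻¹ ∂τ') atTop (nhds (∫ x, 0 ∂τ')) := by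
    apply tendsto_integral_filter_of_dominated_convergence (fun _ => 1)
    · exact Eventually.of_forall fun n => (hm _).aestronglyMeasurable
    · exact Eventually.of_forall fun n => Eventually.of_forall fun x => hb _ x
    · exact integrable_const _
    · filter_upwards [h0] with x hx
      have hl2 : 1 < l ^ 2 := by rw [← sq_abs]; nlinarith [abs_nonneg l]
      have t1 := tendsto_pow_atTop_atTop_of_one_lt hl2
      have hx2 : 0 < x ^ 2 := by positivity
      apply Tendsto.inv_tendsto_atTop
      apply tendsto_atTop_add_const_left
      have : (fun n : ℕ => ((l ^ 2) ^ n * x) ^ 2) = fun n => ((l ^ 2) ^ n) ^ 2 * x ^ 2 := by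
        ext n; ring
      rw [this]
      apply Tendsto.atTop_mul_const hx2
      exact (tendsto_pow_atTop (by norm_num)).comp t1
  simp_rw [hc] at hlim
  have := (tendsto_nhds_unique hlim tendsto_const_nhds).symm
  rw [integral_zero, integral_eq_zero_iff_of_nonneg (fun x => by positivity)
    (Integrable.of_bound (hm 1).aestronglyMeasurable 1 (Eventually.of_forall fun x => hb 1 x))] at this
  obtain ⟨x, hx⟩ := this.exists
  simp only [Pi.zero_apply] at hx
  have : 0 < (1 + (1 * x) ^ 2)⁻¹ := by positivity
  linarith

lemma mob_scale (s : ℝ) (hs : 0 < s) (b : SL2) (x : ℝ) :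
    mob (mk2 s⁻¹ 0 0 s (by field_simp; ring) * b) x = (s ^ 2)⁻¹ * mob b x := by
  simp only [mob, r0, r1, dt, sl_mul00, sl_mul01, sl_mul10, sl_mul11, mk2_00, mk2_01, mk2_10, mk2_11,
    zero_mul, add_zero, zero_add]
  rw [mul_assoc, mul_assoc, ← mul_add, ← mul_add, mul_div_mul_comm]
  congr 1
  field_simp

variable (hst : (μ.prod τ).map (fun p => mob p.1 p.2) = τ)
include hst

lemma q0_pos (hzd : ¬ IsSolvable (Subgroup.closure (measSupp μ))) {u : ℝ × ℝ} (hu : u ≠ 0) :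
    ∃ s : ℝ, 0 < s ∧ 0 < q0 μ τ (s • u) := by
  by_contra hcon
  push Not at hcon
  obtain ⟨b, rfl⟩ := exists_r1 hu
  have h1 : ∀ ξ : ℝ, 0 < ξ → ∀ᵐ g ∂μ, charFun (τ.map (mob (b * g))) ξ = charFun (τ.map (mob b)) ξ := by
    intro ξ hξ
    set s := (√ξ)⁻¹ with hs
    have hs0 : 0 < s := by positivity
    have hs2 : (s ^ 2)⁻¹ = ξ := by rw [hs, inv_pow, inv_inv, Real.sq_sqrt hξ.le]
    set D := mk2 s⁻¹ 0 0 s (by field_simp; ring) with hD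
    have hr : r1 (D * b) = s • r1 b := by
      ext <;> simp [r1, hD, sl_mul10, sl_mul11]
    have hq : q0 μ τ (r1 (D * b)) = 0 := le_antisymm (by rw [hr]; exact hcon s hs0) (q0_nonneg μ τ hst (r1_ne _))
    have key : ∀ c : SL2, charFun (τ.map (mob c)) ξ = (AA τ (D * c) : ℂ) + (BB τ (D * c) : ℂ) * Complex.I := by
      intro c
      have hic : Integrable (fun x => Real.cos (mob (D * c) x)) τ :=
        Integrable.of_bound (Real.measurable_cos.comp (meas_mob' _)).aestronglyMeasurable 1
          (Eventually.of_forall fun x => Real.abs_cos_le_one _)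
      have his : Integrable (fun x => Real.sin (mob (D * c) x)) τ :=
        Integrable.of_bound (Real.measurable_sin.comp (meas_mob' _)).aestronglyMeasurable 1
          (Eventually.of_forall fun x => Real.abs_sin_le_one _)
      rw [charFun_map_mob]
      unfold AA BB
      rw [← integral_complex_ofReal, ← integral_complex_ofReal, ← integral_mul_const, ← integral_add hic.ofReal (his.ofReal.mul_const _)]
      congr 1; ext x
      rw [hD, mob_scale s hs0, hs2, Complex.exp_mul_I]
      push_cast
      rfl
    filter_upwards [q0_zero_ae μ τ hst (D * b) hq] with g hg
    rw [key, key, ← mul_assoc, hg.1, hg.2]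
  have h2 : ∀ᵐ g ∂μ, ∀ q : ℚ, 0 < q → charFun (τ.map (mob (b * g))) q = charFun (τ.map (mob b)) q := by
    rw [ae_all_iff]
    intro q
    by_cases hq : 0 < q
    · filter_upwards [h1 q (by exact_mod_cast hq)] with g hg _ using hg
    · exact Eventually.of_forall fun g h => absurd h hq
  have h3 : ∀ᵐ g ∂μ, τ.map (mob g) = τ := by
    filter_upwards [h2] with g hg
    have hpos : ∀ ξ : ℝ, 0 < ξ → charFun (τ.map (mob (b * g))) ξ = charFun (τ.map (mob b)) ξ := by
      intro ξ hξ
      have hcl : IsClosed {ξ : ℝ | charFun (τ.map (mob (b * g))) ξ = charFun (τ.map (mob b)) ξ} :=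
        isClosed_eq continuous_charFun continuous_charFun
      by_contra hne
      obtain ⟨ε, hε, hball⟩ := Metric.isOpen_iff.1 hcl.isOpen_compl ξ hne
      obtain ⟨q, hq1, hq2⟩ := exists_rat_btwn (show ξ < ξ + ε by linarith)
      have : (q : ℝ) ∈ Metric.ball ξ ε := by
        rw [Metric.mem_ball, Real.dist_eq, abs_lt]; constructor <;> linarith
      exact hball this (hg q (by exact_mod_cast hξ.trans hq1))
    have hall : τ.map (mob (b * g)) = τ.map (mob b) := by
      apply Measure.ext_of_charFun
      ext ξ
      rcases lt_trichotomy ξ 0 with h | h | h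
      · have := hpos (-ξ) (by linarith)
        rw [charFun_neg, charFun_neg] at this
        exact (starRingEnd ℂ).injective this
      · subst h; simp
      · exact hpos ξ h
    have e := map_mob_mul τ b⁻¹ (b * g)
    rw [hall, ← map_mob_mul, inv_mul_cancel_left, inv_mul_cancel, map_mob_one] at e
    exact e
  obtain ⟨γ, hγ, hγ2⟩ := hyp_exists _ hzd
  exact no_inv τ γ hγ2 (minv_closure μ τ h3 hγ)
end


def LL (v : ℝ × ℝ) : ℝ := Real.log ‖v‖
def kk (α ρ : ℝ) (v : ℝ × ℝ) : ℝ := Real.exp (-(α * |LL v - ρ|))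
def mm (α : ℝ) (g : SL2) : ℝ := Real.exp (α * Real.log (nm g))

lemma LL_meas : Measurable LL := Real.measurable_log.comp measurable_norm
lemma kk_meas (α ρ) : Measurable (kk α ρ) := by
  unfold kk
  exact Real.measurable_exp.comp (((LL_meas.sub_const ρ).abs).const_mul α).neg
lemma kk_pos (α ρ v) : 0 < kk α ρ v := Real.exp_pos _
lemma kk_le_one {α : ℝ} (hα : 0 < α) (ρ v) : kk α ρ v ≤ 1 := by
  unfold kk; rw [Real.exp_le_one_iff]; have := abs_nonneg (LL v - ρ); nlinarith
lemma mm_meas (α) : Measurable (mm α) := by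
  unfold mm
  exact Real.measurable_exp.comp ((Real.measurable_log.comp cont_nm.measurable).const_mul α)
lemma mm_ge_one {α : ℝ} (hα : 0 < α) (g) : 1 ≤ mm α g := by
  unfold mm; rw [Real.one_le_exp_iff]; exact mul_nonneg hα.le (Real.log_nonneg (nm_ge_one g))

lemma LL_ra {u : ℝ × ℝ} (hu : u ≠ 0) (g : SL2) : |LL (ra u g) - LL u| ≤ Real.log (nm g) := by
  have h1 := ra_norm_le u g
  have h2 := ra_norm_ge u g
  have hu0 : 0 < ‖u‖ := norm_pos_iff.2 hu
  have hv0 : 0 < ‖ra u g‖ := norm_pos_iff.2 (ra_ne hu g)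
  have hn := nm_pos g
  have h3 := Real.log_le_log hv0 h1
  have h4 := Real.log_le_log hu0 h2
  rw [Real.log_mul hn.ne' hu0.ne'] at h3
  rw [Real.log_mul hn.ne' hv0.ne'] at h4
  unfold LL
  rw [abs_le]; constructor <;> linarith

lemma LL_smul {s : ℝ} (hs : 0 < s) {u : ℝ × ℝ} (hu : u ≠ 0) : LL (s • u) = Real.log s + LL u := by
  unfold LL
  rw [norm_smul, Real.norm_eq_abs, abs_of_pos hs, Real.log_mul hs.ne' (norm_pos_iff.2 hu).ne']

lemma kk_lip {α : ℝ} (hα : 0 < α) (ρ c : ℝ) (u v : ℝ × ℝ) (h : |LL u - LL v| ≤ c) :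
    kk α ρ u ≤ Real.exp (α * c) * kk α ρ v := by
  unfold kk
  rw [← Real.exp_add, Real.exp_le_exp]
  have h2 : |LL v - ρ| ≤ |LL u - ρ| + c := by
    have h3 := abs_sub_le (LL v) (LL u) ρ
    rw [abs_sub_comm] at h
    linarith
  nlinarith

section
variable (μ : Measure SL2) [IsProbabilityMeasure μ] (τ : Measure ℝ) [IsProbabilityMeasure τ]
  [NullSingletonClass τ]
variable (hst : (μ.prod τ).map (fun p => mob p.1 p.2) = τ)
include hst

lemma hh_int_ra {u : ℝ × ℝ} (hu : u ≠ 0) : Integrable (fun g => hh τ (ra u g)) μ :=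
  Integrable.of_bound ((hh_meas τ).comp (cont_ra_right u).measurable).aestronglyMeasurable 1
    (Eventually.of_forall fun g => hh_abs_le τ (ra_ne hu g))

lemma q0_riesz {u : ℝ × ℝ} (hu : u ≠ 0) : ∫⁻ g, ENNReal.ofReal (q0 μ τ (ra u g)) ∂(green μ)
    ≤ ENNReal.ofReal (1 - hh τ u) := by
  have h := riesz μ (s := fun b => ENNReal.ofReal (q0 μ τ (ra u b)))
    (Y := fun b => ENNReal.ofReal (1 - hh τ (ra u b)))
    ((q0_meas μ τ).comp (cont_ra_right u).measurable).ennreal_ofReal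
    (((hh_meas τ).comp (cont_ra_right u).measurable).const_sub 1).ennreal_ofReal ?_ 1
  · simpa [ra_one] using h
  · intro b
    have hv := ra_ne hu b
    simp only [ra_mul]
    set v := ra u b
    have hIntg := hh_int_ra μ τ hst hv
    have e : ∫⁻ g, ENNReal.ofReal (1 - hh τ (ra v g)) ∂μ = ENNReal.ofReal (1 - hh τ v - q0 μ τ v) := by
      have hIntg' : Integrable (fun g => 1 - hh τ (ra v g)) μ := (integrable_const _).sub hIntg
      rw [← ofReal_integral_eq_lintegral_ofReal hIntg'
        (Eventually.of_forall fun g => by have := hh_le_one τ (ra v g); simpa using this),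
        integral_sub (integrable_const _) hIntg]
      simp [q0]
    rw [e, ← ENNReal.ofReal_add (q0_nonneg μ τ hst hv) (by linarith [q0_le μ τ hv])]
    apply le_of_eq; congr 1; ring

/-- log-averaged defect -/
def QQ (μ : Measure SL2) (τ : Measure ℝ) (α : ℝ) (v : ℝ × ℝ) : ℝ≥0∞ :=
  ∫⁻ r : ℝ, ENNReal.ofReal (Real.exp (-(α * |r|))) * ENNReal.ofReal (q0 μ τ (Real.exp r • v))

omit hst in
lemma meas_exp_q0 : Measurable fun p : (ℝ × ℝ) × ℝ => ENNReal.ofReal (q0 μ τ (Real.exp p.2 • p.1)) := by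
  apply Measurable.ennreal_ofReal
  apply (q0_meas μ τ).comp
  exact (by fun_prop : Continuous fun p : (ℝ × ℝ) × ℝ => Real.exp p.2 • p.1).measurable

omit hst in
lemma meas_exp_q0' (v : ℝ × ℝ) : Measurable fun r : ℝ => ENNReal.ofReal (q0 μ τ (Real.exp r • v)) := by
  have hc : Continuous fun r : ℝ => Real.exp r • v := by fun_prop
  exact ((q0_meas μ τ).comp hc.measurable).ennreal_ofReal

omit hst in
lemma meas_QQ_int (α : ℝ) (v : ℝ × ℝ) : Measurable fun r : ℝ => ENNReal.ofReal (Real.exp (-(α * |r|))) *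
    ENNReal.ofReal (q0 μ τ (Real.exp r • v)) := by
  have hm : Measurable fun r : ℝ => ENNReal.ofReal (Real.exp (-(α * |r|))) := by fun_prop
  exact hm.mul (meas_exp_q0' μ τ v)

omit hst in
lemma exp_abs_fin {α : ℝ} (hα : 0 < α) : ∫⁻ r : ℝ, ENNReal.ofReal (Real.exp (-(α * |r|))) < ⊤ := by
  have h1 : IntegrableOn (fun r : ℝ => Real.exp (-(α * |r|))) (Set.Ioi 0) := by
    have := integrableOn_exp_mul_Ioi (a := -α) (by linarith) 0
    apply this.congr_fun _ measurableSet_Ioi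
    intro r hr
    simp only [abs_of_pos (Set.mem_Ioi.1 hr)]; congr 1; ring
  have h2 : IntegrableOn (fun r : ℝ => Real.exp (-(α * |r|))) (Set.Iic 0) := by
    have := integrableOn_exp_mul_Iic (a := α) hα 0
    apply this.congr_fun _ measurableSet_Iic
    intro r hr
    simp only [abs_of_nonpos (Set.mem_Iic.1 hr)]; congr 1; ring
  have h3 := h2.union h1
  rw [Set.Iic_union_Ioi, integrableOn_univ] at h3
  exact h3.lintegral_lt_top

lemma QQ_green {α : ℝ} (hα : 0 < α) {u : ℝ × ℝ} (hu : u ≠ 0) :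
    ∫⁻ g, QQ μ τ α (ra u g) ∂(green μ) ≤ ∫⁻ r : ℝ, ENNReal.ofReal (Real.exp (-(α * |r|))) := by
  unfold QQ
  have hm : Measurable fun r : ℝ => ENNReal.ofReal (Real.exp (-(α * |r|))) := by fun_prop
  rw [lintegral_lintegral_swap]
  · apply lintegral_mono
    intro r
    have hm2 : Measurable fun g => ENNReal.ofReal (q0 μ τ (Real.exp r • ra u g)) :=
      ((q0_meas μ τ).comp ((cont_ra_right u).const_smul (Real.exp r)).measurable).ennreal_ofReal
    simp only
    rw [lintegral_const_mul _ hm2]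
    have h1 : ∫⁻ g, ENNReal.ofReal (q0 μ τ (Real.exp r • ra u g)) ∂(green μ) ≤ 1 := by
      simp_rw [← ra_smul]
      have hu' : Real.exp r • u ≠ 0 := smul_ne_zero (Real.exp_pos r).ne' hu
      refine (q0_riesz μ τ hst hu').trans ?_
      rw [← ENNReal.ofReal_one]
      apply ENNReal.ofReal_le_ofReal
      linarith [hh_nonneg τ hu']
    calc _ ≤ ENNReal.ofReal (Real.exp (-(α * |r|))) * 1 := by gcongr
      _ = _ := mul_one _
  · apply Measurable.aemeasurable
    apply (hm.comp measurable_snd).mul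
    have hc : Continuous fun p : SL2 × ℝ => Real.exp p.2 • ra u p.1 :=
      (Real.continuous_exp.comp continuous_snd).smul ((cont_ra_right u).comp continuous_fst)
    exact ((q0_meas μ τ).comp hc.measurable).ennreal_ofReal

lemma QQ_pos (hzd : ¬ IsSolvable (Subgroup.closure (measSupp μ))) (α : ℝ) {u : ℝ × ℝ} (hu : u ≠ 0) :
    QQ μ τ α u ≠ 0 := by
  intro h0
  have hm : Measurable fun r : ℝ => ENNReal.ofReal (Real.exp (-(α * |r|))) := by fun_prop
  unfold QQ at h0
  rw [lintegral_eq_zero_iff (meas_QQ_int μ τ α u)] at h0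
  have hc : Continuous fun r : ℝ => q0 μ τ (Real.exp r • u) := by
    apply (q0_cont μ τ).comp_continuous (by fun_prop)
    intro r
    exact smul_ne_zero (Real.exp_pos r).ne' hu
  have h1 : (fun r : ℝ => q0 μ τ (Real.exp r • u)) =ᵐ[volume] fun _ => 0 := by
    filter_upwards [h0] with r hr
    simp only [Pi.zero_apply, mul_eq_zero, ENNReal.ofReal_eq_zero] at hr
    rcases hr with hr | hr
    · exact absurd hr (not_le.2 (Real.exp_pos _))
    · exact le_antisymm hr (q0_nonneg μ τ hst (smul_ne_zero (Real.exp_pos r).ne' hu))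
  have h2 := (hc.ae_eq_iff_eq volume continuous_const).1 h1
  obtain ⟨s, hs, hs'⟩ := q0_pos μ τ hst hzd hu
  have h3 := congrFun h2 (Real.log s)
  simp only [Real.exp_log hs] at h3
  linarith

lemma QQ_lower (hzd : ¬ IsSolvable (Subgroup.closure (measSupp μ))) (α : ℝ) :
    ∃ c : ℝ≥0∞, 0 < c ∧ c ≠ ⊤ ∧ ∀ v : ℝ × ℝ, ‖v‖ = 1 → c ≤ QQ μ τ α v := by
  by_contra hcon
  push Not at hcon
  have : ∀ n : ℕ, ∃ v : ℝ × ℝ, ‖v‖ = 1 ∧ QQ μ τ α v < ((n : ℝ≥0∞) + 1)⁻¹ := by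
    intro n
    apply hcon
    · simp [ENNReal.add_ne_top]
    · simp
  choose v hv1 hv2 using this
  have hcpt : IsCompact (Metric.sphere (0 : ℝ × ℝ) 1) := isCompact_sphere _ _
  obtain ⟨w, hw, φ, hφ, hlim⟩ := hcpt.tendsto_subseq (x := v) (fun n => by simpa using hv1 n)
  have hw0 : w ≠ 0 := by rintro rfl; simp at hw
  apply QQ_pos μ τ hst hzd α hw0
  have hm : Measurable fun r : ℝ => ENNReal.ofReal (Real.exp (-(α * |r|))) := by fun_prop
  have hF := lintegral_liminf_le (u := atTop) (μ := (volume : Measure ℝ)) (f := fun (n : ℕ) (r : ℝ) =>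
    ENNReal.ofReal (Real.exp (-(α * |r|))) * ENNReal.ofReal (q0 μ τ (Real.exp r • v (φ n))))
    (fun n => meas_QQ_int μ τ α (v (φ n)))
  have h1 : ∀ r : ℝ, liminf (fun n : ℕ => ENNReal.ofReal (Real.exp (-(α * |r|))) *
      ENNReal.ofReal (q0 μ τ (Real.exp r • v (φ n)))) atTop =
      ENNReal.ofReal (Real.exp (-(α * |r|))) * ENNReal.ofReal (q0 μ τ (Real.exp r • w)) := by
    intro r
    apply Tendsto.liminf_eq
    apply ENNReal.Tendsto.const_mul _ (Or.inr ENNReal.ofReal_ne_top)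
    apply ENNReal.tendsto_ofReal
    have hne : Real.exp r • w ≠ 0 := smul_ne_zero (Real.exp_pos r).ne' hw0
    have := (q0_cont μ τ _ hne).continuousAt (isOpen_compl_singleton.mem_nhds hne)
    exact this.tendsto.comp (hlim.const_smul (Real.exp r))
  simp_rw [h1] at hF
  have h2 : liminf (fun n : ℕ => QQ μ τ α (v (φ n))) atTop = 0 := by
    apply Tendsto.liminf_eq
    have h3 : Tendsto (fun n : ℕ => ((n : ℝ≥0∞) + 1)⁻¹) atTop (nhds 0) := by
      have := ENNReal.tendsto_inv_nat_nhds_zero.comp (tendsto_add_atTop_nat 1)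
      refine this.congr fun n => ?_
      simp
    apply tendsto_of_tendsto_of_tendsto_of_le_of_le tendsto_const_nhds (h3.comp hφ.tendsto_atTop)
    · intro n; exact bot_le
    · intro n; exact (hv2 (φ n)).le
  apply le_antisymm _ bot_le
  calc QQ μ τ α w ≤ _ := hF
    _ = 0 := h2

omit hst in
lemma QQ_scale {α : ℝ} (hα : 0 < α) (x : ℝ) (v : ℝ × ℝ) :
    ENNReal.ofReal (Real.exp (-(α * |x|))) * QQ μ τ α v ≤ QQ μ τ α (Real.exp x • v) := by
  have hm : Measurable fun r : ℝ => ENNReal.ofReal (Real.exp (-(α * |r|))) := by fun_prop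
  have hmq : Measurable fun r : ℝ => ENNReal.ofReal (q0 μ τ (Real.exp r • v)) :=
    meas_exp_q0' μ τ v
  unfold QQ
  rw [← lintegral_const_mul _ (meas_QQ_int μ τ α v)]
  have e := lintegral_add_right_eq_self (μ := (volume : Measure ℝ)) (fun r : ℝ =>
    ENNReal.ofReal (Real.exp (-(α * |r - x|))) * ENNReal.ofReal (q0 μ τ (Real.exp r • v))) x
  simp only [add_sub_cancel_right, Real.exp_add, mul_smul] at e
  rw [e]
  apply lintegral_mono
  intro r
  simp only
  rw [← mul_assoc, ← ENNReal.ofReal_mul (Real.exp_pos _).le, ← Real.exp_add]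
  gcongr
  have := abs_sub r x
  nlinarith

lemma green_kk (hzd : ¬ IsSolvable (Subgroup.closure (measSupp μ))) {α : ℝ} (hα : 0 < α) :
    ∃ C : ℝ, 0 < C ∧ ∀ (u : ℝ × ℝ) (ρ : ℝ), u ≠ 0 →
      ∫⁻ g, ENNReal.ofReal (kk α ρ (ra u g)) ∂(green μ) ≤ ENNReal.ofReal C := by
  obtain ⟨c, hc, hct, hc'⟩ := QQ_lower μ τ hst hzd α
  have hI := exp_abs_fin hα
  set I := ∫⁻ r : ℝ, ENNReal.ofReal (Real.exp (-(α * |r|)))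
  have hfin : c⁻¹ * I ≠ ⊤ := ENNReal.mul_ne_top (by simpa using hc.ne') hI.ne
  refine ⟨(c⁻¹ * I).toReal + 1, by positivity, fun u ρ hu => ?_⟩
  have key : ∀ v : ℝ × ℝ, v ≠ 0 → ENNReal.ofReal (kk α ρ v) ≤ c⁻¹ * QQ μ τ α (Real.exp (-ρ) • v) := by
    intro v hv
    have hn : 0 < ‖v‖ := norm_pos_iff.2 hv
    have h1 := QQ_scale μ τ hα (LL v - ρ) (‖v‖⁻¹ • v)
    have e : Real.exp (LL v - ρ) • ‖v‖⁻¹ • v = Real.exp (-ρ) • v := by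
      rw [smul_smul]; congr 1
      rw [sub_eq_add_neg, Real.exp_add, LL, Real.exp_log hn]; field_simp
    rw [e] at h1
    have h2 := hc' (‖v‖⁻¹ • v) (by rw [norm_smul]; simp [hn.ne'])
    rw [mul_comm, ← div_eq_mul_inv, ENNReal.le_div_iff_mul_le (Or.inl hc.ne') (Or.inl hct)]
    refine le_trans ?_ h1
    unfold kk
    gcongr
  calc ∫⁻ g, ENNReal.ofReal (kk α ρ (ra u g)) ∂(green μ)
      ≤ ∫⁻ g, c⁻¹ * QQ μ τ α (ra (Real.exp (-ρ) • u) g) ∂(green μ) := by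
        apply lintegral_mono
        intro g
        simp only
        rw [ra_smul]
        exact key _ (ra_ne hu g)
    _ = c⁻¹ * ∫⁻ g, QQ μ τ α (ra (Real.exp (-ρ) • u) g) ∂(green μ) := by
        apply lintegral_const_mul' _ _ (by simpa using hc.ne')
    _ ≤ c⁻¹ * I := by
        gcongr
        exact QQ_green μ τ hst hα (smul_ne_zero (Real.exp_pos _).ne' hu)
    _ = ENNReal.ofReal (c⁻¹ * I).toReal := (ENNReal.ofReal_toReal hfin).symm
    _ ≤ _ := by apply ENNReal.ofReal_le_ofReal; linarith
end


lemma sig_lip (z w : ℝ) : |(1 + Real.exp (-(z + w)))⁻¹ - (1 + Real.exp (-z))⁻¹| ≤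
    Real.exp |w| * Real.exp (-|z|) := by
  rw [neg_add, Real.exp_add]
  set A := Real.exp (-z) with hA
  set B := Real.exp (-w) with hB
  have hA0 : 0 < A := Real.exp_pos _
  have hB0 : 0 < B := Real.exp_pos _
  set M := Real.exp |w| with hM
  have hM1 : 1 ≤ M := Real.one_le_exp (abs_nonneg w)
  have hBM : B ≤ M := Real.exp_le_exp.2 (neg_le_abs w)
  have hMB : 1 ≤ M * B := by
    rw [hM, hB, ← Real.exp_add]; apply Real.one_le_exp; have := le_abs_self w; linarith
  have e : (1 + A * B)⁻¹ - (1 + A)⁻¹ = A * (1 - B) / ((1 + A) * (1 + A * B)) := by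
    field_simp; ring
  rw [e, abs_div, abs_mul, abs_of_pos hA0, abs_of_pos (show 0 < (1 + A) * (1 + A * B) by positivity)]
  have hAB : 0 < A * B := by positivity
  rcases le_total 0 z with hz | hz
  · rw [abs_of_nonneg hz, ← hA, div_le_iff₀ (by positivity)]
    have h1 : |1 - B| ≤ M := by rw [abs_le]; constructor <;> linarith
    calc A * |1 - B| ≤ A * M := by gcongr
      _ = M * A * (1 * 1) := by ring
      _ ≤ M * A * ((1 + A) * (1 + A * B)) := by gcongr <;> linarith
  · rw [abs_of_nonpos hz, neg_neg]
    have e2 : Real.exp z = A⁻¹ := by rw [hA, Real.exp_neg, inv_inv]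
    rw [e2, ← div_eq_mul_inv, div_le_div_iff₀ (by positivity) hA0]
    have h1 : |1 - B| ≤ M * B := by
      rw [abs_le]
      constructor
      · nlinarith
      · linarith
    calc A * |1 - B| * A ≤ A * (M * B) * A := by gcongr
      _ = M * (A * (A * B)) := by ring
      _ ≤ M * ((1 + A) * (1 + A * B)) := by gcongr <;> linarith

def ph (α ρ : ℝ) (v : ℝ × ℝ) : ℝ := (1 + Real.exp (-(2 * α * (LL v - ρ))))⁻¹

lemma ph_pos (α ρ v) : 0 < ph α ρ v := by unfold ph; positivity
lemma ph_le_one (α ρ v) : ph α ρ v ≤ 1 := by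
  unfold ph; apply inv_le_one_of_one_le₀; linarith [Real.exp_pos (-(2 * α * (LL v - ρ)))]
lemma ph_meas (α ρ) : Measurable (ph α ρ) := by
  unfold ph
  have := LL_meas
  fun_prop
lemma ph_mono {α : ℝ} (hα : 0 < α) {ρ ρ' : ℝ} (h : ρ ≤ ρ') (v) : ph α ρ' v ≤ ph α ρ v := by
  unfold ph
  gcongr
lemma ph_lip {α : ℝ} (hα : 0 < α) (ρ ρ' : ℝ) (u v : ℝ × ℝ) : |ph α ρ' v - ph α ρ u| ≤
    Real.exp (α * |(LL v - ρ') - (LL u - ρ)|) ^ 2 * kk α ρ u ^ 2 := by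
  have := sig_lip (2 * α * (LL u - ρ)) (2 * α * ((LL v - ρ') - (LL u - ρ)))
  unfold ph kk
  rw [← mul_add, add_sub_cancel] at this
  refine this.trans (le_of_eq ?_)
  rw [← Real.exp_nat_mul, ← Real.exp_nat_mul, abs_mul (2 * α), abs_mul (2 * α), abs_of_pos (show 0 < 2 * α by positivity)]
  congr 2 <;> · push_cast; ring

lemma LL_cont : ContinuousOn LL {0}ᶜ := by
  unfold LL
  apply ContinuousOn.log continuous_norm.continuousOn
  intro u hu
  exact (norm_pos_iff.2 hu).ne'

lemma kk_cont (α ρ) : ContinuousOn (kk α ρ) {0}ᶜ := by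
  unfold kk
  have := LL_cont
  fun_prop

lemma ph_cont (α ρ) : ContinuousOn (ph α ρ) {0}ᶜ := by
  unfold ph
  apply ContinuousOn.inv₀
  · have := LL_cont
    fun_prop
  · intro u hu; positivity

section
variable (μ : Measure SL2) [IsProbabilityMeasure μ] (τ : Measure ℝ) [IsProbabilityMeasure τ]
  [NullSingletonClass τ]
variable (hst : (μ.prod τ).map (fun p => mob p.1 p.2) = τ)
include hst

lemma S_unbdd (hzd : ¬ IsSolvable (Subgroup.closure (measSupp μ))) (C : ℝ) :
    ∃ s ∈ Submonoid.closure (measSupp μ), C ≤ nm s := by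
  by_contra hcon
  push Not at hcon
  set S := Submonoid.closure (measSupp μ)
  obtain ⟨C', hC', hG⟩ := green_kk μ τ hst hzd (α := 1) one_pos
  have hS : ∀ g ∈ S.topologicalClosure, nm g ≤ C := by
    intro g hg
    have hcl : IsClosed {g : SL2 | nm g ≤ C} := isClosed_le cont_nm continuous_const
    exact closure_minimal (fun s hs => (hcon s hs).le) hcl hg
  have hu : ((1:ℝ), (0:ℝ)) ≠ 0 := by simp
  have hL : LL ((1:ℝ), (0:ℝ)) = 0 := by simp [LL, Prod.norm_def]
  have hk : ∀ g ∈ S.topologicalClosure, ENNReal.ofReal (Real.exp (-Real.log C)) ≤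
      ENNReal.ofReal (kk 1 0 (ra (1, 0) g)) := by
    intro g hg
    apply ENNReal.ofReal_le_ofReal
    unfold kk
    have h1 := LL_ra hu g
    have h2 := Real.log_le_log (nm_pos g) (hS g hg)
    rw [hL] at h1
    gcongr
    linarith
  have hmus : ∀ n, ENNReal.ofReal (Real.exp (-Real.log C)) ≤
      ∫⁻ g, ENNReal.ofReal (kk 1 0 (ra (1, 0) g)) ∂(mus μ n) := by
    intro n
    have h0 := mus_supp μ S.topologicalClosure S.isClosed_topologicalClosure
      (Submonoid.subset_closure.trans S.le_topologicalClosure) n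
    have h1 : ∀ᵐ g ∂(mus μ n), g ∈ S.topologicalClosure := h0
    calc _ = ∫⁻ g, ENNReal.ofReal (Real.exp (-Real.log C)) ∂(mus μ n) := by simp
      _ ≤ _ := by
        apply lintegral_mono_ae
        filter_upwards [h1] with g hg using hk g hg
  have := hG (1, 0) 0 hu
  rw [lint_green] at this
  have h3 : ∑' n : ℕ, ENNReal.ofReal (Real.exp (-Real.log C)) ≤ ENNReal.ofReal C' :=
    (ENNReal.tsum_le_tsum hmus).trans this
  rw [ENNReal.tsum_const_eq_top_of_ne_zero (by simp [Real.exp_pos])] at h3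
  exact ENNReal.ofReal_ne_top (top_le_iff.1 h3)

lemma bad_green (hzd : ¬ IsSolvable (Subgroup.closure (measSupp μ))) {α : ℝ} (hα : 0 < α)
    {ε : ℝ} (hε : 0 < ε) : ∃ δ > (0:ℝ), ∀ u : ℝ × ℝ, u ≠ 0 →
    (∀ (u' : ℝ × ℝ) (ρ : ℝ), u' ≠ 0 → ∫⁻ g in {g | ‖ra u g‖ < δ * (nm g * ‖u‖)},
      ENNReal.ofReal (kk α ρ (ra u' g)) ∂(green μ) ≤ ENNReal.ofReal ε) ∧
    ∀ n, mus μ n {g | ‖ra u g‖ < δ * (nm g * ‖u‖)} ≤ ENNReal.ofReal ε := by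
  obtain ⟨C, hC, hG⟩ := green_kk μ τ hst hzd hα
  set e := ε / (2 * (C + 1)) with he
  have he0 : 0 < e := by positivity
  obtain ⟨δ, hδ, hD⟩ := bad_exists μ τ hst (ε := ENNReal.ofReal e) (by simpa using he0)
  refine ⟨δ, hδ, fun u hu => ?_⟩
  obtain ⟨D, hDm, hDh, hD1, hDb⟩ := hD u hu
  set Bad : Set SL2 := {g | ‖ra u g‖ < δ * (nm g * ‖u‖)} with hBad
  have hBm : MeasurableSet Bad := by
    apply measurableSet_lt (cont_ra_right u).measurable.norm
    exact (cont_nm.measurable.mul_const _).const_mul _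
  have e1 : 2 * C * e ≤ ε := by
    rw [he, mul_div_assoc', div_le_iff₀ (by positivity)]; nlinarith
  have e2 : 2 * e ≤ ε := by
    rw [he, mul_div_assoc', div_le_iff₀ (by positivity)]; nlinarith
  constructor
  · intro u' ρ hu'
    have hkm : Measurable fun b => ENNReal.ofReal (kk α ρ (ra u' b)) :=
      ((kk_meas α ρ).comp (cont_ra_right u').measurable).ennreal_ofReal
    set w : SL2 → ℝ≥0∞ := fun b => ∫⁻ g, ENNReal.ofReal (kk α ρ (ra u' (b * g))) ∂(green μ) with hw
    have hwm : Measurable w := meas_lint_green μ hkm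
    have hwC : ∀ b, w b ≤ ENNReal.ofReal C := by
      intro b
      simp only [hw, ra_mul]
      exact hG _ ρ (ra_ne hu' b)
    have hweq : ∀ b, w b = ENNReal.ofReal (kk α ρ (ra u' b)) + ∫⁻ g, w (b * g) ∂μ := by
      intro b
      have := green_eq μ (F := fun g => ENNReal.ofReal (kk α ρ (ra u' (b * g))))
        (hkm.comp (measurable_const_mul b))
      simp only [hw]
      rw [this]
      simp only [mul_one, mul_assoc]
    have hr := riesz μ (s := Bad.indicator fun b => ENNReal.ofReal (kk α ρ (ra u' b)))
      (Y := fun b => min (w b) (2 * ENNReal.ofReal C * D b)) (hkm.indicator hBm)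
      (hwm.min (hDm.const_mul _)) ?_ 1
    · simp only [one_mul] at hr
      rw [lintegral_indicator hBm] at hr
      refine hr.trans ((min_le_right _ _).trans ?_)
      calc 2 * ENNReal.ofReal C * D 1 ≤ ENNReal.ofReal 2 * ENNReal.ofReal C * ENNReal.ofReal e := by
            rw [ENNReal.ofReal_ofNat]; gcongr
        _ = ENNReal.ofReal (2 * C * e) := by
            rw [ENNReal.ofReal_mul (by positivity), ENNReal.ofReal_mul (by positivity)]
        _ ≤ _ := ENNReal.ofReal_le_ofReal e1
    · intro b
      have hle : Bad.indicator (fun b => ENNReal.ofReal (kk α ρ (ra u' b))) b +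
          ∫⁻ g, min (w (b * g)) (2 * ENNReal.ofReal C * D (b * g)) ∂μ ≤ w b := by
        conv_rhs => rw [hweq]
        gcongr
        · exact Set.indicator_le_self _ _ b
        · exact min_le_left _ _
      apply le_min hle
      by_cases hb : b ∈ Bad
      · refine hle.trans ((hwC b).trans ?_)
        calc ENNReal.ofReal C = ENNReal.ofReal C * 1 := (mul_one _).symm
          _ ≤ ENNReal.ofReal C * (2 * D b) := by gcongr; exact hDb b hb
          _ = _ := by ring
      · rw [Set.indicator_of_notMem hb, zero_add, ← hDh b, ← lintegral_const_mul _ (show Measurable fun g => D (b * g) from hDm.comp (measurable_const_mul b))]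
        apply lintegral_mono
        intro g
        exact min_le_right _ _
  · intro n
    have hs := superharm_n μ (Y := D) hDm (fun b => (hDh b).le) n 1
    simp only [one_mul] at hs
    calc mus μ n Bad = ∫⁻ g, Bad.indicator 1 g ∂(mus μ n) := (lintegral_indicator_one hBm).symm
      _ ≤ ∫⁻ g, 2 * D g ∂(mus μ n) := by
          apply lintegral_mono
          intro g
          by_cases hg : g ∈ Bad
          · rw [Set.indicator_of_mem hg]; exact hDb g hg
          · rw [Set.indicator_of_notMem hg]; exact bot_le
      _ = 2 * ∫⁻ g, D g ∂(mus μ n) := lintegral_const_mul _ hDm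
      _ ≤ ENNReal.ofReal 2 * ENNReal.ofReal e := by
          rw [ENNReal.ofReal_ofNat]; gcongr; exact hs.trans hD1
      _ = ENNReal.ofReal (2 * e) := by rw [ENNReal.ofReal_mul (by positivity)]
      _ ≤ _ := ENNReal.ofReal_le_ofReal e2
end


def qq (μ : Measure SL2) (τ : Measure ℝ) (α ρ : ℝ) (v : ℝ × ℝ) : ℝ :=
  (ph α (-ρ) v - ph α ρ v) * q0 μ τ v

def Gq (μ : Measure SL2) (τ : Measure ℝ) (α ρ : ℝ) (u : ℝ × ℝ) : ℝ≥0∞ :=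
  ∫⁻ g, ENNReal.ofReal (qq μ τ α ρ (ra u g)) ∂(green μ)

def ff (μ : Measure SL2) (τ : Measure ℝ) (α ρ : ℝ) (u : ℝ × ℝ) : ℝ := 1 - (Gq μ τ α ρ u).toReal

lemma LL_near {v v' : ℝ × ℝ} (hv : v ≠ 0) (h : ‖v' - v‖ ≤ 1 / 2 * ‖v‖) : v' ≠ 0 ∧ |LL v' - LL v| ≤ 1 := by
  have hn : 0 < ‖v‖ := norm_pos_iff.2 hv
  have h1 : ‖v‖ - ‖v'‖ ≤ ‖v' - v‖ := by rw [norm_sub_rev]; exact norm_sub_norm_le _ _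
  have h2 : ‖v'‖ - ‖v‖ ≤ ‖v' - v‖ := norm_sub_norm_le _ _
  have hn' : 0 < ‖v'‖ := by linarith
  refine ⟨norm_pos_iff.1 hn', ?_⟩
  unfold LL
  have he : 2 < Real.exp 1 := by have := Real.add_one_lt_exp (x := 1) one_ne_zero; linarith
  have e2 : Real.log 2 ≤ 1 := by
    rw [Real.log_le_iff_le_exp (by norm_num)]; exact he.le
  have h3 : Real.log ‖v'‖ ≤ Real.log 2 + Real.log ‖v‖ := by
    rw [← Real.log_mul (by norm_num) hn.ne']
    exact Real.log_le_log hn' (by linarith)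
  have h4 : Real.log ‖v‖ ≤ Real.log 2 + Real.log ‖v'‖ := by
    rw [← Real.log_mul (by norm_num) hn'.ne']
    exact Real.log_le_log hn (by linarith)
  rw [abs_le]; constructor <;> linarith

section
variable (μ : Measure SL2) [IsProbabilityMeasure μ] (τ : Measure ℝ) [IsProbabilityMeasure τ]
  [NullSingletonClass τ]

lemma q0_neg (u) : q0 μ τ (-u) = q0 μ τ u := by
  unfold q0
  simp_rw [ra_neg, hh_neg]

lemma ph_neg (α ρ u) : ph α ρ (-u) = ph α ρ u := by unfold ph LL; rw [norm_neg]

lemma qq_neg (α ρ u) : qq μ τ α ρ (-u) = qq μ τ α ρ u := by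
  unfold qq; rw [ph_neg, ph_neg, q0_neg]

lemma ff_neg (α ρ u) : ff μ τ α ρ (-u) = ff μ τ α ρ u := by
  unfold ff Gq; simp_rw [ra_neg, qq_neg]

lemma qq_meas (α ρ) : Measurable (qq μ τ α ρ) :=
  ((ph_meas _ _).sub (ph_meas _ _)).mul (q0_meas μ τ)

lemma qq_cont (α ρ) : ContinuousOn (qq μ τ α ρ) {0}ᶜ :=
  ((ph_cont _ _).sub (ph_cont _ _)).mul (q0_cont μ τ)

lemma qq_meas_ra (α ρ u) : Measurable fun g => ENNReal.ofReal (qq μ τ α ρ (ra u g)) :=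
  ((qq_meas μ τ α ρ).comp (cont_ra_right u).measurable).ennreal_ofReal

lemma Gq_meas (α ρ) : Measurable (Gq μ τ α ρ) := by
  unfold Gq
  exact ((qq_meas μ τ α ρ).comp meas_ra).ennreal_ofReal.lintegral_prod_right'

lemma ff_meas (α ρ) : Measurable (ff μ τ α ρ) := (Gq_meas μ τ α ρ).ennreal_toReal.const_sub 1

variable (hst : (μ.prod τ).map (fun p => mob p.1 p.2) = τ)
variable {α ρ : ℝ} (hα : 0 < α) (hρ : 0 ≤ ρ)
include hst hα hρ

lemma qq_nonneg {v : ℝ × ℝ} (hv : v ≠ 0) : 0 ≤ qq μ τ α ρ v := by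
  apply mul_nonneg _ (q0_nonneg μ τ hst hv)
  have := ph_mono hα (show -ρ ≤ ρ by linarith) v
  linarith

lemma q0_le_one {v : ℝ × ℝ} (hv : v ≠ 0) : q0 μ τ v ≤ 1 := by
  have := q0_le μ τ hv
  linarith [hh_nonneg τ hv]

lemma qq_le_q0 {v : ℝ × ℝ} (hv : v ≠ 0) : qq μ τ α ρ v ≤ q0 μ τ v := by
  have h1 := ph_le_one α (-ρ) v
  have h2 := ph_pos α ρ v
  have h3 := q0_nonneg μ τ hst hv
  unfold qq
  nlinarith

lemma qq_le_kk {v : ℝ × ℝ} (hv : v ≠ 0) : qq μ τ α ρ v ≤ Real.exp (α * (2 * ρ)) ^ 2 * kk α ρ v ^ 2 := by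
  have h1 := ph_lip hα ρ (-ρ) v v
  have e : LL v - -ρ - (LL v - ρ) = 2 * ρ := by ring
  rw [e, abs_of_nonneg (show 0 ≤ 2 * ρ by linarith)] at h1
  have h3 := q0_nonneg μ τ hst hv
  have h4 := q0_le_one μ τ hst hα hρ hv
  unfold qq
  calc _ ≤ |ph α (-ρ) v - ph α ρ v| * q0 μ τ v := by gcongr; exact le_abs_self _
    _ ≤ |ph α (-ρ) v - ph α ρ v| * 1 := by gcongr
    _ ≤ _ := by rw [mul_one]; exact h1

lemma Gq_le {u : ℝ × ℝ} (hu : u ≠ 0) : Gq μ τ α ρ u ≤ ENNReal.ofReal (1 - hh τ u) := by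
  refine le_trans ?_ (q0_riesz μ τ hst hu)
  apply lintegral_mono
  intro g
  exact ENNReal.ofReal_le_ofReal (qq_le_q0 μ τ hst hα hρ (ra_ne hu g))

lemma Gq_le_one {u : ℝ × ℝ} (hu : u ≠ 0) : Gq μ τ α ρ u ≤ 1 := by
  refine (Gq_le μ τ hst hα hρ hu).trans ?_
  rw [← ENNReal.ofReal_one]
  apply ENNReal.ofReal_le_ofReal
  linarith [hh_nonneg τ hu]

lemma Gq_ne_top {u : ℝ × ℝ} (hu : u ≠ 0) : Gq μ τ α ρ u ≠ ⊤ :=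
  ne_top_of_le_ne_top ENNReal.one_ne_top (Gq_le_one μ τ hst hα hρ hu)

lemma ff_le_one (u) : ff μ τ α ρ u ≤ 1 := by
  unfold ff; linarith [ENNReal.toReal_nonneg (a := Gq μ τ α ρ u)]

lemma hh_le_ff {u : ℝ × ℝ} (hu : u ≠ 0) : hh τ u ≤ ff μ τ α ρ u := by
  unfold ff
  have := ENNReal.toReal_le_of_le_ofReal (by linarith [hh_le_one τ u]) (Gq_le μ τ hst hα hρ hu)
  linarith

lemma ff_nonneg {u : ℝ × ℝ} (hu : u ≠ 0) : 0 ≤ ff μ τ α ρ u :=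
  (hh_nonneg τ hu).trans (hh_le_ff μ τ hst hα hρ hu)

lemma ff_harm {u : ℝ × ℝ} (hu : u ≠ 0) : ∫ g, ff μ τ α ρ (ra u g) ∂μ = ff μ τ α ρ u + qq μ τ α ρ u := by
  have h1 := green_eq μ (qq_meas_ra μ τ α ρ u)
  simp only [ra_one, ra_mul] at h1
  have hm : Measurable fun g => Gq μ τ α ρ (ra u g) := (Gq_meas μ τ α ρ).comp (cont_ra_right u).measurable
  have h2 : Gq μ τ α ρ u = ENNReal.ofReal (qq μ τ α ρ u) + ∫⁻ g, Gq μ τ α ρ (ra u g) ∂μ := h1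
  have h3 : ∫⁻ g, Gq μ τ α ρ (ra u g) ∂μ ≠ ⊤ := by
    intro h; rw [h] at h2; exact Gq_ne_top μ τ hst hα hρ hu (by rw [h2]; simp)
  have h4 : ∫ g, (Gq μ τ α ρ (ra u g)).toReal ∂μ = (∫⁻ g, Gq μ τ α ρ (ra u g) ∂μ).toReal :=
    integral_toReal hm.aemeasurable (ae_lt_top hm h3)
  have h5 : Integrable (fun g => (Gq μ τ α ρ (ra u g)).toReal) μ :=
    integrable_toReal_of_lintegral_ne_top hm.aemeasurable h3
  unfold ff
  rw [integral_sub (integrable_const _) h5, h4, h2, ENNReal.toReal_add ENNReal.ofReal_ne_top h3,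
    ENNReal.toReal_ofReal (qq_nonneg μ τ hst hα hρ hu)]
  simp
  ring

lemma qq_mod {ε : ℝ} (hε : 0 < ε) : ∃ η > (0:ℝ), η ≤ 1 / 2 ∧ ∀ v v' : ℝ × ℝ, v ≠ 0 → ‖v' - v‖ ≤ η * ‖v‖ →
    |qq μ τ α ρ v' - qq μ τ α ρ v| ≤ ε * kk α ρ v := by
  set M := Real.exp (α * (2 * ρ)) ^ 2 with hM
  have hM0 : 0 < M := by positivity
  set E := Real.exp (α * 1) with hE
  have hE1 : 1 ≤ E := Real.one_le_exp (by linarith)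
  set κ := ε / (M * E ^ 2) with hκ
  have hκ0 : 0 < κ := by positivity
  set c := -Real.log κ / α with hc
  have hKc : IsCompact {v : ℝ × ℝ | Real.exp (ρ - c) ≤ ‖v‖ ∧ ‖v‖ ≤ Real.exp (ρ + c)} := by
    apply Metric.isCompact_of_isClosed_isBounded
    · exact (isClosed_le continuous_const continuous_norm).inter (isClosed_le continuous_norm continuous_const)
    · apply (Metric.isBounded_closedBall (x := (0:ℝ × ℝ)) (r := Real.exp (ρ + c))).subset
      rintro v ⟨_, hv⟩
      simpa using hv
  have hu := hKc.uniformContinuousAt_of_continuousAt (qq μ τ α ρ) (r := {p | dist p.1 p.2 < ε * κ}) (by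
    rintro v ⟨hv, _⟩
    have hv0 : v ≠ 0 := norm_pos_iff.1 (lt_of_lt_of_le (Real.exp_pos _) hv)
    exact (qq_cont μ τ α ρ v hv0).continuousAt (isOpen_compl_singleton.mem_nhds hv0))
    (Metric.dist_mem_uniformity (by positivity))
  obtain ⟨η', hη', hη''⟩ := Metric.mem_uniformity_dist.1 hu
  refine ⟨min (1/2) (η' / (2 * Real.exp (ρ + c))), by positivity, min_le_left _ _, fun v v' hv h => ?_⟩
  have hn : 0 < ‖v‖ := norm_pos_iff.2 hv
  obtain ⟨hv', hLL⟩ := LL_near hv (h.trans (by gcongr; exact min_le_left _ _))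
  have hk := kk_pos α ρ v
  by_cases hcase : kk α ρ v ≤ κ
  · have hk' := kk_lip hα ρ 1 v' v hLL
    have hkp := kk_pos α ρ v'
    have b1 := qq_le_kk μ τ hst hα hρ hv
    have b2 := qq_le_kk μ τ hst hα hρ hv'
    have n1 := qq_nonneg μ τ hst hα hρ hv
    have n2 := qq_nonneg μ τ hst hα hρ hv'
    rw [← hM] at b1 b2
    rw [← hE] at hk'
    have b3 : M * (E * kk α ρ v) ^ 2 ≤ ε * kk α ρ v := by
      have : M * E ^ 2 * kk α ρ v ≤ ε := by
        rw [hκ, le_div_iff₀ (by positivity)] at hcase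
        linarith
      calc _ = M * E ^ 2 * kk α ρ v * kk α ρ v := by ring
        _ ≤ _ := by gcongr
    have b4 : M * kk α ρ v' ^ 2 ≤ M * (E * kk α ρ v) ^ 2 := by gcongr
    have b5 : M * kk α ρ v ^ 2 ≤ M * (E * kk α ρ v) ^ 2 := by
      gcongr; nlinarith
    rw [abs_le]; constructor <;> linarith
  · push Not at hcase
    have hL : |LL v - ρ| ≤ c := by
      have := Real.log_lt_log hκ0 hcase
      unfold kk at this
      rw [Real.log_exp] at this
      rw [hc, le_div_iff₀ hα]
      linarith
    have hvK : v ∈ {v : ℝ × ℝ | Real.exp (ρ - c) ≤ ‖v‖ ∧ ‖v‖ ≤ Real.exp (ρ + c)} := by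
      have e : ‖v‖ = Real.exp (LL v) := by unfold LL; rw [Real.exp_log hn]
      have := abs_le.1 hL
      refine ⟨?_, ?_⟩ <;> · rw [e, Real.exp_le_exp]; linarith
    have hd : dist v v' < η' := by
      rw [dist_comm, dist_eq_norm]
      calc ‖v' - v‖ ≤ _ := h
        _ ≤ η' / (2 * Real.exp (ρ + c)) * Real.exp (ρ + c) := by
            gcongr
            · exact min_le_right _ _
            · exact hvK.2
        _ = η' / 2 := by field_simp
        _ < η' := by linarith
    have := hη'' hd hvK
    simp only [Set.mem_setOf_eq, Real.dist_eq] at this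
    rw [abs_sub_comm]
    refine this.le.trans ?_
    gcongr

lemma ff_eq_aux {C ε δ : ℝ} (hC : 0 < C) (hε : 0 < ε) (u a b : ℝ × ℝ) (ha : a ≠ 0) (hb : b ≠ 0)
    (hCa : ∫⁻ g, ENNReal.ofReal (kk α ρ (ra u g)) ∂(green μ) ≤ ENNReal.ofReal C)
    (hbad : ∫⁻ g in {g | ‖ra u g‖ < δ * (nm g * ‖u‖)}, ENNReal.ofReal (kk α ρ (ra a g)) ∂(green μ) ≤
      ENNReal.ofReal (ε / Real.exp (α * (2 * ρ)) ^ 2))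
    (hgood : ∀ g, ¬ ‖ra u g‖ < δ * (nm g * ‖u‖) →
      qq μ τ α ρ (ra a g) ≤ qq μ τ α ρ (ra b g) + ε / C * kk α ρ (ra u g)) :
    Gq μ τ α ρ a ≤ Gq μ τ α ρ b + ENNReal.ofReal (2 * ε) := by
  set M := Real.exp (α * (2 * ρ)) ^ 2 with hM
  have hM0 : 0 < M := by positivity
  set Bad : Set SL2 := {g | ‖ra u g‖ < δ * (nm g * ‖u‖)} with hBad
  have hBm : MeasurableSet Bad := by
    apply measurableSet_lt (cont_ra_right u).measurable.norm
    exact (cont_nm.measurable.mul_const _).const_mul _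
  have hkm : ∀ v : ℝ × ℝ, Measurable fun g => ENNReal.ofReal (kk α ρ (ra v g)) := fun v =>
      ((kk_meas α ρ).comp (cont_ra_right v).measurable).ennreal_ofReal
  unfold Gq
  calc ∫⁻ g, ENNReal.ofReal (qq μ τ α ρ (ra a g)) ∂(green μ)
      ≤ ∫⁻ g, (ENNReal.ofReal (qq μ τ α ρ (ra b g)) + (ENNReal.ofReal (ε / C) * ENNReal.ofReal (kk α ρ (ra u g))
          + ENNReal.ofReal M * Bad.indicator (fun g => ENNReal.ofReal (kk α ρ (ra a g))) g)) ∂(green μ) := by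
        apply lintegral_mono
        intro g
        simp only
        by_cases hg : g ∈ Bad
        · rw [Set.indicator_of_mem hg]
          refine le_trans ?_ (le_add_left (le_add_left le_rfl))
          rw [← ENNReal.ofReal_mul hM0.le]
          apply ENNReal.ofReal_le_ofReal
          refine (qq_le_kk μ τ hst hα hρ (ra_ne ha g)).trans ?_
          rw [← hM]
          gcongr
          have h1 := kk_le_one hα ρ (ra a g)
          have h2 := kk_pos α ρ (ra a g)
          nlinarith
        · rw [Set.indicator_of_notMem hg, mul_zero, add_zero, ← ENNReal.ofReal_mul (by positivity),
            ← ENNReal.ofReal_add (qq_nonneg μ τ hst hα hρ (ra_ne hb g)) (by have := kk_pos α ρ (ra u g); positivity)]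
          exact ENNReal.ofReal_le_ofReal (hgood g hg)
    _ = ∫⁻ g, ENNReal.ofReal (qq μ τ α ρ (ra b g)) ∂(green μ) + (ENNReal.ofReal (ε / C) *
          ∫⁻ g, ENNReal.ofReal (kk α ρ (ra u g)) ∂(green μ) + ENNReal.ofReal M *
          ∫⁻ g in Bad, ENNReal.ofReal (kk α ρ (ra a g)) ∂(green μ)) := by
        rw [lintegral_add_left (qq_meas_ra μ τ α ρ b), lintegral_add_left ((hkm u).const_mul _),
          lintegral_const_mul _ (hkm u), lintegral_const_mul _ ((hkm a).indicator hBm), lintegral_indicator hBm]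
    _ ≤ ∫⁻ g, ENNReal.ofReal (qq μ τ α ρ (ra b g)) ∂(green μ) + (ENNReal.ofReal (ε / C) * ENNReal.ofReal C +
          ENNReal.ofReal M * ENNReal.ofReal (ε / M)) := by gcongr
    _ = _ := by
        rw [← ENNReal.ofReal_mul (by positivity), ← ENNReal.ofReal_mul (by positivity),
          ← ENNReal.ofReal_add (by positivity) (by positivity)]
        congr 2
        field_simp
        ring

lemma ff_EQ (hzd : ¬ IsSolvable (Subgroup.closure (measSupp μ))) {ε : ℝ} (hε : 0 < ε) :
    ∃ η > (0:ℝ), ∀ u u' : ℝ × ℝ, u ≠ 0 → ‖u' - u‖ ≤ η * ‖u‖ → |ff μ τ α ρ u' - ff μ τ α ρ u| ≤ ε := by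
  obtain ⟨C, hC, hG⟩ := green_kk μ τ hst hzd hα
  set e := ε / 2 with he
  have he0 : 0 < e := by positivity
  set M := Real.exp (α * (2 * ρ)) ^ 2 with hM
  have hM0 : 0 < M := by positivity
  obtain ⟨δ, hδ, hB⟩ := bad_green μ τ hst hzd hα (ε := e / M) (by positivity)
  obtain ⟨η, hη, hη2, hmod⟩ := qq_mod μ τ hst hα hρ (ε := e / C) (by positivity)
  refine ⟨min (1/2) (η * δ), by positivity, fun u u' hu h => ?_⟩
  have hn : 0 < ‖u‖ := norm_pos_iff.2 hu
  obtain ⟨hu', -⟩ := LL_near hu (h.trans (by gcongr; exact min_le_left _ _))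
  have hgood : ∀ g, ¬ ‖ra u g‖ < δ * (nm g * ‖u‖) →
      |qq μ τ α ρ (ra u' g) - qq μ τ α ρ (ra u g)| ≤ e / C * kk α ρ (ra u g) := by
    intro g hg
    push Not at hg
    apply hmod _ _ (ra_ne hu g)
    rw [← ra_sub]
    have hnm := nm_pos g
    calc ‖ra (u' - u) g‖ ≤ nm g * ‖u' - u‖ := ra_norm_le _ _
      _ ≤ nm g * (η * δ * ‖u‖) := by
          gcongr; exact h.trans (by gcongr; exact min_le_right _ _)
      _ = η * (δ * (nm g * ‖u‖)) := by ring
      _ ≤ _ := by gcongr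
  have h1 := ff_eq_aux μ τ hst hα hρ hC he0 u u' u hu' hu (hG u ρ hu) ((hB u hu).1 u' ρ hu')
    (fun g hg => by have := (abs_le.1 (hgood g hg)).2; linarith)
  have h2 := ff_eq_aux μ τ hst hα hρ hC he0 u u u' hu hu' (hG u ρ hu) ((hB u hu).1 u ρ hu)
    (fun g hg => by have := (abs_le.1 (hgood g hg)).1; linarith)
  have t1 := Gq_ne_top μ τ hst hα hρ hu
  have t2 := Gq_ne_top μ τ hst hα hρ hu'
  have e2 : 2 * e = ε := by rw [he]; ring
  rw [e2] at h1 h2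
  have h3 := ENNReal.toReal_mono (ENNReal.add_ne_top.2 ⟨t1, ENNReal.ofReal_ne_top⟩) h1
  have h4 := ENNReal.toReal_mono (ENNReal.add_ne_top.2 ⟨t2, ENNReal.ofReal_ne_top⟩) h2
  rw [ENNReal.toReal_add t1 ENNReal.ofReal_ne_top, ENNReal.toReal_ofReal hε.le] at h3
  rw [ENNReal.toReal_add t2 ENNReal.ofReal_ne_top, ENNReal.toReal_ofReal hε.le] at h4
  unfold ff
  rw [abs_le]; constructor <;> linarith

lemma qq_small {ε : ℝ} (hε : 0 < ε) : ∃ r > (0:ℝ), ∀ v : ℝ × ℝ, v ≠ 0 → ‖v‖ < r → qq μ τ α ρ v ≤ ε := by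
  set M := Real.exp (α * (2 * ρ)) ^ 2 with hM
  have hM0 : 0 < M := by positivity
  refine ⟨Real.exp (ρ - |Real.log (ε / M)| / α), Real.exp_pos _, fun v hv h => ?_⟩
  have hn : 0 < ‖v‖ := norm_pos_iff.2 hv
  have hL : LL v < ρ - |Real.log (ε / M)| / α := by
    unfold LL; rw [Real.log_lt_iff_lt_exp hn]; exact h
  have hk : kk α ρ v ≤ ε / M := by
    rw [← Real.exp_log (show 0 < ε / M by positivity)]
    unfold kk
    rw [Real.exp_le_exp]
    have h0 : |Real.log (ε / M)| / α < ρ - LL v := by linarith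
    rw [div_lt_iff₀ hα] at h0
    have h1 : ρ - LL v ≤ |LL v - ρ| := by rw [abs_sub_comm]; exact le_abs_self _
    have h2 := neg_abs_le (Real.log (ε / M))
    nlinarith
  refine (qq_le_kk μ τ hst hα hρ hv).trans ?_
  rw [← hM]
  have h1 := kk_le_one hα ρ v
  have h2 := kk_pos α ρ v
  rw [le_div_iff₀ hM0] at hk
  nlinarith [mul_pos hM0 h2]
end


lemma subharm_n (μ : Measure SL2) [IsProbabilityMeasure μ] {s Y : SL2 → ℝ≥0∞} (hs : Measurable s) (hY : Measurable Y)
    (h : ∀ b, ∫⁻ g, Y (b * g) ∂μ ≤ Y b + s b) (n : ℕ) : ∀ b,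
    ∫⁻ g, Y (b * g) ∂(mus μ n) ≤ Y b + ∫⁻ g, s (b * g) ∂(green μ) := by
  induction n with
  | zero =>
    intro b
    rw [lint_mus_zero μ (F := fun g => Y (b * g)) (hY.comp (measurable_const_mul b)), mul_one]
    exact le_self_add
  | succ n ih =>
    intro b
    have hsb : Measurable fun g => s (b * g) := hs.comp (measurable_const_mul b)
    have hYb : Measurable fun g => Y (b * g) := hY.comp (measurable_const_mul b)
    rw [lint_mus_succ μ hYb, green_eq μ hsb]
    calc ∫⁻ g, ∫⁻ h, Y (b * (g * h)) ∂(mus μ n) ∂μ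
        ≤ ∫⁻ g, (Y (b * g) + ∫⁻ h, s (b * (g * h)) ∂(green μ)) ∂μ := by
          apply lintegral_mono
          intro g
          simpa only [mul_assoc] using ih (b * g)
      _ = ∫⁻ g, Y (b * g) ∂μ + ∫⁻ g, ∫⁻ h, s (b * (g * h)) ∂(green μ) ∂μ := lintegral_add_left hYb _
      _ ≤ (Y b + s b) + ∫⁻ g, ∫⁻ h, s (b * (g * h)) ∂(green μ) ∂μ := by gcongr; exact h b
      _ = _ := by rw [mul_one, add_assoc]

def JJ (μ : Measure SL2) (α : ℝ) (F : ℝ × ℝ → ℝ) (v : ℝ × ℝ) : ℝ≥0∞ :=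
  ∫⁻ g, ENNReal.ofReal (mm α g ^ 2 * F (ra v g)) ∂μ

def Gc (μ : Measure SL2) (α ρ : ℝ) (F : ℝ × ℝ → ℝ) (u : ℝ × ℝ) : ℝ≥0∞ :=
  ∫⁻ g, ENNReal.ofReal (kk α ρ (ra u g) ^ 2) * JJ μ α F (ra u g) ∂(green μ)

section
variable (μ : Measure SL2) [IsProbabilityMeasure μ] (τ : Measure ℝ) [IsProbabilityMeasure τ]
  [NullSingletonClass τ]

lemma JJ_int_meas (α : ℝ) {F : ℝ × ℝ → ℝ} (hF : Measurable F) :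
    Measurable fun p : (ℝ × ℝ) × SL2 => ENNReal.ofReal (mm α p.2 ^ 2 * F (ra p.1 p.2)) :=
  ((((mm_meas α).comp measurable_snd).pow_const 2).mul (hF.comp meas_ra)).ennreal_ofReal

lemma JJ_meas (α : ℝ) {F : ℝ × ℝ → ℝ} (hF : Measurable F) : Measurable (JJ μ α F) :=
  (JJ_int_meas α hF).lintegral_prod_right'

lemma kJ_meas (α ρ : ℝ) {F : ℝ × ℝ → ℝ} (hF : Measurable F) :
    Measurable fun v => ENNReal.ofReal (kk α ρ v ^ 2) * JJ μ α F v :=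
  ((kk_meas α ρ).pow_const 2).ennreal_ofReal.mul (JJ_meas μ α hF)

lemma ph_step {α : ℝ} (hα : 0 < α) (ρ : ℝ) {u : ℝ × ℝ} (hu : u ≠ 0) (g : SL2) :
    ph α ρ (ra u g) ≤ ph α ρ u + kk α ρ u ^ 2 * mm α g ^ 2 := by
  have h1 := ph_lip hα ρ ρ u (ra u g)
  have h2 : |LL (ra u g) - ρ - (LL u - ρ)| ≤ Real.log (nm g) := by
    have := LL_ra hu g
    rwa [show LL (ra u g) - ρ - (LL u - ρ) = LL (ra u g) - LL u by ring]
  have h3 : Real.exp (α * |LL (ra u g) - ρ - (LL u - ρ)|) ^ 2 ≤ mm α g ^ 2 := by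
    unfold mm; gcongr
  have h4 := le_abs_self (ph α ρ (ra u g) - ph α ρ u)
  have h5 : Real.exp (α * |LL (ra u g) - ρ - (LL u - ρ)|) ^ 2 * kk α ρ u ^ 2 ≤ mm α g ^ 2 * kk α ρ u ^ 2 := by gcongr
  linarith

variable (hst : (μ.prod τ).map (fun p => mob p.1 p.2) = τ)
variable {α ρ : ℝ} (hα : 0 < α) (hρ : 0 ≤ ρ)
include hst hα hρ

lemma ee_step {u : ℝ × ℝ} (hu : u ≠ 0) :
    ∫⁻ g, ENNReal.ofReal (ph α (-ρ) (ra u g) * hh τ (ra u g) + ph α ρ (ra u g) * (1 - hh τ (ra u g))) ∂μ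
    ≤ ENNReal.ofReal (ph α (-ρ) u * hh τ u + ph α ρ u * (1 - hh τ u)) + (ENNReal.ofReal (qq μ τ α ρ u) +
      (ENNReal.ofReal (kk α (-ρ) u ^ 2) * JJ μ α (hh τ) u +
       ENNReal.ofReal (kk α ρ u ^ 2) * JJ μ α (fun v => 1 - hh τ v) u)) := by
  have hra := (cont_ra_right u).measurable
  have hmh : Measurable fun g => hh τ (ra u g) := (hh_meas τ).comp hra
  have hpn : ∀ v, 0 ≤ 1 - hh τ v := fun v => by linarith [hh_le_one τ v]
  have hn := fun g => hh_nonneg τ (ra_ne hu g)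
  have ha := ph_pos α (-ρ) u
  have hb := ph_pos α ρ u
  set a := ph α (-ρ) u with hadef
  set b := ph α ρ u with hbdef
  have i1 := hh_int_ra μ τ hst hu
  have i1a : Integrable (fun g => a * hh τ (ra u g)) μ := i1.const_mul a
  have i2' : Integrable (fun g => 1 - hh τ (ra u g)) μ := (integrable_const 1).sub i1
  have i2 : Integrable (fun g => b * (1 - hh τ (ra u g))) μ := i2'.const_mul b
  have i3 : Integrable (fun g => a * hh τ (ra u g) + b * (1 - hh τ (ra u g))) μ := i1a.add i2
  have hm1 : Measurable fun g => ENNReal.ofReal (mm α g ^ 2 * hh τ (ra u g)) :=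
    (((mm_meas α).pow_const 2).mul hmh).ennreal_ofReal
  have hm2 : Measurable fun g => ENNReal.ofReal (mm α g ^ 2 * (1 - hh τ (ra u g))) :=
    (((mm_meas α).pow_const 2).mul (hmh.const_sub 1)).ennreal_ofReal
  have hm0 : Measurable fun g => ENNReal.ofReal (a * hh τ (ra u g) + b * (1 - hh τ (ra u g))) :=
    ((hmh.const_mul a).add ((hmh.const_sub 1).const_mul b)).ennreal_ofReal
  have hI : ∫ g, hh τ (ra u g) ∂μ = hh τ u + q0 μ τ u := by unfold q0; ring
  have hfirst : ∫⁻ g, ENNReal.ofReal (a * hh τ (ra u g) + b * (1 - hh τ (ra u g))) ∂μ =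
      ENNReal.ofReal (a * hh τ u + b * (1 - hh τ u)) + ENNReal.ofReal (qq μ τ α ρ u) := by
    rw [← ofReal_integral_eq_lintegral_ofReal i3 (Eventually.of_forall fun g => by
        have := hn g; have := hpn (ra u g); simp only [Pi.zero_apply]; positivity),
      ← ENNReal.ofReal_add (by have := hh_nonneg τ hu; have := hpn u; positivity) (qq_nonneg μ τ hst hα hρ hu),
      integral_add i1a i2, integral_const_mul, integral_const_mul, integral_sub (integrable_const _) i1, hI]
    congr 1
    simp only [integral_const, probReal_univ, smul_eq_mul, qq]
    ring
  calc _ ≤ ∫⁻ g, (ENNReal.ofReal (a * hh τ (ra u g) + b * (1 - hh τ (ra u g))) +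
        (ENNReal.ofReal (kk α (-ρ) u ^ 2) * ENNReal.ofReal (mm α g ^ 2 * hh τ (ra u g)) +
         ENNReal.ofReal (kk α ρ u ^ 2) * ENNReal.ofReal (mm α g ^ 2 * (1 - hh τ (ra u g))))) ∂μ := by
        apply lintegral_mono
        intro g
        have n1 := hn g
        have n2 := hpn (ra u g)
        simp only
        rw [← ENNReal.ofReal_mul (by positivity), ← ENNReal.ofReal_mul (by positivity),
          ← ENNReal.ofReal_add (by positivity) (by positivity),
          ← ENNReal.ofReal_add (by positivity) (by positivity)]
        apply ENNReal.ofReal_le_ofReal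
        have s1 := mul_le_mul_of_nonneg_right (ph_step hα (-ρ) hu g) n1
        have s2 := mul_le_mul_of_nonneg_right (ph_step hα ρ hu g) n2
        rw [← hadef] at s1
        rw [← hbdef] at s2
        nlinarith [s1, s2]
    _ = _ := by
        rw [lintegral_add_left hm0, lintegral_add_left (hm1.const_mul _), lintegral_const_mul _ hm1,
          lintegral_const_mul _ hm2, hfirst, add_assoc]
        rfl

omit hst hα hρ in
lemma ph_ge {α : ℝ} (hα : 0 < α) (ρ L0 : ℝ) (v : ℝ × ℝ) (hL : L0 ≤ LL v) :
    1 ≤ ph α ρ v + Real.exp (α * |ρ - L0|) * kk α ρ v := by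
  have hE : 1 ≤ Real.exp (α * |ρ - L0|) := Real.one_le_exp (by positivity)
  by_cases hc : ρ ≤ LL v
  · have h1 : 1 - Real.exp (-(2 * α * (LL v - ρ))) ≤ ph α ρ v := by
      unfold ph
      set x := Real.exp (-(2 * α * (LL v - ρ)))
      have hx : 0 < x := Real.exp_pos _
      rw [← one_div, le_div_iff₀ (by positivity)]
      nlinarith
    have h2 : Real.exp (-(2 * α * (LL v - ρ))) ≤ kk α ρ v := by
      unfold kk
      rw [abs_of_nonneg (by linarith)]
      apply Real.exp_le_exp.2
      nlinarith [mul_nonneg hα.le (sub_nonneg.2 hc)]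
    have := kk_pos α ρ v
    nlinarith
  · push Not at hc
    have h1 := ph_pos α ρ v
    have : 1 ≤ Real.exp (α * |ρ - L0|) * kk α ρ v := by
      unfold kk
      rw [← Real.exp_add]
      apply Real.one_le_exp
      rw [abs_of_neg (by linarith : LL v - ρ < 0)]
      have := le_abs_self (ρ - L0)
      nlinarith
    linarith

lemma ph_lower (hzd : ¬ IsSolvable (Subgroup.closure (measSupp μ))) {ε : ℝ} (hε : 0 < ε) {u : ℝ × ℝ} (hu : u ≠ 0) :
    ∃ N, 1 ≤ ∫⁻ g, ENNReal.ofReal (ph α ρ (ra u g)) ∂(mus μ N) + ENNReal.ofReal ε := by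
  obtain ⟨C, hC, hG⟩ := green_kk μ τ hst hzd hα
  obtain ⟨δ, hδ, hB⟩ := bad_green μ τ hst hzd hα (ε := ε / 2) (by positivity)
  have hn : 0 < ‖u‖ := norm_pos_iff.2 hu
  set K := Real.exp (α * |ρ - Real.log (δ * ‖u‖)|) with hK
  have hK0 : 0 < K := Real.exp_pos _
  have hsum : ∑' n, ∫⁻ g, ENNReal.ofReal (kk α ρ (ra u g)) ∂(mus μ n) ≠ ⊤ := by
    rw [← lint_green]
    exact ne_top_of_le_ne_top ENNReal.ofReal_ne_top (hG u ρ hu)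
  have htz := ENNReal.tendsto_atTop_zero_of_tsum_ne_top hsum
  obtain ⟨N, hN⟩ := (htz.eventually_le_const (show (0:ℝ≥0∞) < ENNReal.ofReal (ε / 2 / K) by
    rw [ENNReal.ofReal_pos]; positivity)).exists
  refine ⟨N, ?_⟩
  set Bad : Set SL2 := {g | ‖ra u g‖ < δ * (nm g * ‖u‖)} with hBad
  have hBm : MeasurableSet Bad := by
    apply measurableSet_lt (cont_ra_right u).measurable.norm
    exact (cont_nm.measurable.mul_const _).const_mul _
  have hkm : Measurable fun g => ENNReal.ofReal (kk α ρ (ra u g)) :=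
      ((kk_meas α ρ).comp (cont_ra_right u).measurable).ennreal_ofReal
  have hpm : Measurable fun g => ENNReal.ofReal (ph α ρ (ra u g)) :=
      ((ph_meas α ρ).comp (cont_ra_right u).measurable).ennreal_ofReal
  calc (1:ℝ≥0∞) = ∫⁻ g, 1 ∂(mus μ N) := by simp
    _ ≤ ∫⁻ g, (ENNReal.ofReal (ph α ρ (ra u g)) + (ENNReal.ofReal K * ENNReal.ofReal (kk α ρ (ra u g)) +
          Bad.indicator 1 g)) ∂(mus μ N) := by
        apply lintegral_mono
        intro g
        simp only
        by_cases hg : g ∈ Bad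
        · rw [Set.indicator_of_mem hg, Pi.one_apply]
          exact le_add_left (le_add_left le_rfl)
        · rw [Set.indicator_of_notMem hg, add_zero, ← ENNReal.ofReal_mul hK0.le,
            ← ENNReal.ofReal_add (ph_pos _ _ _).le (mul_pos hK0 (kk_pos _ _ _)).le, ← ENNReal.ofReal_one]
          apply ENNReal.ofReal_le_ofReal
          apply ph_ge hα
          unfold LL
          apply Real.log_le_log (by positivity)
          have hg' : δ * (nm g * ‖u‖) ≤ ‖ra u g‖ := not_lt.1 hg
          refine le_trans ?_ hg'
          have := nm_ge_one g
          gcongr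
          nlinarith
    _ = ∫⁻ g, ENNReal.ofReal (ph α ρ (ra u g)) ∂(mus μ N) + (ENNReal.ofReal K *
          ∫⁻ g, ENNReal.ofReal (kk α ρ (ra u g)) ∂(mus μ N) + mus μ N Bad) := by
        rw [lintegral_add_left hpm, lintegral_add_left (hkm.const_mul _), lintegral_const_mul _ hkm,
          lintegral_indicator_one hBm]
    _ ≤ ∫⁻ g, ENNReal.ofReal (ph α ρ (ra u g)) ∂(mus μ N) + (ENNReal.ofReal K * ENNReal.ofReal (ε / 2 / K) +
          ENNReal.ofReal (ε / 2)) := by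
        gcongr
        exact (hB u hu).2 N
    _ = _ := by
        rw [← ENNReal.ofReal_mul hK0.le, ← ENNReal.ofReal_add (by positivity) (by positivity)]
        congr 2
        field_simp
        ring

lemma ff_upper (hzd : ¬ IsSolvable (Subgroup.closure (measSupp μ))) {u : ℝ × ℝ} (hu : u ≠ 0) :
    ENNReal.ofReal (ff μ τ α ρ u) ≤ ENNReal.ofReal (ph α (-ρ) u) + (Gc μ α (-ρ) (hh τ) u +
      Gc μ α ρ (fun v => 1 - hh τ v) u) := by
  have hra := (cont_ra_right u).measurable
  have hpm : Measurable fun v => 1 - hh τ v := (hh_meas τ).const_sub 1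
  set E : ℝ × ℝ → ℝ := fun v => ph α (-ρ) v * hh τ v + ph α ρ v * (1 - hh τ v) with hE
  have hEm : Measurable E := ((ph_meas _ _).mul (hh_meas τ)).add ((ph_meas _ _).mul hpm)
  have hEge : ∀ v, v ≠ 0 → ph α ρ v ≤ E v := by
    intro v hv
    have h1 := ph_mono hα (show -ρ ≤ ρ by linarith) v
    have := mul_nonneg (sub_nonneg.2 h1) (hh_nonneg τ hv)
    simp only [hE]; nlinarith
  have hEle : ∀ v, v ≠ 0 → E v ≤ ph α (-ρ) v := by
    intro v hv
    have h1 := ph_mono hα (show -ρ ≤ ρ by linarith) v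
    have := mul_nonneg (sub_nonneg.2 h1) (sub_nonneg.2 (hh_le_one τ v))
    simp only [hE]; nlinarith
  have hc1m := (kJ_meas μ α (-ρ) (hh_meas τ)).comp hra
  have hc2m := (kJ_meas μ α ρ hpm).comp hra
  have hit := fun n => subharm_n μ (s := fun b => ENNReal.ofReal (qq μ τ α ρ (ra u b)) +
      (ENNReal.ofReal (kk α (-ρ) (ra u b) ^ 2) * JJ μ α (hh τ) (ra u b) +
       ENNReal.ofReal (kk α ρ (ra u b) ^ 2) * JJ μ α (fun v => 1 - hh τ v) (ra u b)))
    (Y := fun b => ENNReal.ofReal (E (ra u b)))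
    ((qq_meas_ra μ τ α ρ u).add (hc1m.add hc2m)) (hEm.comp hra).ennreal_ofReal
    (fun b => by
      simp only [ra_mul]
      exact ee_step μ τ hst hα hρ (ra_ne hu b)) n 1
  simp only [one_mul, ra_one] at hit
  have htot : ∀ n, ∫⁻ g, ENNReal.ofReal (E (ra u g)) ∂(mus μ n) ≤ ENNReal.ofReal (E u) +
      (Gq μ τ α ρ u + (Gc μ α (-ρ) (hh τ) u + Gc μ α ρ (fun v => 1 - hh τ v) u)) := by
    intro n
    refine (hit n).trans (le_of_eq ?_)
    rw [lintegral_add_left (qq_meas_ra μ τ α ρ u)]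
    erw [lintegral_add_left hc1m]
    rfl
  have h1 : (1:ℝ≥0∞) ≤ ENNReal.ofReal (E u) +
      (Gq μ τ α ρ u + (Gc μ α (-ρ) (hh τ) u + Gc μ α ρ (fun v => 1 - hh τ v) u)) := by
    apply ENNReal.le_of_forall_pos_le_add
    intro ε hε _
    obtain ⟨N, hN⟩ := ph_lower μ τ hst hα hρ hzd (ε := ε) hε hu
    rw [ENNReal.ofReal_coe_nnreal] at hN
    refine hN.trans ?_
    gcongr
    refine le_trans (lintegral_mono fun g => ?_) (htot N)
    exact ENNReal.ofReal_le_ofReal (hEge _ (ra_ne hu g))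
  have h2 : ENNReal.ofReal (ff μ τ α ρ u) = 1 - Gq μ τ α ρ u := by
    unfold ff
    rw [ENNReal.ofReal_sub _ ENNReal.toReal_nonneg, ENNReal.ofReal_one, ENNReal.ofReal_toReal (Gq_ne_top μ τ hst hα hρ hu)]
  rw [h2, tsub_le_iff_right]
  refine h1.trans ?_
  have := ENNReal.ofReal_le_ofReal (hEle u hu)
  calc _ ≤ ENNReal.ofReal (ph α (-ρ) u) + (Gq μ τ α ρ u + (Gc μ α (-ρ) (hh τ) u + Gc μ α ρ (fun v => 1 - hh τ v) u)) := by gcongr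
    _ = _ := by ring
end


lemma ra_tendsto_zero (g : SL2) : Tendsto (fun v => ra v g) (nhdsWithin 0 {0}ᶜ) (nhdsWithin 0 {0}ᶜ) := by
  apply tendsto_nhdsWithin_of_tendsto_nhds_of_eventually_within
  · have h0 : ra (0:ℝ × ℝ) g = 0 := by simp [ra]
    have := (cont_ra_left g).tendsto 0
    rw [h0] at this
    exact this.mono_left nhdsWithin_le_nhds
  · filter_upwards [self_mem_nhdsWithin] with v hv
    exact ra_ne hv g

lemma ra_tendsto_infty (g : SL2) : Tendsto (fun v => ra v g) (Bornology.cobounded (ℝ × ℝ)) (Bornology.cobounded (ℝ × ℝ)) := by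
  rw [← tendsto_norm_atTop_iff_cobounded]
  have h : Tendsto (fun v : ℝ × ℝ => ‖v‖ / nm g) (Bornology.cobounded (ℝ × ℝ)) atTop :=
    tendsto_norm_cobounded_atTop.atTop_div_const (nm_pos g)
  refine tendsto_atTop_mono (fun v => ?_) h
  rw [div_le_iff₀ (nm_pos g)]
  linarith [ra_norm_ge v g, mul_comm (nm g) ‖ra v g‖]

section
variable (μ : Measure SL2) [IsProbabilityMeasure μ] (τ : Measure ℝ) [IsProbabilityMeasure τ]
  [NullSingletonClass τ]

lemma JJ_le {α : ℝ} {F : ℝ × ℝ → ℝ} (hF : ∀ v, v ≠ 0 → F v ≤ 1) {v : ℝ × ℝ} (hv : v ≠ 0) :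
    JJ μ α F v ≤ ∫⁻ g, ENNReal.ofReal (mm α g ^ 2) ∂μ := by
  apply lintegral_mono
  intro g
  apply ENNReal.ofReal_le_ofReal
  have := hF _ (ra_ne hv g)
  nlinarith [sq_nonneg (mm α g)]

lemma JJ_tendsto {α : ℝ} (hmo : ∫⁻ g, ENNReal.ofReal (mm α g ^ 2) ∂μ < ⊤) {F : ℝ × ℝ → ℝ} (hFm : Measurable F)
    (hF : ∀ v, v ≠ 0 → F v ≤ 1) {l : Filter (ℝ × ℝ)} [l.IsCountablyGenerated] (hl : ∀ᶠ v in l, v ≠ 0)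
    (hra : ∀ g, Tendsto (fun v => ra v g) l l) (hFl : Tendsto F l (nhds 0)) :
    Tendsto (JJ μ α F) l (nhds 0) := by
  have : (0:ℝ≥0∞) = ∫⁻ g : SL2, 0 ∂μ := by simp
  rw [this]
  unfold JJ
  apply tendsto_lintegral_filter_of_dominated_convergence (fun g => ENNReal.ofReal (mm α g ^ 2))
  · refine Eventually.of_forall fun v => ?_
    have hm : Measurable fun g => F (ra v g) := hFm.comp (cont_ra_right v).measurable
    exact (((mm_meas α).pow_const 2).mul hm).ennreal_ofReal
  · filter_upwards [hl] with v hv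
    refine Eventually.of_forall fun g => ?_
    apply ENNReal.ofReal_le_ofReal
    have := hF _ (ra_ne hv g)
    nlinarith [sq_nonneg (mm α g)]
  · exact hmo.ne
  · refine Eventually.of_forall fun g => ?_
    have h1 : Tendsto (fun v => mm α g ^ 2 * F (ra v g)) l (nhds (mm α g ^ 2 * 0)) :=
      (hFl.comp (hra g)).const_mul _
    rw [mul_zero] at h1
    have := ENNReal.tendsto_ofReal h1
    rwa [ENNReal.ofReal_zero] at this

lemma kk_small {α : ℝ} (hα : 0 < α) {c : ℝ} (hc : 0 < c) : ∃ T : ℝ, ∀ ρ v, T ≤ |LL v - ρ| → kk α ρ v ≤ c := by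
  refine ⟨|Real.log c| / α, fun ρ v h => ?_⟩
  rw [← Real.exp_log hc]
  unfold kk
  rw [Real.exp_le_exp]
  rw [div_le_iff₀ hα] at h
  have h2 := neg_abs_le (Real.log c)
  nlinarith

lemma kJ_small {α : ℝ} (hα : 0 < α) (hmo : ∫⁻ g, ENNReal.ofReal (mm α g ^ 2) ∂μ < ⊤) {F : ℝ × ℝ → ℝ}
    (hF : ∀ v, v ≠ 0 → F v ≤ 1) {ε : ℝ} (hε : 0 < ε) (P : ℝ × ℝ → Prop) (hP : ∀ v, v ≠ 0 → P v → JJ μ α F v ≤ ENNReal.ofReal ε) :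
    ∃ T : ℝ, ∀ ρ v, v ≠ 0 → (¬ P v → T ≤ |LL v - ρ|) → ENNReal.ofReal (kk α ρ v) * JJ μ α F v ≤ ENNReal.ofReal ε := by
  set m := (∫⁻ g, ENNReal.ofReal (mm α g ^ 2) ∂μ).toReal with hm
  have hmm : ∫⁻ g, ENNReal.ofReal (mm α g ^ 2) ∂μ = ENNReal.ofReal m := (ENNReal.ofReal_toReal hmo.ne).symm
  have hm0 : 0 ≤ m := ENNReal.toReal_nonneg
  obtain ⟨T, hT⟩ := kk_small hα (c := ε / (m + 1)) (by positivity)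
  refine ⟨T, fun ρ v hv h => ?_⟩
  by_cases hp : P v
  · calc _ ≤ ENNReal.ofReal 1 * ENNReal.ofReal ε := by
          gcongr
          · exact kk_le_one hα ρ v
          · exact hP v hv hp
      _ = _ := by simp
  · have h1 := hT ρ v (h hp)
    calc _ ≤ ENNReal.ofReal (ε / (m + 1)) * ENNReal.ofReal m := by
          gcongr
          rw [← hmm]; exact JJ_le μ hF hv
      _ = ENNReal.ofReal (ε / (m + 1) * m) := by rw [← ENNReal.ofReal_mul (by positivity)]
      _ ≤ _ := by
          apply ENNReal.ofReal_le_ofReal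
          rw [div_mul_eq_mul_div, div_le_iff₀ (by positivity)]
          nlinarith

lemma J2_small {α : ℝ} (hα : 0 < α) (hmo : ∫⁻ g, ENNReal.ofReal (mm α g ^ 2) ∂μ < ⊤) {ε : ℝ} (hε : 0 < ε) :
    ∃ R : ℝ, ∀ ρ, R ≤ ρ → ∀ v, v ≠ 0 → ENNReal.ofReal (kk α ρ v) * JJ μ α (fun v => 1 - hh τ v) v ≤ ENNReal.ofReal ε := by
  have hF : ∀ v : ℝ × ℝ, v ≠ 0 → 1 - hh τ v ≤ 1 := fun v hv => by linarith [hh_nonneg τ hv]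
  have hcb : Bornology.cobounded (ℝ × ℝ) = comap norm atTop := comap_norm_atTop.symm
  have : (Bornology.cobounded (ℝ × ℝ)).IsCountablyGenerated := by rw [hcb]; infer_instance
  have ht := JJ_tendsto μ hmo ((hh_meas τ).const_sub 1) hF (l := Bornology.cobounded (ℝ × ℝ))
    (by
      have := (tendsto_norm_cobounded_atTop (E := ℝ × ℝ)).eventually_gt_atTop 0
      filter_upwards [this] with v hv using norm_pos_iff.1 hv) ra_tendsto_infty
    (by have := (hh_infty τ).const_sub 1; rwa [sub_self] at this)
  have h1 := ht.eventually_le_const (show (0:ℝ≥0∞) < ENNReal.ofReal ε by simpa using hε)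
  rw [hcb, eventually_comap] at h1
  obtain ⟨R, hR⟩ := eventually_atTop.1 h1
  obtain ⟨T, hT⟩ := kJ_small μ hα hmo hF hε (fun v => R ≤ ‖v‖) (fun v _ hv => hR _ hv v rfl)
  refine ⟨Real.log (max R 1) + T, fun ρ hρ v hv => hT ρ v hv fun h => ?_⟩
  push Not at h
  have : LL v ≤ Real.log (max R 1) := Real.log_le_log (norm_pos_iff.2 hv) (h.le.trans (le_max_left _ _))
  rw [abs_sub_comm]
  exact le_trans (by linarith) (le_abs_self _)

lemma hbar_le_one (v : ℝ × ℝ) : hbar τ v ≤ 1 := by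
  unfold hbar
  by_cases hi : IntegrableOn (fun s : ℝ => hh τ ((√s)⁻¹ • v)) (Set.Icc 1 2)
  · calc _ ≤ ∫ s in Set.Icc (1:ℝ) 2, (1:ℝ) := by
          apply setIntegral_mono_on hi (integrableOn_const (by simp)) measurableSet_Icc
          intro s _; exact hh_le_one τ _
      _ = 1 := by simp; norm_num
  · rw [integral_undef hi]; norm_num

lemma meas_sc : Measurable fun p : (ℝ × ℝ) × ℝ => (√p.2)⁻¹ • p.1 := by
  have h : Measurable fun p : (ℝ × ℝ) × ℝ => (√p.2)⁻¹ := (Real.continuous_sqrt.measurable.comp measurable_snd).inv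
  exact h.smul measurable_fst

lemma sc_ne {s : ℝ} (hs : s ∈ Set.Icc (1:ℝ) 2) {v : ℝ × ℝ} (hv : v ≠ 0) : (√s)⁻¹ • v ≠ 0 :=
  smul_ne_zero (inv_ne_zero (Real.sqrt_ne_zero'.2 (by linarith [hs.1]))) hv

lemma hbar_lint {v : ℝ × ℝ} (hv : v ≠ 0) : ∫⁻ s in Set.Icc (1:ℝ) 2, ENNReal.ofReal (hh τ ((√s)⁻¹ • v)) =
    ENNReal.ofReal (hbar τ v) := by
  unfold hbar
  have hm : Measurable fun s : ℝ => hh τ ((√s)⁻¹ • v) := (hh_meas τ).comp (meas_sc.comp measurable_prodMk_left)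
  have hmem : ∀ᵐ s ∂(volume.restrict (Set.Icc (1:ℝ) 2)), s ∈ Set.Icc (1:ℝ) 2 := ae_restrict_mem measurableSet_Icc
  rw [ofReal_integral_eq_lintegral_ofReal]
  · apply Integrable.of_bound hm.aestronglyMeasurable 1
    filter_upwards [hmem] with s hs
    exact hh_abs_le τ (sc_ne hs hv)
  · filter_upwards [hmem] with s hs
    exact hh_nonneg τ (sc_ne hs hv)

lemma hbar_meas : Measurable (hbar τ) := by
  unfold hbar
  exact (((hh_meas τ).comp meas_sc).stronglyMeasurable.integral_prod_right'
    (ν := volume.restrict (Set.Icc (1:ℝ) 2))).measurable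

lemma J1_small {α : ℝ} (hα : 0 < α) (hmo : ∫⁻ g, ENNReal.ofReal (mm α g ^ 2) ∂μ < ⊤) {ε : ℝ} (hε : 0 < ε) :
    ∃ R : ℝ, ∀ ρ, R ≤ ρ → ∀ v, v ≠ 0 → ENNReal.ofReal (kk α (-ρ) v) * JJ μ α (hbar τ) v ≤ ENNReal.ofReal ε := by
  have hF : ∀ v : ℝ × ℝ, v ≠ 0 → hbar τ v ≤ 1 := fun v _ => hbar_le_one τ v
  have ht := JJ_tendsto μ hmo (hbar_meas τ) hF (l := nhdsWithin 0 {0}ᶜ)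
    self_mem_nhdsWithin ra_tendsto_zero (hbar_tendsto τ)
  have h1 := ht.eventually_le_const (show (0:ℝ≥0∞) < ENNReal.ofReal ε by simpa using hε)
  obtain ⟨r, hr, hr'⟩ := Metric.mem_nhdsWithin_iff.1 h1
  obtain ⟨T, hT⟩ := kJ_small μ hα hmo hF hε (fun v => ‖v‖ < r) (fun v hv h => hr' ⟨by simpa using h, hv⟩)
  refine ⟨-Real.log r + T, fun ρ hρ v hv => hT _ v hv fun h => ?_⟩
  push Not at h
  have : Real.log r ≤ LL v := Real.log_le_log hr h
  exact le_trans (by linarith) (le_abs_self _)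

lemma JJ_avg (α : ℝ) {v : ℝ × ℝ} (hv : v ≠ 0) : ∫⁻ s in Set.Icc (1:ℝ) 2, JJ μ α (hh τ) ((√s)⁻¹ • v) = JJ μ α (hbar τ) v := by
  unfold JJ
  rw [lintegral_lintegral_swap]
  · apply lintegral_congr
    intro g
    have hq : 0 ≤ mm α g ^ 2 := sq_nonneg _
    simp_rw [ra_smul, ENNReal.ofReal_mul hq]
    rw [lintegral_const_mul', hbar_lint τ (ra_ne hv g)]
    exact ENNReal.ofReal_ne_top
  · apply Measurable.aemeasurable
    have h : Measurable fun p : ℝ × SL2 => ((√p.1)⁻¹ • v, p.2) :=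
      Measurable.prodMk (meas_sc.comp (measurable_const.prodMk measurable_fst)) measurable_snd
    have h2 : Measurable fun p : ℝ × SL2 => hh τ (ra ((√p.1)⁻¹ • v) p.2) := (hh_meas τ).comp (meas_ra.comp h)
    have h3 : Measurable fun p : ℝ × SL2 => mm α p.2 ^ 2 := ((mm_meas α).comp measurable_snd).pow_const 2
    exact (h3.mul h2).ennreal_ofReal

lemma LL_sc {s : ℝ} (hs : s ∈ Set.Icc (1:ℝ) 2) {v : ℝ × ℝ} (hv : v ≠ 0) :
    LL ((√s)⁻¹ • v) ≤ LL v ∧ |LL ((√s)⁻¹ • v) - LL v| ≤ 1 := by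
  have hs0 : 0 < √s := Real.sqrt_pos.2 (by linarith [hs.1])
  have h1 : 1 ≤ √s := by rw [Real.one_le_sqrt]; exact hs.1
  have h2 : √s ≤ 2 := by rw [Real.sqrt_le_left (by norm_num)]; linarith [hs.2]
  rw [LL_smul (inv_pos.2 hs0) hv, Real.log_inv]
  have h3 := Real.log_nonneg h1
  have h4 : Real.log √s ≤ 1 := by
    have := Real.log_le_sub_one_of_pos hs0; linarith
  refine ⟨by linarith, ?_⟩
  rw [abs_le]; constructor <;> linarith

variable (hst : (μ.prod τ).map (fun p => mob p.1 p.2) = τ)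
variable {α : ℝ} (hα : 0 < α)
include hst hα

lemma Gc1_avg {C ε ρ : ℝ} (hε : 0 < ε) {u : ℝ × ℝ} (hu : u ≠ 0)
    (hC : ∫⁻ g, ENNReal.ofReal (kk α (-ρ) (ra u g)) ∂(green μ) ≤ ENNReal.ofReal C)
    (hJ : ∀ v, v ≠ 0 → ENNReal.ofReal (kk α (-ρ) v) * JJ μ α (hbar τ) v ≤ ENNReal.ofReal ε) :
    ∫⁻ s in Set.Icc (1:ℝ) 2, Gc μ α (-ρ) (hh τ) ((√s)⁻¹ • u) ≤
      ENNReal.ofReal (Real.exp (α * 1) ^ 2) * (ENNReal.ofReal ε * ENNReal.ofReal C) := by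
  set E := Real.exp (α * 1) with hE
  unfold Gc
  rw [lintegral_lintegral_swap]
  · calc _ ≤ ∫⁻ g, ENNReal.ofReal (E ^ 2) * (ENNReal.ofReal ε * ENNReal.ofReal (kk α (-ρ) (ra u g))) ∂(green μ) := by
          apply lintegral_mono
          intro g
          simp only [ra_smul]
          set v := ra u g with hv
          have hv0 : v ≠ 0 := ra_ne hu g
          have hk0 := kk_pos α (-ρ) v
          calc _ ≤ ∫⁻ s in Set.Icc (1:ℝ) 2, ENNReal.ofReal (E ^ 2 * kk α (-ρ) v ^ 2) * JJ μ α (hh τ) ((√s)⁻¹ • v) := by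
                apply lintegral_mono_ae
                filter_upwards [ae_restrict_mem measurableSet_Icc] with s hs
                gcongr
                have := kk_lip hα (-ρ) 1 _ _ (LL_sc hs hv0).2
                have h2 := kk_pos α (-ρ) ((√s)⁻¹ • v)
                calc _ ≤ (E * kk α (-ρ) v) ^ 2 := by gcongr
                  _ = _ := by ring
            _ = ENNReal.ofReal (E ^ 2 * kk α (-ρ) v ^ 2) * JJ μ α (hbar τ) v := by
                rw [lintegral_const_mul' _ _ ENNReal.ofReal_ne_top, JJ_avg μ τ α hv0]
            _ = ENNReal.ofReal (E ^ 2) * (ENNReal.ofReal (kk α (-ρ) v) * JJ μ α (hbar τ) v * ENNReal.ofReal (kk α (-ρ) v)) := by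
                rw [ENNReal.ofReal_mul (by positivity), pow_two (kk _ _ _), ENNReal.ofReal_mul (by positivity)]
                ring
            _ ≤ _ := by gcongr; exact hJ v hv0
      _ ≤ _ := by
          have hkm : Measurable fun g => ENNReal.ofReal (kk α (-ρ) (ra u g)) :=
            ((kk_meas α (-ρ)).comp (cont_ra_right u).measurable).ennreal_ofReal
          rw [lintegral_const_mul _ (hkm.const_mul _), lintegral_const_mul _ hkm]
          gcongr
  · apply Measurable.aemeasurable
    have h : Measurable fun p : ℝ × SL2 => ra ((√p.1)⁻¹ • u) p.2 :=
      meas_ra.comp (Measurable.prodMk (meas_sc.comp (measurable_const.prodMk measurable_fst)) measurable_snd)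
    exact (kJ_meas μ α (-ρ) (hh_meas τ)).comp h

omit hst in
lemma Gc2_le {C ε ρ : ℝ} (hε : 0 < ε) {u : ℝ × ℝ} (hu : u ≠ 0)
    (hC : ∫⁻ g, ENNReal.ofReal (kk α ρ (ra u g)) ∂(green μ) ≤ ENNReal.ofReal C)
    (hJ : ∀ v, v ≠ 0 → ENNReal.ofReal (kk α ρ v) * JJ μ α (fun v => 1 - hh τ v) v ≤ ENNReal.ofReal ε) :
    Gc μ α ρ (fun v => 1 - hh τ v) u ≤ ENNReal.ofReal ε * ENNReal.ofReal C := by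
  unfold Gc
  have hkm : Measurable fun g => ENNReal.ofReal (kk α ρ (ra u g)) :=
    ((kk_meas α ρ).comp (cont_ra_right u).measurable).ennreal_ofReal
  calc _ ≤ ∫⁻ g, ENNReal.ofReal ε * ENNReal.ofReal (kk α ρ (ra u g)) ∂(green μ) := by
        apply lintegral_mono
        intro g
        simp only
        have hk0 := kk_pos α ρ (ra u g)
        calc _ = ENNReal.ofReal (kk α ρ (ra u g)) * JJ μ α (fun v => 1 - hh τ v) (ra u g) * ENNReal.ofReal (kk α ρ (ra u g)) := by
              rw [pow_two, ENNReal.ofReal_mul (by positivity)]; ring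
          _ ≤ _ := by gcongr; exact hJ _ (ra_ne hu g)
    _ ≤ _ := by
        rw [lintegral_const_mul _ hkm]
        gcongr

lemma ff_avg (hzd : ¬ IsSolvable (Subgroup.closure (measSupp μ)))
    (hmo : ∫⁻ g, ENNReal.ofReal (mm α g ^ 2) ∂μ < ⊤) {ε : ℝ} (hε : 0 < ε) :
    ∃ ρ, 0 ≤ ρ ∧ ∃ r > (0:ℝ), ∀ u : ℝ × ℝ, u ≠ 0 → ‖u‖ < r →
      ∫⁻ s in Set.Icc (1:ℝ) 2, ENNReal.ofReal (ff μ τ α ρ ((√s)⁻¹ • u)) ≤ ENNReal.ofReal ε := by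
  obtain ⟨C, hC, hG⟩ := green_kk μ τ hst hzd hα
  set E := Real.exp (α * 1) with hE
  have hE0 : 0 < E := Real.exp_pos _
  set e := ε / (3 * E ^ 2 * C) with he
  set e' := ε / (3 * C) with he'
  have he0 : 0 < e := by positivity
  have he0' : 0 < e' := by positivity
  obtain ⟨R1, hR1⟩ := J1_small μ τ hα hmo he0
  obtain ⟨R2, hR2⟩ := J2_small μ τ hα hmo he0'
  set ρ := max (max R1 R2) 0 with hρd
  have hρ : 0 ≤ ρ := le_max_right _ _
  have hJ1 := hR1 ρ ((le_max_left _ _).trans (le_max_left _ _))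
  have hJ2 := hR2 ρ ((le_max_right _ _).trans (le_max_left _ _))
  refine ⟨ρ, hρ, Real.exp (Real.log (ε / 3) / (2 * α) - ρ), Real.exp_pos _, fun u hu hur => ?_⟩
  have hn : 0 < ‖u‖ := norm_pos_iff.2 hu
  have hLu : LL u < Real.log (ε / 3) / (2 * α) - ρ := by
    unfold LL; rw [Real.log_lt_iff_lt_exp hn]; exact hur
  have hmem : ∀ᵐ s ∂(volume.restrict (Set.Icc (1:ℝ) 2)), s ∈ Set.Icc (1:ℝ) 2 := ae_restrict_mem measurableSet_Icc
  calc _ ≤ ∫⁻ s in Set.Icc (1:ℝ) 2, (ENNReal.ofReal (ε / 3) + (Gc μ α (-ρ) (hh τ) ((√s)⁻¹ • u) +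
        ENNReal.ofReal e' * ENNReal.ofReal C)) := by
        apply lintegral_mono_ae
        filter_upwards [hmem] with s hs
        have hs0 := sc_ne hs hu
        refine (ff_upper μ τ hst hα hρ hzd hs0).trans ?_
        gcongr
        · have hL := (LL_sc hs hu).1
          unfold ph
          have h1 : Real.exp (-Real.log (ε / 3)) ≤ Real.exp (-(2 * α * (LL ((√s)⁻¹ • u) - -ρ))) := by
            rw [Real.exp_le_exp]
            have : LL ((√s)⁻¹ • u) + ρ < Real.log (ε / 3) / (2 * α) := by linarith
            rw [lt_div_iff₀ (by positivity)] at this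
            nlinarith
          rw [Real.exp_neg, Real.exp_log (by positivity)] at h1
          rw [inv_le_comm₀ (by positivity) (by positivity)]
          linarith
        · exact Gc2_le μ τ hα he0' hs0 (hG _ ρ hs0) hJ2
    _ = ENNReal.ofReal (ε / 3) + ((∫⁻ s in Set.Icc (1:ℝ) 2, Gc μ α (-ρ) (hh τ) ((√s)⁻¹ • u)) +
        ENNReal.ofReal e' * ENNReal.ofReal C) := by
        rw [lintegral_add_left measurable_const, lintegral_add_right _ measurable_const]
        simp only [lintegral_const, Measure.restrict_apply_univ, Real.volume_Icc]
        norm_num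
    _ ≤ ENNReal.ofReal (ε / 3) + (ENNReal.ofReal (E ^ 2) * (ENNReal.ofReal e * ENNReal.ofReal C) +
        ENNReal.ofReal e' * ENNReal.ofReal C) := by
        gcongr
        exact Gc1_avg μ τ hst hα he0 hu (hG u (-ρ) hu) hJ1
    _ = _ := by
        rw [← ENNReal.ofReal_mul he0.le, ← ENNReal.ofReal_mul he0'.le, ← ENNReal.ofReal_mul (by positivity),
          ← ENNReal.ofReal_add (by positivity) (by positivity), ← ENNReal.ofReal_add (by positivity) (by positivity)]
        congr 1
        rw [he, he']
        field_simp
        ring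
end


/-- sequences tending to zero along which `f` tends to `M` -/
def Mx (f : ℝ × ℝ → ℝ) (M : ℝ) (w : ℕ → ℝ × ℝ) : Prop :=
  (∀ n, w n ≠ 0) ∧ Tendsto w atTop (nhds 0) ∧ Tendsto (fun n => f (w n)) atTop (nhds M)

/-- relative uniform continuity -/
def EQf (f : ℝ × ℝ → ℝ) : Prop :=
  ∀ ε > (0:ℝ), ∃ η > (0:ℝ), ∀ u u' : ℝ × ℝ, u ≠ 0 → ‖u' - u‖ ≤ η * ‖u‖ → |f u' - f u| ≤ ε

lemma ra_zero (g : SL2) : ra 0 g = 0 := by simp [ra]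

lemma ra_seq_zero {w : ℕ → ℝ × ℝ} (h : Tendsto w atTop (nhds 0)) (g : SL2) :
    Tendsto (fun n => ra (w n) g) atTop (nhds 0) := by
  have := ((cont_ra_left g).tendsto 0).comp h
  rwa [ra_zero] at this

lemma ra_diff (g0 : SL2) {η : ℝ} (hη : 0 < η) : ∃ U : Set SL2, IsOpen U ∧ g0 ∈ U ∧ ∀ g ∈ U, ∀ u : ℝ × ℝ,
    ‖ra u g - ra u g0‖ ≤ η * ‖ra u g0‖ := by
  set D : SL2 → ℝ := fun g => |g.1 0 0 - g0.1 0 0| + |g.1 0 1 - g0.1 0 1| + |g.1 1 0 - g0.1 1 0| + |g.1 1 1 - g0.1 1 1| with hD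
  have hDc : Continuous D := by
    have h := fun i j => (((cont_entry i j).sub (continuous_const (y := g0.1 i j)))).abs
    exact (((h 0 0).add (h 0 1)).add (h 1 0)).add (h 1 1)
  have hn := nm_pos g0
  refine ⟨{g | D g < η / nm g0}, isOpen_lt hDc continuous_const, ?_, ?_⟩
  · simp only [hD, Set.mem_setOf_eq, sub_self, abs_zero, add_zero]; positivity
  · intro g hg u
    have h1 : |u.1| ≤ ‖u‖ := norm_fst_le u
    have h2 : |u.2| ≤ ‖u‖ := norm_snd_le u
    have hD0 : 0 ≤ D g := by simp only [hD]; positivity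
    have key : ∀ x y a b : ℝ, |x| ≤ ‖u‖ → |y| ≤ ‖u‖ → |x * a + y * b| ≤ (|a| + |b|) * ‖u‖ := by
      intro x y a b hx hy
      calc _ ≤ |x * a| + |y * b| := abs_add_le _ _
        _ = |x| * |a| + |y| * |b| := by rw [abs_mul, abs_mul]
        _ ≤ ‖u‖ * |a| + ‖u‖ * |b| := by gcongr
        _ = _ := by ring
    have h3 : ‖ra u g - ra u g0‖ ≤ D g * ‖u‖ := by
      rw [Prod.norm_def]
      apply max_le
      · have := key u.1 u.2 (g.1 0 0 - g0.1 0 0) (g.1 1 0 - g0.1 1 0) h1 h2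
        simp only [ra, Prod.fst_sub, Real.norm_eq_abs]
        calc _ = |u.1 * (g.1 0 0 - g0.1 0 0) + u.2 * (g.1 1 0 - g0.1 1 0)| := by congr 1; ring
          _ ≤ _ := this
          _ ≤ _ := by
            gcongr
            simp only [hD]
            linarith [abs_nonneg (g.1 0 1 - g0.1 0 1), abs_nonneg (g.1 1 1 - g0.1 1 1)]
      · have := key u.1 u.2 (g.1 0 1 - g0.1 0 1) (g.1 1 1 - g0.1 1 1) h1 h2
        simp only [ra, Prod.snd_sub, Real.norm_eq_abs]
        calc _ = |u.1 * (g.1 0 1 - g0.1 0 1) + u.2 * (g.1 1 1 - g0.1 1 1)| := by congr 1; ring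
          _ ≤ _ := this
          _ ≤ _ := by
            gcongr
            simp only [hD]
            linarith [abs_nonneg (g.1 0 0 - g0.1 0 0), abs_nonneg (g.1 1 0 - g0.1 1 0)]
    calc _ ≤ D g * ‖u‖ := h3
      _ ≤ (η / nm g0) * (nm g0 * ‖ra u g0‖) := by
          have hg' : D g ≤ η / nm g0 := le_of_lt hg
          have := ra_norm_ge u g0
          gcongr
      _ = _ := by field_simp

section
variable (μ : Measure SL2) [IsProbabilityMeasure μ] {f q : ℝ × ℝ → ℝ} {M : ℝ}
variable (hf0 : ∀ u, u ≠ 0 → 0 ≤ f u) (hf1 : ∀ u, f u ≤ 1) (hfm : Measurable f) (hEQ : EQf f)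
  (hharm : ∀ u, u ≠ 0 → ∫ g, f (ra u g) ∂μ = f u + q u)
  (hq : Tendsto q (nhdsWithin 0 {0}ᶜ) (nhds 0))
  (hM : ∀ ε > (0:ℝ), ∃ r > (0:ℝ), ∀ u : ℝ × ℝ, u ≠ 0 → ‖u‖ < r → f u ≤ M + ε)
include hf0 hf1 hfm hEQ hharm hq hM

omit hf0 hf1 hfm hEQ hharm hq in
lemma mx_up {w : ℕ → ℝ × ℝ} (hw0 : ∀ n, w n ≠ 0) (hw : Tendsto w atTop (nhds 0)) {ε : ℝ} (hε : 0 < ε) :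
    ∀ᶠ n in atTop, f (w n) ≤ M + ε := by
  obtain ⟨r, hr, h⟩ := hM ε hε
  filter_upwards [hw.norm.eventually_lt_const (show ‖(0:ℝ × ℝ)‖ < r by simpa using hr)] with n hn
  exact h _ (hw0 n) hn

lemma mx_step {w : ℕ → ℝ × ℝ} (hw : Mx f M w) {g0 : SL2} (hg0 : g0 ∈ measSupp μ) :
    Mx f M (fun n => ra (w n) g0) := by
  obtain ⟨hw0, hwz, hwM⟩ := hw
  have hra0 : ∀ g n, ra (w n) g ≠ 0 := fun g n => ra_ne (hw0 n) g
  refine ⟨hra0 g0, ra_seq_zero hwz g0, ?_⟩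
  have hmeas : ∀ n, Measurable fun g => f (ra (w n) g) := fun n => hfm.comp (cont_ra_right (w n)).measurable
  have hIntg : ∀ n, Integrable (fun g => f (ra (w n) g)) μ := fun n => by
    apply Integrable.of_bound (hmeas n).aestronglyMeasurable 1
    refine Eventually.of_forall fun g => ?_
    rw [Real.norm_eq_abs, abs_of_nonneg (hf0 _ (hra0 g n))]; exact hf1 _
  have hmax : Tendsto (fun n => ∫ g, max (f (ra (w n) g)) M ∂μ) atTop (nhds (∫ g : SL2, M ∂μ)) := by
    apply tendsto_integral_of_dominated_convergence (fun _ => 1 + |M|)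
    · exact fun n => ((hmeas n).max measurable_const).aestronglyMeasurable
    · exact integrable_const _
    · intro n
      refine Eventually.of_forall fun g => ?_
      rw [Real.norm_eq_abs, abs_le]
      have h1 := hf0 _ (hra0 g n)
      have h2 := hf1 (ra (w n) g)
      have h3 := neg_abs_le M
      have h4 := le_abs_self M
      have h5 := abs_nonneg M
      constructor
      · exact le_trans (by linarith) (le_max_left _ _)
      · exact max_le (by linarith) (by linarith)
    · refine Eventually.of_forall fun g => ?_
      rw [Metric.tendsto_atTop']
      intro ε hε
      obtain ⟨N, hN⟩ := eventually_atTop.1 (mx_up hM (hra0 g) (ra_seq_zero hwz g) (half_pos hε))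
      refine ⟨N, fun n hn => ?_⟩
      have := hN n hn.le
      rw [Real.dist_eq, abs_lt]
      constructor
      · linarith [le_max_right (f (ra (w n) g)) M]
      · have : max (f (ra (w n) g)) M ≤ M + ε / 2 := max_le this (by linarith)
        linarith
  have hfI : Tendsto (fun n => ∫ g, f (ra (w n) g) ∂μ) atTop (nhds M) := by
    have h1 : Tendsto (fun n => f (w n) + q (w n)) atTop (nhds (M + 0)) := by
      apply hwM.add
      exact hq.comp (tendsto_nhdsWithin_of_tendsto_nhds_of_eventually_within _ hwz (Eventually.of_forall hw0))
    rw [add_zero] at h1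
    exact h1.congr fun n => (hharm _ (hw0 n)).symm
  have hd : Tendsto (fun n => ∫ g, (max (f (ra (w n) g)) M - f (ra (w n) g)) ∂μ) atTop (nhds 0) := by
    have := hmax.sub hfI
    simp only [integral_const, probReal_univ, one_smul, sub_self] at this
    refine this.congr fun n => ?_
    rw [integral_sub _ (hIntg n)]
    exact (hIntg n).sup (integrable_const M)
  rw [Metric.tendsto_atTop']
  intro ε hε
  obtain ⟨η, hη, hE⟩ := hEQ (ε / 4) (by positivity)
  obtain ⟨U, hU, hgU, hUd⟩ := ra_diff g0 hη
  have hμU : 0 < μ.real U := by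
    rw [measureReal_def, ENNReal.toReal_pos_iff]
    exact ⟨hg0 U hU hgU, measure_lt_top _ _⟩
  have hev := (hd.eventually_lt_const (show (0:ℝ) < ε / 4 * μ.real U by positivity)).and
    (mx_up hM (hra0 g0) (ra_seq_zero hwz g0) (half_pos hε))
  obtain ⟨N, hN⟩ := eventually_atTop.1 hev
  refine ⟨N, fun n hn => ?_⟩
  obtain ⟨h1, h2⟩ := hN n hn.le
  rw [Real.dist_eq, abs_lt]
  refine ⟨?_, by linarith⟩
  by_contra hcon
  push Not at hcon
  have hdi : Integrable (fun g => max (f (ra (w n) g)) M - f (ra (w n) g)) μ :=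
    ((hIntg n).sup (integrable_const M)).sub (hIntg n)
  have h3 : ε / 4 * μ.real U ≤ ∫ g, (max (f (ra (w n) g)) M - f (ra (w n) g)) ∂μ := by
    calc ε / 4 * μ.real U = ∫ g in U, ε / 4 ∂μ := by simp [mul_comm]
      _ ≤ ∫ g in U, (max (f (ra (w n) g)) M - f (ra (w n) g)) ∂μ := by
          apply setIntegral_mono_on (integrableOn_const (by simp)) hdi.integrableOn hU.measurableSet
          intro g hg
          have h4 := hE (ra (w n) g0) (ra (w n) g) (hra0 g0 n) (hUd g hg (w n))
          have h5 := (abs_le.1 h4).2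
          have h6 := le_max_right (f (ra (w n) g)) M
          linarith
      _ ≤ _ := by
          apply setIntegral_le_integral hdi
          refine Eventually.of_forall fun g => ?_
          simp
  linarith

lemma mx_S {w : ℕ → ℝ × ℝ} (hw : Mx f M w) {g0 : SL2} (hg0 : g0 ∈ Submonoid.closure (measSupp μ)) :
    Mx f M (fun n => ra (w n) g0) := by
  induction hg0 using Submonoid.closure_induction generalizing w with
  | mem g hg => exact mx_step μ hf0 hf1 hfm hEQ hharm hq hM hw hg
  | one => simpa only [ra_one] using hw
  | mul x y hx hy ihx ihy => simpa only [ra_mul] using ihy (ihx hw)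
end

lemma mx_exists {f : ℝ × ℝ → ℝ} (hf0 : ∀ u, u ≠ 0 → 0 ≤ f u) (hf1 : ∀ u, f u ≤ 1) :
    ∃ M : ℝ, (∀ ε > (0:ℝ), ∃ r > (0:ℝ), ∀ u : ℝ × ℝ, u ≠ 0 → ‖u‖ < r → f u ≤ M + ε) ∧ ∃ w, Mx f M w := by
  set X : Set ℝ := {m | ∃ r > (0:ℝ), ∀ u : ℝ × ℝ, u ≠ 0 → ‖u‖ < r → f u ≤ m} with hX
  have hne : X.Nonempty := ⟨1, 1, one_pos, fun u _ _ => hf1 u⟩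
  have hbd : BddBelow X := by
    refine ⟨0, ?_⟩
    rintro m ⟨r, hr, h⟩
    have hn : ‖((r / 2, 0) : ℝ × ℝ)‖ = r / 2 := by
      rw [Prod.norm_def]; simp [abs_of_pos hr, hr.le]; positivity
    have hne : ((r / 2, 0) : ℝ × ℝ) ≠ 0 := by
      rw [← norm_pos_iff, hn]; positivity
    exact (hf0 _ hne).trans (h _ hne (by rw [hn]; linarith))
  have hM : ∀ ε > (0:ℝ), ∃ r > (0:ℝ), ∀ u : ℝ × ℝ, u ≠ 0 → ‖u‖ < r → f u ≤ sInf X + ε := by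
    intro ε hε
    obtain ⟨m, ⟨r, hr, h⟩, hm⟩ := exists_lt_of_csInf_lt hne (show sInf X < sInf X + ε by linarith)
    exact ⟨r, hr, fun u hu hur => (h u hu hur).trans hm.le⟩
  refine ⟨sInf X, hM, ?_⟩
  have hex : ∀ n : ℕ, ∃ u : ℝ × ℝ, u ≠ 0 ∧ ‖u‖ < 1 / ((n:ℝ) + 1) ∧ sInf X - 1 / ((n:ℝ) + 1) < f u := by
    intro n
    by_contra hcon
    push Not at hcon
    have : sInf X - 1 / ((n:ℝ) + 1) ∈ X := ⟨1 / ((n:ℝ) + 1), by positivity, hcon⟩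
    have h1 := csInf_le hbd this
    have h2 : (0:ℝ) < 1 / ((n:ℝ) + 1) := by positivity
    linarith
  choose w hw0 hwn hwf using hex
  have hwz : Tendsto w atTop (nhds 0) :=
    squeeze_zero_norm (fun n => (hwn n).le) tendsto_one_div_add_atTop_nhds_zero_nat
  refine ⟨w, hw0, hwz, ?_⟩
  have h1 := (tendsto_one_div_add_atTop_nhds_zero_nat (𝕜 := ℝ))
  rw [Metric.tendsto_atTop']
  intro ε hε
  obtain ⟨N, hN⟩ := eventually_atTop.1 ((h1.eventually_lt_const hε).and (mx_up hM hw0 hwz (half_pos hε)))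
  refine ⟨N, fun n hn => ?_⟩
  obtain ⟨a, b⟩ := hN n hn.le
  have := hwf n
  rw [Real.dist_eq, abs_lt]
  constructor <;> linarith


lemma neg_mem_of_closed (B : AddSubmonoid ℝ) (hB : IsClosed (B : Set ℝ)) {L : ℝ} (hL : 0 < L) (h1 : L ∈ B) (h2 : -L ∈ B)
    {x : ℝ} (hx : x ∈ B) : -x ∈ B := by
  have hz : ∀ k : ℤ, (k:ℝ) * L ∈ B := by
    intro k
    obtain ⟨n, rfl | rfl⟩ := k.eq_nat_or_neg
    · have := B.nsmul_mem h1 n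
      simpa using this
    · have := B.nsmul_mem h2 n
      simpa using this
  have : -x ∈ closure (B : Set ℝ) := by
    rw [Metric.mem_closure_iff]
    intro ε hε
    obtain ⟨n, hn⟩ := exists_nat_gt (L / ε)
    have hn0 : 0 < n := by
      have : (0:ℝ) < n := lt_trans (by positivity) hn
      exact_mod_cast this
    obtain ⟨j, k, hk0, hkn, hjk⟩ := Real.exists_int_int_abs_mul_sub_le (x / L) hn0
    refine ⟨((k - 1).toNat : ℝ) * x + ((-j : ℤ) : ℝ) * L, B.add_mem ?_ (hz _), ?_⟩
    · have := B.nsmul_mem hx (k - 1).toNat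
      simpa using this
    · have e : (((k - 1).toNat : ℤ) : ℝ) = ((k - 1 : ℤ) : ℝ) := by rw [Int.toNat_of_nonneg (by omega)]
      have e' : ((k - 1).toNat : ℝ) = (k:ℝ) - 1 := by push_cast at e; exact_mod_cast e
      rw [e', dist_comm, Real.dist_eq]
      have e2 : ((k:ℝ) - 1) * x + ((-j : ℤ) : ℝ) * L - -x = ((k:ℝ) * (x / L) - j) * L := by
        push_cast; field_simp; ring
      rw [e2, abs_mul, abs_of_pos hL]
      have hn' : (0:ℝ) < n := by exact_mod_cast hn0
      calc _ ≤ 1 / ((n:ℝ) + 1) * L := by gcongr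
        _ < ε := by
          rw [div_lt_iff₀ hε] at hn
          rw [div_mul_eq_mul_div, div_lt_iff₀ (by positivity)]
          nlinarith
  rwa [hB.closure_eq] at this

lemma closed_monoid_univ (B : AddSubmonoid ℝ) (hB : IsClosed (B : Set ℝ)) {L : ℝ} (hL : 0 < L) (h1 : L ∈ B) (h2 : -L ∈ B)
    {b : ℕ → ℝ} {b0 : ℝ} (hb : ∀ n, b n ∈ B) (hlim : Tendsto b atTop (nhds b0)) (hne : ∀ᶠ n in atTop, b n ≠ b0) (x : ℝ) :
    x ∈ B := by
  let G : AddSubgroup ℝ := { B with neg_mem' := fun hx => neg_mem_of_closed B hB hL h1 h2 hx }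
  have hGB : ∀ y, y ∈ G ↔ y ∈ B := fun y => Iff.rfl
  have hb0 : b0 ∈ G := hB.mem_of_tendsto hlim (Eventually.of_forall hb)
  have hd : Dense (G : Set ℝ) := by
    apply AddSubgroup.dense_of_not_isolated_zero
    intro ε hε
    obtain ⟨n, hn1, hn2⟩ := (hne.and (Metric.tendsto_nhds.1 hlim ε hε)).exists
    have hmem : b n - b0 ∈ G := G.sub_mem (hb n) hb0
    rw [Real.dist_eq] at hn2
    refine ⟨|b n - b0|, ?_, abs_pos.2 (sub_ne_zero.2 hn1), hn2⟩
    rcases abs_choice (b n - b0) with h | h <;> rw [h]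
    · exact hmem
    · exact G.neg_mem hmem
  have : x ∈ closure (G : Set ℝ) := hd x
  have hc : closure (G : Set ℝ) = G := hB.closure_eq
  rw [hc] at this
  exact this

lemma mx_pert {f : ℝ × ℝ → ℝ} {M : ℝ} (hEQ : EQf f) {w w' : ℕ → ℝ × ℝ} (hw0 : ∀ᶠ n in atTop, w n ≠ 0)
    (hw : Tendsto (fun n => f (w n)) atTop (nhds M))
    (h : ∀ η > (0:ℝ), ∀ᶠ n in atTop, ‖w' n - w n‖ ≤ η * ‖w n‖) :
    Tendsto (fun n => f (w' n)) atTop (nhds M) := by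
  have : Tendsto (fun n => f (w' n) - f (w n)) atTop (nhds 0) := by
    rw [Metric.tendsto_nhds]
    intro ε hε
    obtain ⟨η, hη, hE⟩ := hEQ (ε / 2) (by positivity)
    filter_upwards [hw0, h η hη] with n h0 h1
    have := hE _ _ h0 h1
    rw [Real.dist_eq, sub_zero]
    linarith
  have h2 := this.add hw
  simpa using h2


lemma ra_pow {a : SL2} {l : ℝ} (hl : 1 < l) (a00 : a.1 0 0 = l) (a01 : a.1 0 1 = 0) (a10 : a.1 1 0 = 0)
    (a11 : a.1 1 1 = l⁻¹) (u : ℝ × ℝ) (m : ℕ) : ra u (a ^ m) = (l ^ m * u.1, (l ^ m)⁻¹ * u.2) := by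
  have hl0 : l ≠ 0 := by positivity
  induction m with
  | zero => simp [ra_one]
  | succ m ih =>
    rw [pow_succ, ra_mul, ih]
    unfold ra
    rw [a00, a01, a10, a11]
    ext
    · simp only; rw [pow_succ]; ring
    · simp only; rw [pow_succ, mul_inv]; ring

lemma norm_fst_only (x : ℝ) : ‖((x, 0) : ℝ × ℝ)‖ = |x| := by
  rw [Prod.norm_def]; simp

lemma norm_snd_only (x : ℝ) : ‖((0, x) : ℝ × ℝ)‖ = |x| := by
  rw [Prod.norm_def]; simp

section
variable {f : ℝ × ℝ → ℝ} {M : ℝ} (hEQ : EQf f) (hneg : ∀ u, f (-u) = f u) (P : Submonoid SL2)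
  (hP : ∀ g ∈ P, ∀ w, Mx f M w → Mx f M (fun n => ra (w n) g))
  {a s : SL2} {l : ℝ} (hl : 1 < l) (haP : a ∈ P) (a00 : a.1 0 0 = l) (a01 : a.1 0 1 = 0) (a10 : a.1 1 0 = 0)
  (a11 : a.1 1 1 = l⁻¹) (hsP : s ∈ P) (s00 : s.1 0 0 ≠ 0) (s01 : s.1 0 1 ≠ 0) (s10 : s.1 1 0 ≠ 0)
include hEQ hneg hP hl haP a00 a01 a10 a11 hsP s00 s01 s10

omit hl haP a00 a01 a10 a11 s00 s01 in
lemma core1 {w : ℕ → ℝ × ℝ} (hw : Mx f M w) : ∃ (d : ℝ × ℝ) (r : ℕ → ℝ), 0 < d.1 ∧ (∀ n, 0 < r n) ∧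
    Tendsto r atTop (nhds 0) ∧ Mx f M (fun n => r n • d) := by
  obtain ⟨hw0, hwz, hwM⟩ := hw
  have hnp : ∀ n, 0 < ‖w n‖ := fun n => norm_pos_iff.2 (hw0 n)
  have hsph : ∀ n, ‖w n‖⁻¹ • w n ∈ Metric.sphere (0:ℝ × ℝ) 1 := by
    intro n
    rw [mem_sphere_zero_iff_norm, norm_smul, norm_inv, norm_norm, inv_mul_cancel₀ (hnp n).ne']
  obtain ⟨d, hd, φ, hφ, hlim⟩ := (isCompact_sphere (0:ℝ × ℝ) 1).tendsto_subseq hsph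
  have hd0 : d ≠ 0 := by
    intro h; rw [h, mem_sphere_zero_iff_norm, norm_zero] at hd; exact zero_ne_one hd
  have hrz : Tendsto (fun n => ‖w (φ n)‖) atTop (nhds 0) := by
    have := (hwz.comp hφ.tendsto_atTop).norm
    simpa using this
  have base : Mx f M (fun n => ‖w (φ n)‖ • d) := by
    refine ⟨fun n => smul_ne_zero (hnp _).ne' hd0, ?_, ?_⟩
    · have := hrz.smul_const d
      simpa using this
    · apply mx_pert hEQ (w := fun n => w (φ n)) (Eventually.of_forall fun n => hw0 _) (hwM.comp hφ.tendsto_atTop)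
      intro η hη
      filter_upwards [Metric.tendsto_nhds.1 hlim η hη] with n hn
      simp only [Function.comp_apply] at hn
      have e : w (φ n) = ‖w (φ n)‖ • (‖w (φ n)‖⁻¹ • w (φ n)) := by
        rw [smul_smul, mul_inv_cancel₀ (hnp _).ne', one_smul]
      have e2 : ‖w (φ n)‖ • d - w (φ n) = ‖w (φ n)‖ • (d - ‖w (φ n)‖⁻¹ • w (φ n)) := by
        rw [smul_sub, ← e]
      rw [e2, norm_smul, norm_norm, mul_comm]
      gcongr
      rw [← dist_eq_norm, dist_comm]; exact hn.le
  have base2 : ∃ d : ℝ × ℝ, d.1 ≠ 0 ∧ Mx f M (fun n => ‖w (φ n)‖ • d) := by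
    by_cases h1 : d.1 = 0
    · refine ⟨ra d s, ?_, ?_⟩
      · have h2 : d.2 ≠ 0 := fun h => hd0 (Prod.ext h1 h)
        simp only [ra, h1, zero_mul, zero_add]
        exact mul_ne_zero h2 s10
      · simpa only [ra_smul] using hP s hsP _ base
    · exact ⟨d, h1, base⟩
  obtain ⟨d, hd1, hMx⟩ := base2
  rcases lt_or_gt_of_ne hd1 with h | h
  · refine ⟨-d, fun n => ‖w (φ n)‖, by simpa using h, fun n => hnp _, hrz, ?_⟩
    obtain ⟨x, y, z⟩ := hMx
    refine ⟨fun n => ?_, ?_, ?_⟩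
    · show ‖w (φ n)‖ • -d ≠ 0
      rw [smul_neg]; exact neg_ne_zero.2 (x n)
    · have := y.neg; simpa using this
    · simp_rw [smul_neg, hneg]; exact z
  · exact ⟨d, fun n => ‖w (φ n)‖, h, fun n => hnp _, hrz, hMx⟩

lemma core2 {w : ℕ → ℝ × ℝ} (hw : Mx f M w) : ∃ t : ℕ → ℝ, (∀ n, 0 < t n) ∧ Tendsto t atTop (nhds 0) ∧
    ∀ j : ℤ, Tendsto (fun k => f (Real.exp (j * Real.log l) * t k, 0)) atTop (nhds M) := by
  obtain ⟨d, r, hd, hr, hrz, hMx⟩ := core1 hEQ hneg P hP hsP s10 hw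
  have hl0 : 0 < l := by linarith
  have hm : ∀ m : ℕ, Tendsto (fun n => f (ra (r n • d) (a ^ m))) atTop (nhds M) := fun m =>
    (hP _ (P.pow_mem haP m) _ hMx).2.2
  have hex : ∀ k : ℕ, ∃ n, (∀ m ∈ Finset.range (2 * k + 1), |f (ra (r n • d) (a ^ m)) - M| < 1 / ((k:ℝ) + 1)) ∧
      r n * (l ^ k * d.1) < 1 / ((k:ℝ) + 1) := by
    intro k
    have hpos : (0:ℝ) < 1 / ((k:ℝ) + 1) := by positivity
    have h1 : ∀ᶠ n in atTop, ∀ m ∈ Finset.range (2 * k + 1), |f (ra (r n • d) (a ^ m)) - M| < 1 / ((k:ℝ) + 1) := by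
      rw [Finset.eventually_all]
      intro m _
      have := Metric.tendsto_nhds.1 (hm m) _ hpos
      simpa only [Real.dist_eq] using this
    have h2 : ∀ᶠ n in atTop, r n * (l ^ k * d.1) < 1 / ((k:ℝ) + 1) := by
      have := hrz.mul_const (l ^ k * d.1)
      rw [zero_mul] at this
      exact this.eventually_lt_const hpos
    exact (h1.and h2).exists
  choose n hn1 hn2 using hex
  have h1k := (tendsto_one_div_add_atTop_nhds_zero_nat (𝕜 := ℝ))
  refine ⟨fun k => r (n k) * (l ^ k * d.1), fun k => by have := hr (n k); positivity, ?_, fun j => ?_⟩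
  · apply squeeze_zero (fun k => by have := hr (n k); positivity) (fun k => (hn2 k).le) h1k
  · set m : ℕ → ℕ := fun k => ((k:ℤ) + j).toNat with hmdef
    have hmt : Tendsto m atTop atTop := by
      rw [tendsto_atTop]
      intro b
      filter_upwards [eventually_ge_atTop (b + j.natAbs)] with k hk
      simp only [hmdef]; omega
    apply mx_pert hEQ (w := fun k => ra (r (n k) • d) (a ^ m k))
    · refine Eventually.of_forall fun k => ra_ne (smul_ne_zero (hr _).ne' ?_) _
      rintro rfl; simp at hd
    · rw [tendsto_iff_dist_tendsto_zero]
      apply squeeze_zero' (Eventually.of_forall fun k => dist_nonneg) _ h1k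
      filter_upwards [eventually_ge_atTop j.natAbs] with k hk
      rw [Real.dist_eq]
      apply (hn1 k _ _).le
      rw [Finset.mem_range]; simp only [hmdef]; omega
    · intro η hη
      have hpow : Tendsto (fun k => (l ^ m k)⁻¹ * |d.2|) atTop (nhds 0) := by
        have := (((tendsto_pow_atTop_atTop_of_one_lt hl).comp hmt).inv_tendsto_atTop).mul_const |d.2|
        simpa using this
      filter_upwards [hpow.eventually_le_const (show 0 < η * d.1 by positivity), eventually_ge_atTop j.natAbs] with k hk hkj
      rw [ra_pow hl a00 a01 a10 a11]
      have hrk := hr (n k)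
      have e : Real.exp (j * Real.log l) * l ^ k = l ^ m k := by
        have hmk : (m k : ℝ) = k + j := by
          have : (m k : ℤ) = k + j := by simp only [hmdef]; omega
          exact_mod_cast this
        rw [← Real.rpow_natCast, ← Real.rpow_natCast, Real.rpow_def_of_pos hl0, Real.rpow_def_of_pos hl0, ← Real.exp_add, hmk]
        congr 1; ring
      have e2 : ((Real.exp (j * Real.log l) * (r (n k) * (l ^ k * d.1)), 0) : ℝ × ℝ) -
          (l ^ m k * (r (n k) • d).1, (l ^ m k)⁻¹ * (r (n k) • d).2) = (0, -(r (n k) * ((l ^ m k)⁻¹ * d.2))) := by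
        ext
        · simp only [Prod.fst_sub, Prod.smul_fst, smul_eq_mul, ← e]; ring
        · simp only [Prod.snd_sub, Prod.smul_snd, smul_eq_mul]; ring
      rw [e2, norm_snd_only, abs_neg, abs_mul, abs_of_pos hrk, abs_mul, abs_of_pos (by positivity : 0 < (l ^ m k)⁻¹)]
      have hge : r (n k) * d.1 ≤ ‖((l ^ m k * (r (n k) • d).1, (l ^ m k)⁻¹ * (r (n k) • d).2) : ℝ × ℝ)‖ := by
        refine le_trans ?_ (norm_fst_le _)
        simp only [Prod.smul_fst, smul_eq_mul, Real.norm_eq_abs]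
        rw [abs_of_pos (by positivity)]
        have : 1 ≤ l ^ m k := one_le_pow₀ hl.le
        have h3 : 0 < r (n k) * d.1 := by positivity
        nlinarith
      calc _ ≤ r (n k) * (η * d.1) := by gcongr
        _ = η * (r (n k) * d.1) := by ring
        _ ≤ _ := by gcongr

omit hneg hP hl haP a00 a01 a10 a11 hsP s00 s01 s10 in
lemma A0_closed {t : ℕ → ℝ} (ht : ∀ n, 0 < t n) :
    IsClosed {x : ℝ | Tendsto (fun k => f (Real.exp x * t k, 0)) atTop (nhds M)} := by
  rw [← closure_subset_iff_isClosed]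
  intro x hx
  rw [Set.mem_setOf_eq, Metric.tendsto_nhds]
  intro ε hε
  obtain ⟨η, hη, hE⟩ := hEQ (ε / 2) (by positivity)
  have hc : Continuous fun y : ℝ => |Real.exp (x - y) - 1| := by fun_prop
  have ho : IsOpen {y : ℝ | |Real.exp (x - y) - 1| < η} := isOpen_lt hc continuous_const
  obtain ⟨y, hy1, hy2⟩ := mem_closure_iff.1 hx _ ho (by simpa using hη)
  have hy1' : |Real.exp (x - y) - 1| < η := hy1
  filter_upwards [Metric.tendsto_nhds.1 hy2 (ε / 2) (by positivity)] with k hk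
  have hpos : 0 < Real.exp y * t k := mul_pos (Real.exp_pos _) (ht k)
  have := hE (Real.exp y * t k, 0) (Real.exp x * t k, 0) (by
    rw [← norm_pos_iff, norm_fst_only, abs_of_pos hpos]; exact hpos) (by
    have e : ((Real.exp x * t k, 0) : ℝ × ℝ) - (Real.exp y * t k, 0) = ((Real.exp (x - y) - 1) * (Real.exp y * t k), 0) := by
      ext
      · simp only [Prod.fst_sub]
        have : Real.exp x = Real.exp (x - y) * Real.exp y := by rw [← Real.exp_add]; congr 1; ring
        rw [this]; ring
      · simp
    rw [e, norm_fst_only, norm_fst_only, abs_mul]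
    gcongr)
  rw [Real.dist_eq] at hk ⊢
  rw [abs_lt] at hk ⊢
  rw [abs_le] at this
  constructor <;> linarith [hk.1, hk.2, this.1, this.2]

omit hsP s00 s01 s10 in
lemma A_inv {t : ℕ → ℝ} (ht : ∀ n, 0 < t n) (htz : Tendsto t atTop (nhds 0)) {g : SL2} (hg : g ∈ P) (g00 : g.1 0 0 ≠ 0)
    {x : ℝ} (hx : ∀ j : ℤ, Tendsto (fun k => f (Real.exp (x + j * Real.log l) * t k, 0)) atTop (nhds M)) (j : ℤ) :
    Tendsto (fun k => f (Real.exp (x + Real.log |g.1 0 0| + j * Real.log l) * t k, 0)) atTop (nhds M) := by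
  have hl0 : 0 < l := by linarith
  set c := g.1 0 0 with hc
  have hc0 : 0 < |c| := abs_pos.2 g00
  rw [Metric.tendsto_nhds]
  intro ε hε
  obtain ⟨η, hη, hE⟩ := hEQ (ε / 2) (by positivity)
  have hpow : Tendsto (fun m : ℕ => (l ^ m)⁻¹ * |g.1 0 1|) atTop (nhds 0) := by
    have := ((tendsto_pow_atTop_atTop_of_one_lt hl).inv_tendsto_atTop).mul_const |g.1 0 1|
    simpa using this
  obtain ⟨m, hm⟩ := (hpow.eventually_le_const (show 0 < η * |c| by positivity)).exists
  set y := x + ((j - m : ℤ) : ℝ) * Real.log l with hy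
  have hMx : Mx f M (fun k => ((Real.exp y * t k, 0) : ℝ × ℝ)) := by
    refine ⟨fun k => ?_, ?_, hx (j - m)⟩
    · have hpos : 0 < Real.exp y * t k := mul_pos (Real.exp_pos _) (ht k)
      rw [← norm_pos_iff, norm_fst_only, abs_of_pos hpos]; exact hpos
    · have h1 : Tendsto (fun k => Real.exp y * t k) atTop (nhds 0) := by simpa using htz.const_mul (Real.exp y)
      exact h1.prodMk_nhds tendsto_const_nhds
  have h2 := hP _ (P.mul_mem hg (P.pow_mem haP m)) _ hMx
  filter_upwards [Metric.tendsto_nhds.1 h2.2.2 (ε / 2) (by positivity)] with k hk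
  have hpos : 0 < Real.exp y * t k := mul_pos (Real.exp_pos _) (ht k)
  have hra : ra (Real.exp y * t k, 0) (g * a ^ m) = (l ^ m * (Real.exp y * t k * c), (l ^ m)⁻¹ * (Real.exp y * t k * g.1 0 1)) := by
    rw [ra_mul, ra_pow hl a00 a01 a10 a11]
    simp [ra, hc]
  rw [hra] at hk
  have hne : ra (Real.exp y * t k, 0) (g * a ^ m) ≠ 0 := h2.1 k
  rw [hra] at hne
  have e1 : Real.exp (x + Real.log |c| + j * Real.log l) * t k = |l ^ m * (Real.exp y * t k * c)| := by
    rw [abs_mul, abs_mul, abs_of_pos hpos, abs_of_pos (by positivity : 0 < l ^ m)]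
    have : Real.exp (x + Real.log |c| + j * Real.log l) = l ^ m * Real.exp y * |c| := by
      rw [← Real.rpow_natCast, Real.rpow_def_of_pos hl0, ← Real.exp_log hc0, ← Real.exp_add, ← Real.exp_add, Real.log_exp, hy]
      congr 1; push_cast; ring
    rw [this]; ring
  have e2 : f (|l ^ m * (Real.exp y * t k * c)|, 0) = f (l ^ m * (Real.exp y * t k * c), 0) := by
    rcases abs_choice (l ^ m * (Real.exp y * t k * c)) with h | h <;> rw [h]
    rw [← hneg]; simp
  rw [e1, e2]
  have := hE _ (l ^ m * (Real.exp y * t k * c), 0) hne (by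
    have e : ((l ^ m * (Real.exp y * t k * c), 0) : ℝ × ℝ) - (l ^ m * (Real.exp y * t k * c), (l ^ m)⁻¹ * (Real.exp y * t k * g.1 0 1))
        = (0, -((Real.exp y * t k) * ((l ^ m)⁻¹ * g.1 0 1))) := by
      ext
      · simp
      · simp only [Prod.snd_sub]; ring
    rw [e, norm_snd_only, abs_neg, abs_mul, abs_of_pos hpos, abs_mul, abs_of_pos (by positivity : 0 < (l ^ m)⁻¹)]
    have hge : (Real.exp y * t k) * |c| ≤ ‖((l ^ m * (Real.exp y * t k * c), (l ^ m)⁻¹ * (Real.exp y * t k * g.1 0 1)) : ℝ × ℝ)‖ := by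
      refine le_trans ?_ (norm_fst_le _)
      simp only [Real.norm_eq_abs]
      rw [abs_mul, abs_mul, abs_of_pos hpos, abs_of_pos (by positivity : 0 < l ^ m)]
      have : 1 ≤ l ^ m := one_le_pow₀ hl.le
      have h3 : 0 < Real.exp y * t k * |c| := by positivity
      nlinarith
    calc _ ≤ Real.exp y * t k * (η * |c|) := by gcongr
      _ = η * (Real.exp y * t k * |c|) := by ring
      _ ≤ _ := by gcongr)
  rw [Real.dist_eq] at hk ⊢
  rw [abs_lt] at hk ⊢
  rw [abs_le] at this
  constructor <;> linarith [hk.1, hk.2, this.1, this.2]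

lemma core3 {w : ℕ → ℝ × ℝ} (hw : Mx f M w) : ∃ t : ℕ → ℝ, (∀ n, 0 < t n) ∧ Tendsto t atTop (nhds 0) ∧
    ∀ x : ℝ, Tendsto (fun k => f (Real.exp x * t k, 0)) atTop (nhds M) := by
  obtain ⟨t, ht, htz, hj⟩ := core2 hEQ hneg P hP hl haP a00 a01 a10 a11 hsP s00 s01 s10 hw
  refine ⟨t, ht, htz, ?_⟩
  have hl0 : 0 < l := by linarith
  set L := Real.log l with hLd
  have hL : 0 < L := Real.log_pos hl
  set A : Set ℝ := {x | ∀ j : ℤ, Tendsto (fun k => f (Real.exp (x + j * L) * t k, 0)) atTop (nhds M)} with hA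
  have hAc : IsClosed A := by
    have : A = ⋂ j : ℤ, (fun x : ℝ => x + j * L) ⁻¹' {x : ℝ | Tendsto (fun k => f (Real.exp x * t k, 0)) atTop (nhds M)} := by
      ext x; simp [hA]
    rw [this]
    exact isClosed_iInter fun j => (A0_closed hEQ ht).preimage (by fun_prop)
  have h0A : (0:ℝ) ∈ A := fun j => by simpa using hj j
  let B : AddSubmonoid ℝ :=
    { carrier := {y | ∀ x ∈ A, x + y ∈ A}
      zero_mem' := fun x hx => by simpa using hx
      add_mem' := fun {y z} hy hz x hx => by rw [← add_assoc]; exact hz _ (hy x hx) }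
  have hBc : IsClosed (B : Set ℝ) := by
    have : (B : Set ℝ) = ⋂ x ∈ A, (fun y : ℝ => x + y) ⁻¹' A := by
      ext y; simp only [Set.mem_iInter, Set.mem_preimage]; rfl
    rw [this]
    exact isClosed_biInter fun x _ => hAc.preimage (by fun_prop)
  have hLz : ∀ i : ℤ, (i:ℝ) * L ∈ B := by
    intro i x hx j
    have := hx (i + j)
    have e : x + i * L + j * L = x + ((i + j : ℤ):ℝ) * L := by push_cast; ring
    rw [e]; exact this
  have hL1 : L ∈ B := by simpa using hLz 1
  have hL2 : -L ∈ B := by simpa using hLz (-1)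
  have hlog : ∀ g ∈ P, g.1 0 0 ≠ 0 → Real.log |g.1 0 0| ∈ B := fun g hg g00 x hx j =>
    A_inv hEQ hneg P hP hl haP a00 a01 a10 a11 ht htz hg g00 hx j
  set S2 := s.1 0 0 ^ 2 with hS2
  have hS2p : 0 < S2 := by positivity
  set z : ℕ → ℝ := fun n => s.1 0 1 * s.1 1 0 * ((l ^ n)⁻¹) ^ 2 with hz
  have hzne : ∀ n, z n ≠ 0 := fun n => by
    have : (l ^ n)⁻¹ ≠ 0 := by positivity
    exact mul_ne_zero (mul_ne_zero s01 s10) (pow_ne_zero _ this)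
  have hzz : Tendsto z atTop (nhds 0) := by
    have := (((tendsto_pow_atTop_atTop_of_one_lt hl).inv_tendsto_atTop).pow 2).const_mul (s.1 0 1 * s.1 1 0)
    simpa [hz] using this
  have hzs : Tendsto (fun n => S2 + z n) atTop (nhds S2) := by simpa using hzz.const_add S2
  obtain ⟨N, hN⟩ := eventually_atTop.1 (hzs.eventually_const_lt hS2p)
  have hBall : ∀ y : ℝ, y ∈ B := by
    apply closed_monoid_univ B hBc hL hL1 hL2 (b := fun n => Real.log (S2 + z (n + N))) (b0 := Real.log S2)
    · intro n
      have hp := hN (n + N) (by omega)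
      have e00 : (s * a ^ (n + N) * s).1 0 0 = l ^ (n + N) * (S2 + z (n + N)) := by
        have h := ra_mul (1, 0) s (a ^ (n + N) * s)
        rw [ra_mul _ (a ^ (n + N)) s, ra_pow hl a00 a01 a10 a11, ← mul_assoc] at h
        have h' := congrArg Prod.fst h
        simp only [ra, one_mul, zero_mul, add_zero] at h'
        rw [h', hS2, hz]
        have : l ^ (n + N) ≠ 0 := by positivity
        simp only
        field_simp
      have h1 := hlog _ (P.mul_mem (P.mul_mem hsP (P.pow_mem haP (n + N))) hsP) (by rw [e00]; positivity)
      rw [e00, abs_of_pos (by positivity), Real.log_mul (by positivity) hp.ne', Real.log_pow] at h1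
      have h2 := B.add_mem h1 (hLz (-((n + N : ℕ) : ℤ)))
      have e : ((n + N : ℕ) : ℝ) * Real.log l + Real.log (S2 + z (n + N)) + ((-((n + N : ℕ) : ℤ) : ℤ) : ℝ) * L = Real.log (S2 + z (n + N)) := by
        push_cast; ring
      rwa [e] at h2
    · exact ((Real.continuousAt_log hS2p.ne').tendsto.comp hzs).comp (tendsto_add_atTop_nat N)
    · refine Eventually.of_forall fun n h => ?_
      have hp := hN (n + N) (by omega)
      have := Real.log_injOn_pos hp hS2p h
      exact hzne (n + N) (by linarith)
  intro x
  have := hBall x 0 h0A 0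
  simpa using this
end


lemma closure_closure_S (A : Set SL2) :
    Subgroup.closure ((Submonoid.closure A : Submonoid SL2) : Set SL2) = Subgroup.closure A := by
  apply le_antisymm
  · rw [Subgroup.closure_le]
    have : Submonoid.closure A ≤ (Subgroup.closure A).toSubmonoid :=
      Submonoid.closure_le.2 Subgroup.subset_closure
    exact this
  · exact Subgroup.closure_mono Submonoid.subset_closure

lemma mx_conj {f : ℝ × ℝ → ℝ} {M : ℝ} {w : ℕ → ℝ × ℝ} (T : SL2) :
    Mx (fun u => f (ra u T)) M w ↔ Mx f M (fun n => ra (w n) T) := by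
  constructor
  · rintro ⟨h1, h2, h3⟩
    exact ⟨fun n => ra_ne (h1 n) T, ra_seq_zero h2 T, h3⟩
  · rintro ⟨h1, h2, h3⟩
    refine ⟨fun n h => h1 n ?_, ?_, h3⟩
    · show ra (w n) T = 0
      rw [h, ra_zero]
    · have := ra_seq_zero h2 T⁻¹
      simpa only [ra_inv] using this

lemma EQf_conj {f : ℝ × ℝ → ℝ} (hEQ : EQf f) (T : SL2) : EQf (fun u => f (ra u T)) := by
  intro ε hε
  obtain ⟨η, hη, h⟩ := hEQ ε hε
  have hn := nm_pos T
  refine ⟨η / nm T ^ 2, by positivity, fun u u' hu h' => h _ _ (ra_ne hu T) ?_⟩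
  rw [← ra_sub]
  calc _ ≤ nm T * ‖u' - u‖ := ra_norm_le _ _
    _ ≤ nm T * (η / nm T ^ 2 * ‖u‖) := by gcongr
    _ ≤ nm T * (η / nm T ^ 2 * (nm T * ‖ra u T‖)) := by gcongr; exact ra_norm_ge _ _
    _ = _ := by field_simp

section
variable (μ : Measure SL2) [IsProbabilityMeasure μ] (τ : Measure ℝ) [IsProbabilityMeasure τ]
  [NullSingletonClass τ]
variable (hst : (μ.prod τ).map (fun p => mob p.1 p.2) = τ)
variable {α : ℝ} (hα : 0 < α)
include hst hα

lemma hh_tendsto (hzd : ¬ IsSolvable (Subgroup.closure (measSupp μ)))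
    (hmo : ∫⁻ g, ENNReal.ofReal (mm α g ^ 2) ∂μ < ⊤) {ε : ℝ} (hε : 0 < ε) :
    ∃ r > (0:ℝ), ∀ u : ℝ × ℝ, u ≠ 0 → ‖u‖ < r → hh τ u ≤ 2 * ε := by
  obtain ⟨ρ, hρ, r, hr, havg⟩ := ff_avg μ τ hst hα hzd hmo hε
  set f := ff μ τ α ρ with hf
  have hf0 : ∀ u, u ≠ 0 → 0 ≤ f u := fun u hu => ff_nonneg μ τ hst hα hρ hu
  have hf1 : ∀ u, f u ≤ 1 := fun u => ff_le_one μ τ hst hα hρ u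
  have hfm : Measurable f := ff_meas μ τ α ρ
  have hEQ : EQf f := fun ε hε => ff_EQ μ τ hst hα hρ hzd hε
  have hharm : ∀ u, u ≠ 0 → ∫ g, f (ra u g) ∂μ = f u + qq μ τ α ρ u := fun u hu => ff_harm μ τ hst hα hρ hu
  have hneg : ∀ u, f (-u) = f u := fun u => ff_neg μ τ α ρ u
  have hq : Tendsto (qq μ τ α ρ) (nhdsWithin 0 {0}ᶜ) (nhds 0) := by
    rw [Metric.tendsto_nhdsWithin_nhds]
    intro e he
    obtain ⟨r, hr, h⟩ := qq_small μ τ hst hα hρ (half_pos he)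
    refine ⟨r, hr, fun {v} hv hd => ?_⟩
    rw [dist_zero_right] at hd
    have h1 := h v hv hd
    have h2 := qq_nonneg μ τ hst hα hρ hv
    rw [Real.dist_eq, sub_zero, abs_of_nonneg h2]
    linarith
  obtain ⟨M, hM, w, hw⟩ := mx_exists hf0 hf1
  set S := Submonoid.closure (measSupp μ) with hS
  have hSs : ¬ IsSolvable (Subgroup.closure (S : Set SL2)) := by
    rw [hS, closure_closure_S]; exact hzd
  obtain ⟨a, haS, hatr⟩ := semi_hyp S hSs (S_unbdd μ τ hst hzd)
  obtain ⟨T, l, hl, a00, a01, a10, a11⟩ := diag_exists a hatr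
  obtain ⟨s, hsS, s00, s01, s10⟩ := generic_exists S hSs T a haS l hl a00 a01 a10 a11
  have hl2 : 1 < l ^ 2 := by rw [← sq_abs]; nlinarith
  set P : Submonoid SL2 := S.map (MulAut.conj T).toMonoidHom with hPd
  have hmem : ∀ g ∈ S, T * g * T⁻¹ ∈ P := fun g hg => ⟨g, hg, rfl⟩
  have hP : ∀ g ∈ P, ∀ w, Mx (fun u => f (ra u T)) M w → Mx (fun u => f (ra u T)) M (fun n => ra (w n) g) := by
    rintro _ ⟨g, hg, rfl⟩ w hw
    rw [mx_conj] at hw ⊢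
    have := mx_S μ hf0 hf1 hfm hEQ hharm hq hM hw hg
    have e : ∀ n, ra (ra (w n) ((MulAut.conj T).toMonoidHom g)) T = ra (ra (w n) T) g := by
      intro n
      rw [← ra_mul, ← ra_mul]
      congr 1
      show T * g * T⁻¹ * T = T * g
      group
    simpa only [e] using this
  set b := T * a * T⁻¹ with hb
  have hbP : b * b ∈ P := P.mul_mem (hmem a haS) (hmem a haS)
  have hstart : Mx (fun u => f (ra u T)) M (fun n => ra (w n) T⁻¹) := by
    rw [mx_conj]
    have e : ∀ n, ra (ra (w n) T⁻¹) T = w n := fun n => by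
      rw [← ra_mul]; simp [ra_one]
    simpa only [e] using hw
  have hl0 : l ≠ 0 := by rintro rfl; norm_num at hl2
  obtain ⟨t, ht, htz, hx⟩ := core3 (f := fun u => f (ra u T)) (EQf_conj hEQ T) (fun u => by
      show f (ra (-u) T) = f (ra u T)
      rw [ra_neg, hneg]) P hP hl2 hbP
    (by rw [sl_mul00, a00, a01]; ring) (by rw [sl_mul01, a00, a01]; ring)
    (by rw [sl_mul10, a10, a11]; ring) (by rw [sl_mul11, a01, a11]; field_simp; ring) (hmem s hsS) s00 s01 s10 hstart
  set v : ℕ → ℝ × ℝ := fun k => ra (t k, 0) T with hv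
  have hv0 : ∀ k, v k ≠ 0 := fun k => ra_ne (by
    rw [← norm_pos_iff, norm_fst_only, abs_of_pos (ht k)]; exact ht k) T
  have hvz : Tendsto v atTop (nhds 0) := by
    apply ra_seq_zero
    exact htz.prodMk_nhds tendsto_const_nhds
  have hpt : ∀ s ∈ Set.Icc (1:ℝ) 2, Tendsto (fun k => f ((√s)⁻¹ • v k)) atTop (nhds M) := by
    intro s hs
    have hsp : 0 < (√s)⁻¹ := by
      have := Real.sqrt_pos.2 (by linarith [hs.1] : 0 < s); positivity
    have := hx (Real.log (√s)⁻¹)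
    rw [Real.exp_log hsp] at this
    convert this using 2 with k
    simp only [hv]
    rw [← ra_smul]
    congr 2
    ext <;> simp
  have hdct : Tendsto (fun k => ∫⁻ s in Set.Icc (1:ℝ) 2, ENNReal.ofReal (f ((√s)⁻¹ • v k))) atTop
      (nhds (∫⁻ s in Set.Icc (1:ℝ) 2, ENNReal.ofReal M)) := by
    apply tendsto_lintegral_of_dominated_convergence (fun _ => (1 : ℝ≥0∞))
    · intro k
      have h1 : Measurable fun s : ℝ => (√s)⁻¹ • v k := by
        have : Measurable fun s : ℝ => (√s)⁻¹ := Real.continuous_sqrt.measurable.inv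
        exact this.smul_const _
      exact ENNReal.measurable_ofReal.comp (hfm.comp h1)
    · intro k
      exact Eventually.of_forall fun s => by
        rw [← ENNReal.ofReal_one]; exact ENNReal.ofReal_le_ofReal (hf1 _)
    · simp
    · rw [ae_restrict_iff' measurableSet_Icc]
      exact Eventually.of_forall fun s hs => (ENNReal.continuous_ofReal.tendsto _).comp (hpt s hs)
  have hMle : M ≤ ε := by
    have h1 : ∫⁻ s in Set.Icc (1:ℝ) 2, ENNReal.ofReal M ≤ ENNReal.ofReal ε := by
      apply le_of_tendsto hdct
      have hvn : Tendsto (fun k => ‖v k‖) atTop (nhds 0) := by simpa using hvz.norm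
      filter_upwards [hvn.eventually_lt_const hr] with k hk
      exact havg _ (hv0 k) hk
    have h2 : ∫⁻ s in Set.Icc (1:ℝ) 2, ENNReal.ofReal M = ENNReal.ofReal M := by
      rw [setLIntegral_const, Real.volume_Icc]; norm_num
    rw [h2] at h1
    exact (ENNReal.ofReal_le_ofReal_iff hε.le).1 h1
  obtain ⟨r', hr', h'⟩ := hM ε hε
  refine ⟨r', hr', fun u hu hur => ?_⟩
  have := h' u hu hur
  have := hh_le_ff μ τ hst hα hρ hu
  linarith
end


lemma vec_ne {a b : ℝ} (h : a ≠ 0 ∨ b ≠ 0) : (![a, b] : Fin 2 → ℝ) ≠ 0 := by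
  intro h0
  have h1 := congrFun h0 0
  have h2 := congrFun h0 1
  simp at h1 h2
  tauto

/-- the point of the projective line with homogeneous coordinates `[a : b]` -/
def pt (a b : ℝ) (h : a ≠ 0 ∨ b ≠ 0) : PX := Projectivization.mk ℝ ![a, b] (vec_ne h)

lemma pt_eq {a b c d : ℝ} (h : a ≠ 0 ∨ b ≠ 0) (h' : c ≠ 0 ∨ d ≠ 0) : pt a b h = pt c d h' ↔ a * d = b * c := by
  unfold pt
  rw [Projectivization.mk_eq_mk_iff']
  constructor
  · rintro ⟨t, ht⟩
    have h1 := congrFun ht 0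
    have h2 := congrFun ht 1
    simp at h1 h2
    rw [← h1, ← h2]; ring
  · intro e
    rcases h' with h' | h'
    · refine ⟨a / c, ?_⟩
      ext i; fin_cases i
      · simp; field_simp
      · simp; field_simp; linarith
    · refine ⟨b / d, ?_⟩
      ext i; fin_cases i
      · simp; field_simp; linarith
      · simp; field_simp

lemma rep_ne (x : PX) : x.rep 0 ≠ 0 ∨ x.rep 1 ≠ 0 := by
  by_contra h
  push Not at h
  apply x.rep_nonzero
  ext i; fin_cases i
  · exact h.1
  · exact h.2

lemma px_rep (x : PX) : x = pt (x.rep 0) (x.rep 1) (rep_ne x) := by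
  unfold pt
  conv_lhs => rw [← x.mk_rep]
  congr 1
  ext i; fin_cases i <;> rfl

lemma px_cases (x : PX) : ∃ a b, ∃ h : a ≠ 0 ∨ b ≠ 0, x = pt a b h := ⟨_, _, _, px_rep x⟩

lemma act_ne (g : SL2) {a b : ℝ} (h : a ≠ 0 ∨ b ≠ 0) :
    g.1 0 0 * a + g.1 0 1 * b ≠ 0 ∨ g.1 1 0 * a + g.1 1 1 * b ≠ 0 := by
  by_contra hc
  push Not at hc
  have hd := sl_det g
  have h1 : a = 0 := by
    have : a = g.1 1 1 * (g.1 0 0 * a + g.1 0 1 * b) - g.1 0 1 * (g.1 1 0 * a + g.1 1 1 * b) := by linear_combination -a * hd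
    rw [this, hc.1, hc.2]; ring
  have h2 : b = 0 := by
    have : b = g.1 0 0 * (g.1 1 0 * a + g.1 1 1 * b) - g.1 1 0 * (g.1 0 0 * a + g.1 0 1 * b) := by linear_combination -b * hd
    rw [this, hc.1, hc.2]; ring
  tauto

lemma act_pt (g : SL2) {a b : ℝ} (h : a ≠ 0 ∨ b ≠ 0) : act g (pt a b h) = pt _ _ (act_ne g h) := by
  unfold act pt
  rw [Projectivization.map_mk]
  congr 1
  ext i; fin_cases i <;> simp [Matrix.SpecialLinearGroup.toLin'_apply, Matrix.mulVec, dotProduct, Fin.sum_univ_two]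

lemma act_one (x : PX) : act 1 x = x := by
  obtain ⟨a, b, h, rfl⟩ := px_cases x
  rw [act_pt, pt_eq]; simp; ring

lemma act_mul (g h : SL2) (x : PX) : act (g * h) x = act g (act h x) := by
  obtain ⟨a, b, hab, rfl⟩ := px_cases x
  rw [act_pt, act_pt, act_pt, pt_eq]
  rw [sl_mul00, sl_mul01, sl_mul10, sl_mul11]; ring

lemma act_inv_act (g : SL2) (x : PX) : act g⁻¹ (act g x) = x := by rw [← act_mul]; simp [act_one]
lemma act_act_inv (g : SL2) (x : PX) : act g (act g⁻¹ x) = x := by rw [← act_mul]; simp [act_one]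

lemma act_inj (g : SL2) : Function.Injective (act g) := fun x y h => by
  rw [← act_inv_act g x, h, act_inv_act]

/-- affine chart -/
def phi (x : PX) : ℝ := x.rep 0 / x.rep 1

lemma phi_pt {a b : ℝ} (h : a ≠ 0 ∨ b ≠ 0) : phi (pt a b h) = a / b := by
  have h1 := (pt_eq _ _).1 (px_rep (pt a b h))
  unfold phi
  set c := (pt a b h).rep 0
  set d := (pt a b h).rep 1
  have h2 : c ≠ 0 ∨ d ≠ 0 := rep_ne (pt a b h)
  by_cases hb : b = 0
  · subst hb
    have : d = 0 := by
      rcases h with h | h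
      · simpa [h] using h1
      · exact absurd rfl h
    rw [this]; simp
  · by_cases hd : d = 0
    · rw [hd] at h1 h2
      exfalso
      simp at h2
      simp at h1
      tauto
    · rw [div_eq_div_iff hd hb]; linarith

lemma px_open (s : Set PX) : IsOpen s ↔ IsOpen {v : {v : Fin 2 → ℝ // v ≠ 0} | Projectivization.mk ℝ v.1 v.2 ∈ s} := Iff.rfl

lemma mk_pt (v : {v : Fin 2 → ℝ // v ≠ 0}) : ∃ h, Projectivization.mk ℝ v.1 v.2 = pt (v.1 0) (v.1 1) h := by
  have h : v.1 0 ≠ 0 ∨ v.1 1 ≠ 0 := by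
    by_contra hc
    push Not at hc
    apply v.2
    ext i; fin_cases i
    · exact hc.1
    · exact hc.2
  refine ⟨h, ?_⟩
  unfold pt
  congr 1
  ext i; fin_cases i <;> rfl

lemma cont_coord (i : Fin 2) : Continuous fun v : {v : Fin 2 → ℝ // v ≠ 0} => v.1 i :=
  (continuous_apply i).comp continuous_subtype_val

instance : T1Space PX := by
  constructor
  intro x
  obtain ⟨a, b, h, rfl⟩ := px_cases x
  rw [← isOpen_compl_iff, px_open]
  have : {v : {v : Fin 2 → ℝ // v ≠ 0} | Projectivization.mk ℝ v.1 v.2 ∈ ({pt a b h}ᶜ : Set PX)} =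
      {v | v.1 0 * b ≠ v.1 1 * a} := by
    ext v
    obtain ⟨hv, e⟩ := mk_pt v
    simp only [Set.mem_setOf_eq, e, Set.mem_compl_iff, Set.mem_singleton_iff, pt_eq]
  rw [this]
  exact isOpen_ne_fun ((cont_coord 0).mul continuous_const) ((cont_coord 1).mul continuous_const)

lemma meas_phi : Measurable phi := by
  apply measurable_of_isOpen
  intro V hV
  have hU : IsOpen ({pt 1 0 (by simp)}ᶜ ∩ phi ⁻¹' V : Set PX) := by
    rw [px_open]
    have : {v : {v : Fin 2 → ℝ // v ≠ 0} | Projectivization.mk ℝ v.1 v.2 ∈ ({pt 1 0 (by simp)}ᶜ ∩ phi ⁻¹' V : Set PX)} =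
        {v | v.1 1 ≠ 0} ∩ (fun v => v.1 0 / v.1 1) ⁻¹' V := by
      ext v
      obtain ⟨hv, e⟩ := mk_pt v
      simp only [Set.mem_setOf_eq, e, Set.mem_inter_iff, Set.mem_compl_iff, Set.mem_singleton_iff, pt_eq, Set.mem_preimage, phi_pt]
      simp [eq_comm]
    rw [this]
    apply ContinuousOn.isOpen_inter_preimage _ _ hV
    · exact (cont_coord 0).continuousOn.div (cont_coord 1).continuousOn fun v hv => hv
    · exact isOpen_ne_fun (cont_coord 1) continuous_const
  have e : phi ⁻¹' V = ({pt 1 0 (by simp)}ᶜ ∩ phi ⁻¹' V) ∪ ({pt 1 0 (by simp)} ∩ phi ⁻¹' V) := by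
    ext x; simp; tauto
  rw [e]
  apply hU.measurableSet.union
  apply Set.Subsingleton.measurableSet
  exact Set.subsingleton_singleton.anti Set.inter_subset_left

lemma cont_act (g : SL2) : Continuous (act g) := by
  constructor
  intro s hs
  rw [px_open] at hs ⊢
  have hc : Continuous fun v : {v : Fin 2 → ℝ // v ≠ 0} =>
      (⟨![g.1 0 0 * v.1 0 + g.1 0 1 * v.1 1, g.1 1 0 * v.1 0 + g.1 1 1 * v.1 1],
        vec_ne (act_ne g (mk_pt v).choose)⟩ : {v : Fin 2 → ℝ // v ≠ 0}) := by
    apply Continuous.subtype_mk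
    apply continuous_pi
    intro i
    have h0 := cont_coord 0
    have h1 := cont_coord 1
    fin_cases i
    · exact (continuous_const.mul h0).add (continuous_const.mul h1)
    · exact (continuous_const.mul h0).add (continuous_const.mul h1)
  have := hs.preimage hc
  convert this using 1
  ext v
  simp only [Set.mem_setOf_eq, Set.mem_preimage]
  have e : act g (Projectivization.mk ℝ v.1 v.2) = pt _ _ (act_ne g (mk_pt v).choose) := by
    conv_lhs => rw [(mk_pt v).choose_spec]
    exact act_pt g _
  exact iff_of_eq (congrArg (· ∈ s) e)

lemma phi_act (g : SL2) (x : PX) (hx : x ≠ pt 1 0 (by simp)) : phi (act g x) = mob g (phi x) := by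
  obtain ⟨a, b, h, rfl⟩ := px_cases x
  have hb : b ≠ 0 := by
    rintro rfl
    apply hx
    rw [pt_eq]; simp
  rw [act_pt, phi_pt, phi_pt]
  unfold mob dt r0 r1
  simp only
  have e1 : g.1 0 0 * a + g.1 0 1 * b = b * (g.1 0 0 * (a / b) + g.1 0 1) := by field_simp
  have e2 : g.1 1 0 * a + g.1 1 1 * b = b * (g.1 1 0 * (a / b) + g.1 1 1) := by field_simp
  rw [e1, e2, mul_div_mul_left _ _ hb]

lemma stat_apply (μ : Measure SL2) (ν : Measure PX) [IsProbabilityMeasure ν] (hstat : IsMuStationary μ ν)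
    {A : Set PX} (hA : MeasurableSet A) : ∫⁻ g, ν (act g ⁻¹' A) ∂μ = ν A ∧ AEMeasurable (fun g => ν (act g ⁻¹' A)) μ := by
  have hae : AEMeasurable (fun g => ν.map (act g)) μ := by
    by_contra h
    have : ν = 0 := by
      rw [← hstat, Measure.bind, Measure.map_of_not_aemeasurable h, Measure.join_zero]
    exact IsProbabilityMeasure.ne_zero ν this
  have e : ∀ g, ν (act g ⁻¹' A) = ν.map (act g) A := fun g => by
    rw [Measure.map_apply (cont_act g).measurable hA]
  simp only [e]
  constructor
  · rw [← Measure.bind_apply hA hae, hstat]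
  · exact (Measure.measurable_coe hA).comp_aemeasurable hae


lemma act_pow_mem {Y : Set PX} {g : SL2} (h : ∀ y ∈ Y, act g y ∈ Y) {y : PX} (hy : y ∈ Y) (n : ℕ) :
    act (g ^ n) y ∈ Y := by
  induction n with
  | zero => simpa [act_one] using hy
  | succ n ih => rw [pow_succ', act_mul]; exact h _ ih

lemma act_pow_diag {g : SL2} {l : ℝ} (a00 : g.1 0 0 = l) (a01 : g.1 0 1 = 0)
    (a10 : g.1 1 0 = 0) (a11 : g.1 1 1 = l⁻¹) (n : ℕ) :
    (g ^ n).1 0 0 = l ^ n ∧ (g ^ n).1 0 1 = 0 ∧ (g ^ n).1 1 0 = 0 ∧ (g ^ n).1 1 1 = (l ^ n)⁻¹ := by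
  induction n with
  | zero => simp
  | succ n ih =>
    obtain ⟨h1, h2, h3, h4⟩ := ih
    rw [pow_succ, sl_mul00, sl_mul01, sl_mul10, sl_mul11, h1, h2, h3, h4, a00, a01, a10, a11]
    refine ⟨by ring, by ring, by ring, ?_⟩
    rw [pow_succ, mul_inv]; ring

lemma periodic_diag {Y : Set PX} (hY : Y.Finite) {g : SL2} {l : ℝ} (hl : 1 < |l|) (a00 : g.1 0 0 = l) (a01 : g.1 0 1 = 0)
    (a10 : g.1 1 0 = 0) (a11 : g.1 1 1 = l⁻¹) (h : ∀ y ∈ Y, act g y ∈ Y) {y : PX} (hy : y ∈ Y) :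
    y = pt 1 0 (by simp) ∨ y = pt 0 1 (by simp) := by
  have hl0 : l ≠ 0 := by rintro rfl; norm_num at hl
  obtain ⟨i, -, j, -, hij, e⟩ := Set.infinite_univ.exists_ne_map_eq_of_mapsTo
    (f := fun n : ℕ => act (g ^ n) y) (t := Y) (fun n _ => act_pow_mem h hy n) hY
  obtain ⟨a, b, hab, rfl⟩ := px_cases y
  rw [act_pt, act_pt, pt_eq] at e
  obtain ⟨h1, h2, h3, h4⟩ := act_pow_diag a00 a01 a10 a11 i
  obtain ⟨k1, k2, k3, k4⟩ := act_pow_diag a00 a01 a10 a11 j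
  rw [h1, h2, h3, h4, k1, k2, k3, k4] at e
  simp only [zero_mul, add_zero, zero_add] at e
  by_cases ha : a = 0
  · right; rw [pt_eq, ha]; simp
  by_cases hb : b = 0
  · left; rw [pt_eq, hb]; simp
  exfalso
  have hi : l ^ i ≠ 0 := pow_ne_zero _ hl0
  have hj : l ^ j ≠ 0 := pow_ne_zero _ hl0
  have e2 : (l ^ i) ^ 2 = (l ^ j) ^ 2 := by
    field_simp at e
    exact e
  have e3 : |l| ^ i = |l| ^ j := by
    rw [← abs_pow, ← abs_pow]; exact (sq_eq_sq_iff_abs_eq_abs _ _).1 e2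
  exact hij (pow_right_injective₀ (by linarith) hl.ne' e3)

lemma no_finite_inv (H : Subgroup SL2) (hH : ¬ IsSolvable H) {Y : Set PX} (hY : Y.Finite) (hne : Y.Nonempty)
    (h : ∀ g ∈ H, ∀ y ∈ Y, act g y ∈ Y) : False := by
  obtain ⟨γ, hγ, htr⟩ := hyp_exists H hH
  obtain ⟨T, l, hl, a00, a01, a10, a11⟩ := diag_exists γ htr
  set Z := act T '' Y with hZ
  have hZf : Z.Finite := hY.image _
  have hZi : ∀ g ∈ H, ∀ z ∈ Z, act (T * g * T⁻¹) z ∈ Z := by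
    rintro g hg _ ⟨y, hy, rfl⟩
    rw [act_mul, act_inv_act, act_mul]
    exact ⟨_, h g hg y hy, rfl⟩
  have hcl : ∀ z ∈ Z, z = pt 1 0 (by simp) ∨ z = pt 0 1 (by simp) := fun z hz =>
    periodic_diag hZf hl a00 a01 a10 a11 (hZi γ hγ) hz
  by_cases hone : ∃ y0, ∀ y ∈ Y, y = y0
  · obtain ⟨y0, hy0⟩ := hone
    obtain ⟨y, hy⟩ := hne
    obtain rfl := hy0 y hy
    obtain ⟨a, b, hab, rfl⟩ := px_cases y
    apply hH
    apply solv_line H a b hab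
    intro g hg
    have := hy0 _ (h g hg _ hy)
    rw [act_pt, pt_eq] at this
    linear_combination (-1) * this
  · push Not at hone
    have both : pt 1 0 (by simp) ∈ Z ∧ pt 0 1 (by simp) ∈ Z := by
      constructor
      · by_contra hc
        obtain ⟨y, hy, hyy⟩ := hone (act T⁻¹ (pt 0 1 (by simp)))
        rcases hcl (act T y) ⟨y, hy, rfl⟩ with e | e
        · exact hc (e ▸ ⟨y, hy, rfl⟩)
        · exact hyy (by rw [← e, act_inv_act])
      · by_contra hc
        obtain ⟨y, hy, hyy⟩ := hone (act T⁻¹ (pt 1 0 (by simp)))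
        rcases hcl (act T y) ⟨y, hy, rfl⟩ with e | e
        · exact hyy (by rw [← e, act_inv_act])
        · exact hc (e ▸ ⟨y, hy, rfl⟩)
    apply hH
    apply solv_torus H T
    intro g hg
    have h1 := hcl _ (hZi g hg _ both.1)
    have h2 := hcl _ (hZi g hg _ both.2)
    set k := T * g * T⁻¹
    have hd := sl_det k
    rw [act_pt, pt_eq, pt_eq] at h1 h2
    simp only [mul_one, mul_zero, add_zero, zero_add] at h1 h2
    rcases h1 with h1 | h1
    · rw [← h1] at hd ⊢
      left
      refine ⟨?_, rfl⟩
      rcases h2 with h2 | h2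
      · rw [← h2] at hd; simp at hd
      · exact h2
    · rw [h1] at hd ⊢
      right
      refine ⟨rfl, ?_⟩
      rcases h2 with h2 | h2
      · exact h2.symm
      · rw [h2] at hd; simp at hd

lemma closed_act_inv (y z : PX) : IsClosed {g : SL2 | act g⁻¹ y = z} := by
  obtain ⟨a, b, hab, rfl⟩ := px_cases y
  obtain ⟨c, d, hcd, rfl⟩ := px_cases z
  simp only [act_pt, pt_eq, sl_inv00, sl_inv01, sl_inv10, sl_inv11]
  have h := cont_entry
  apply isClosed_eq
  · have h1 := h 1 1; have h2 := h 0 1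
    fun_prop
  · have h1 := h 1 0; have h2 := h 0 0
    fun_prop

lemma nu_null (μ : Measure SL2) [IsProbabilityMeasure μ] (hzd : ¬ IsSolvable (Subgroup.closure (measSupp μ)))
    (ν : Measure PX) [IsProbabilityMeasure ν] (hstat : IsMuStationary μ ν) (x : PX) : ν {x} = 0 := by
  by_contra hx
  have hfin : ∀ c : ℝ≥0∞, c ≠ 0 → {y : PX | c ≤ ν {y}}.Finite := by
    intro c hc
    have := Measure.finite_const_le_meas_of_disjoint_iUnion ν (pos_iff_ne_zero.2 hc)
      (As := fun y : PX => ({y} : Set PX)) (fun y => measurableSet_singleton y)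
      (fun y z hyz => by simpa [Function.onFun] using hyz) (measure_ne_top _ _)
    exact this
  obtain ⟨x0, hx0, hmax⟩ := (hfin (ν {x}) hx).exists_maximalFor (fun y => ν {y}) _ ⟨x, by simp⟩
  have hm : ∀ y, ν {y} ≤ ν {x0} := by
    intro y
    by_contra hc
    push Not at hc
    exact absurd (hmax (j := y) (le_trans hx0 hc.le) hc.le) (not_le.2 hc)
  set m := ν {x0} with hmd
  have hm0 : m ≠ 0 := fun h => hx (le_antisymm (h ▸ hx0) bot_le)
  set Y : Set PX := {y | m ≤ ν {y}} with hYd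
  have hYf : Y.Finite := hfin m hm0
  have hYeq : ∀ y, y ∈ Y ↔ ν {y} = m := fun y => ⟨fun h => le_antisymm (hm y) h, fun h => h.ge⟩
  have hae : ∀ y ∈ Y, ∀ᵐ g ∂μ, act g⁻¹ y ∈ Y := by
    intro y hy
    obtain ⟨h1, h2⟩ := stat_apply μ ν hstat (measurableSet_singleton y)
    have e : ∀ g, act g ⁻¹' {y} = {act g⁻¹ y} := by
      intro g; ext z
      simp only [Set.mem_preimage, Set.mem_singleton_iff]
      constructor
      · rintro rfl; rw [act_inv_act]
      · rintro rfl; rw [act_act_inv]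
    simp only [e] at h1 h2
    have h3 : ∫⁻ g, (m - ν {act g⁻¹ y}) ∂μ = 0 := by
      rw [lintegral_sub' h2 (by rw [h1]; exact measure_ne_top _ _) (Eventually.of_forall fun g => hm _), h1, lintegral_const,
        measure_univ, mul_one, (hYeq y).1 hy, tsub_self]
    have hms : AEMeasurable (fun g => m - ν {act g⁻¹ y}) μ := aemeasurable_const.sub h2
    rw [lintegral_eq_zero_iff' hms] at h3
    filter_upwards [h3] with g hg
    exact tsub_eq_zero_iff_le.1 hg
  have hsub : measSupp μ ⊆ {g | ∀ y ∈ Y, act g⁻¹ y ∈ Y} := by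
    apply supp_sub_closed
    · have : {g : SL2 | ∀ y ∈ Y, act g⁻¹ y ∈ Y} = ⋂ y ∈ Y, ⋃ z ∈ Y, {g : SL2 | act g⁻¹ y = z} := by
        ext g; simp
      rw [this]
      exact isClosed_biInter fun y _ => hYf.isClosed_biUnion fun z _ => closed_act_inv y z
    · have : ∀ᵐ g ∂μ, ∀ y ∈ Y, act g⁻¹ y ∈ Y := (ae_ball_iff hYf.countable).2 hae
      exact this
  have hH : ∀ g ∈ Subgroup.closure (measSupp μ), ∀ y, act g y ∈ Y ↔ y ∈ Y := by
    intro g hg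
    induction hg using Subgroup.closure_induction with
    | mem g hg =>
      have hg' := hsub hg
      have him : act g⁻¹ '' Y = Y := by
        apply Set.eq_of_subset_of_ncard_le _ _ hYf
        · rintro _ ⟨y, hy, rfl⟩; exact hg' y hy
        · rw [Set.ncard_image_of_injective _ (act_inj _)]
      intro y
      constructor
      · intro h
        have := hg' _ h
        rwa [act_inv_act] at this
      · intro h
        rw [← him] at h
        obtain ⟨z, hz, rfl⟩ := h
        rwa [act_act_inv]
    | one => intro y; rw [act_one]
    | mul g h _ _ ihg ihh => intro y; rw [act_mul, ihg, ihh]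
    | inv g _ ih => intro y; rw [← ih, act_act_inv]
  exact no_finite_inv _ hzd hYf ⟨x0, (hYeq x0).2 rfl⟩ fun g hg y hy => (hH g hg y).2 hy


lemma entry_le_op (g : SL2) (i j : Fin 2) : |g.1 i j| ≤ opNorm g := by
  unfold opNorm
  set L := Matrix.toEuclideanCLM (𝕜 := ℝ) (n := Fin 2) (g : Matrix (Fin 2) (Fin 2) ℝ) with hL
  have h1 := L.le_opNorm (EuclideanSpace.single j (1:ℝ))
  have h2 := PiLp.norm_apply_le (L (EuclideanSpace.single j (1:ℝ))) i
  have h3 : (L (EuclideanSpace.single j (1:ℝ))) i = g.1 i j := by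
    rw [hL, Matrix.ofLp_toEuclideanCLM]
    simp [Matrix.mulVec_single]
  rw [h3, Real.norm_eq_abs] at h2
  rw [EuclideanSpace.norm_single, norm_one, mul_one] at h1
  exact h2.trans h1

lemma nm_le_op (g : SL2) : nm g ≤ 4 * opNorm g := by
  unfold nm
  linarith [entry_le_op g 0 0, entry_le_op g 0 1, entry_le_op g 1 0, entry_le_op g 1 1]

lemma moment_mm (μ : Measure SL2) (h : HasExpMoment μ) :
    ∃ α > (0:ℝ), ∫⁻ g, ENNReal.ofReal (mm α g ^ 2) ∂μ < ⊤ := by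
  obtain ⟨e, he, h⟩ := h
  refine ⟨e / 2, by positivity, ?_⟩
  have hle : ∀ g, ENNReal.ofReal (mm (e / 2) g ^ 2) ≤ ENNReal.ofReal (4 ^ e) * ENNReal.ofReal (opNorm g ^ e) := by
    intro g
    have hn := nm_pos g
    have ho : 0 ≤ opNorm g := norm_nonneg _
    have e1 : mm (e / 2) g ^ 2 = nm g ^ e := by
      unfold mm
      rw [← Real.exp_nat_mul, Real.rpow_def_of_pos hn]
      congr 1; push_cast; ring
    rw [e1, ← ENNReal.ofReal_mul (by positivity), ← Real.mul_rpow (by norm_num) ho]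
    apply ENNReal.ofReal_le_ofReal
    exact Real.rpow_le_rpow hn.le (nm_le_op g) he.le
  calc _ ≤ ∫⁻ g, ENNReal.ofReal (4 ^ e) * ENNReal.ofReal (opNorm g ^ e) ∂μ := lintegral_mono hle
    _ = ENNReal.ofReal (4 ^ e) * ∫⁻ g, ENNReal.ofReal (opNorm g ^ e) ∂μ := lintegral_const_mul' _ _ ENNReal.ofReal_ne_top
    _ < ⊤ := ENNReal.mul_lt_top ENNReal.ofReal_lt_top h

lemma tau_null (μ : Measure SL2) [IsProbabilityMeasure μ] (hzd : ¬ IsSolvable (Subgroup.closure (measSupp μ)))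
    (ν : Measure PX) [IsProbabilityMeasure ν] (hstat : IsMuStationary μ ν) : NullSingletonClass (ν.map phi) := by
  constructor
  intro x
  rw [Measure.map_apply meas_phi (measurableSet_singleton x)]
  apply measure_mono_null (t := {pt x 1 (by simp)} ∪ {pt 1 0 (by simp)})
  · intro y hy
    obtain ⟨a, b, h, rfl⟩ := px_cases y
    rw [Set.mem_preimage, phi_pt, Set.mem_singleton_iff] at hy
    by_cases hb : b = 0
    · right; rw [Set.mem_singleton_iff, pt_eq, hb]; simp
    · left; rw [Set.mem_singleton_iff, pt_eq, ← hy]; field_simp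
  · rw [measure_union_null_iff]
    exact ⟨nu_null μ hzd ν hstat _, nu_null μ hzd ν hstat _⟩

lemma tau_stat (μ : Measure SL2) [IsProbabilityMeasure μ] (hzd : ¬ IsSolvable (Subgroup.closure (measSupp μ)))
    (ν : Measure PX) [IsProbabilityMeasure ν] (hstat : IsMuStationary μ ν) :
    (μ.prod (ν.map phi)).map (fun p => mob p.1 p.2) = ν.map phi := by
  have : IsProbabilityMeasure (ν.map phi) := Measure.isProbabilityMeasure_map meas_phi.aemeasurable
  ext A hA
  rw [Measure.map_apply meas_mob hA, Measure.prod_apply (meas_mob hA), Measure.map_apply meas_phi hA,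
    ← (stat_apply μ ν hstat (meas_phi hA)).1]
  congr 1
  ext g
  have hs : Prod.mk g ⁻¹' ((fun p : SL2 × ℝ => mob p.1 p.2) ⁻¹' A) = mob g ⁻¹' A := rfl
  rw [hs, Measure.map_apply meas_phi (meas_mob' g hA)]
  apply measure_congr
  have hne : ∀ᵐ x ∂ν, x ≠ pt 1 0 (by simp) := by
    rw [ae_iff]
    simpa using nu_null μ hzd ν hstat (pt 1 0 (by simp))
  filter_upwards [hne] with x hx
  have := phi_act g x hx
  apply propext
  show mob g (phi x) ∈ A ↔ phi (act g x) ∈ A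
  rw [this]

lemma int_eq (τ : Measure ℝ) [IsProbabilityMeasure τ] (ξ : ℝ) :
    ‖∫ x, Complex.exp (Complex.I * x * ξ) ∂τ‖ ^ 2 = (∫ x, Real.cos (|ξ| * x) ∂τ) ^ 2 + (∫ x, Real.sin (|ξ| * x) ∂τ) ^ 2 := by
  have hc : Integrable (fun x => Real.cos (ξ * x)) τ :=
    Integrable.of_bound (by fun_prop) 1 (Eventually.of_forall fun p => Real.abs_cos_le_one _)
  have hs : Integrable (fun x => Real.sin (ξ * x)) τ :=
    Integrable.of_bound (by fun_prop) 1 (Eventually.of_forall fun p => Real.abs_sin_le_one _)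
  have e : ∀ x : ℝ, Complex.exp (Complex.I * x * ξ) = ((Real.cos (ξ * x) : ℝ) : ℂ) + ((Real.sin (ξ * x) : ℝ) : ℂ) * Complex.I := by
    intro x
    rw [Complex.ofReal_cos, Complex.ofReal_sin, ← Complex.exp_mul_I]
    congr 1; push_cast; ring
  have hI : ∫ x, Complex.exp (Complex.I * x * ξ) ∂τ = ((∫ x, Real.cos (ξ * x) ∂τ : ℝ) : ℂ) + ((∫ x, Real.sin (ξ * x) ∂τ : ℝ) : ℂ) * Complex.I := by
    simp_rw [e]
    rw [integral_add hc.ofReal (hs.ofReal.mul_const _), integral_mul_const, integral_complex_ofReal, integral_complex_ofReal]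
  rw [hI, ← Complex.normSq_eq_norm_sq, Complex.normSq_add_mul_I]
  rcases abs_choice ξ with h | h <;> rw [h]
  simp only [neg_mul, Real.cos_neg, Real.sin_neg, integral_neg, neg_sq]

theorem main_result (μ : Measure SL2) [IsProbabilityMeasure μ]
    (hmom : HasExpMoment μ) (hzd : ZariskiDense μ)
    (ν : Measure PX) [IsProbabilityMeasure ν] (hstat : IsMuStationary μ ν) :
    Filter.Tendsto
      (fun ξ : ℝ => ∫ x : PX, Complex.exp (Complex.I * (x.rep 0 / x.rep 1) * ξ) ∂ν)
      (Filter.cocompact ℝ) (nhds (0 : ℂ)) := by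
  set τ := ν.map phi with hτ
  have : IsProbabilityMeasure τ := Measure.isProbabilityMeasure_map meas_phi.aemeasurable
  have : NullSingletonClass τ := tau_null μ hzd ν hstat
  have hst := tau_stat μ hzd ν hstat
  rw [← hτ] at hst
  obtain ⟨α, hα, hmo⟩ := moment_mm μ hmom
  have hIntg : ∀ ξ : ℝ, ∫ x : PX, Complex.exp (Complex.I * (x.rep 0 / x.rep 1) * ξ) ∂ν =
      ∫ x : ℝ, Complex.exp (Complex.I * x * ξ) ∂τ := by
    intro ξ
    rw [hτ, integral_map meas_phi.aemeasurable (by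
      apply Continuous.aestronglyMeasurable; fun_prop)]
    congr 1
    ext x
    unfold phi
    push_cast
    rfl
  simp_rw [hIntg]
  rw [Metric.tendsto_nhds]
  intro δ hδ
  obtain ⟨r, hr, hh'⟩ := hh_tendsto μ τ hst hα hzd hmo (ε := δ ^ 2 / 4) (by positivity)
  have hev : ∀ᶠ ξ : ℝ in cocompact ℝ, (r ^ 2)⁻¹ < |ξ| := by
    have := (tendsto_norm_cocompact_atTop (E := ℝ)).eventually_gt_atTop ((r ^ 2)⁻¹)
    exact this
  filter_upwards [hev] with ξ hξ
  have hξ0 : 0 < |ξ| := lt_trans (by positivity) hξ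
  set s := (√|ξ|)⁻¹ with hs
  have hsq : 0 < √|ξ| := Real.sqrt_pos.2 hξ0
  have hs0 : 0 < s := by positivity
  have hs2 : (s ^ 2)⁻¹ = |ξ| := by rw [hs, inv_pow, inv_inv, Real.sq_sqrt hξ0.le]
  have hsr : s < r := by
    have : s ^ 2 < r ^ 2 := by
      rw [← hs2] at hξ
      exact (inv_lt_inv₀ (by positivity) (by positivity)).1 hξ
    exact lt_of_pow_lt_pow_left₀ 2 hr.le this
  set b : SL2 := mk2 s⁻¹ 0 0 s (by field_simp; ring) with hb
  have hr1 : r1 b = (0, s) := by simp [r1, hb]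
  have hmob : ∀ x, mob b x = |ξ| * x := by
    intro x
    have := mob_scale s hs0 1 x
    rw [mul_one, mob_one, hs2] at this
    exact this
  have hle := hh' (r1 b) (r1_ne b) (by rw [hr1, norm_snd_only, abs_of_pos hs0]; exact hsr)
  rw [hh_eq] at hle
  unfold AA BB at hle
  simp_rw [hmob] at hle
  rw [← int_eq] at hle
  rw [dist_zero_right]
  have : ‖∫ x : ℝ, Complex.exp (Complex.I * x * ξ) ∂τ‖ ^ 2 < δ ^ 2 := by
    have : 0 < δ ^ 2 := by positivity
    linarith
  exact lt_of_pow_lt_pow_left₀ 2 hδ.le this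

theorem affine_chart_rajchman
    (μ : Measure SL2) [IsProbabilityMeasure μ]
    (hmom : HasExpMoment μ) (hzd : ZariskiDense μ)
    (ν : Measure PX) [IsProbabilityMeasure ν] (hstat : IsMuStationary μ ν)
    (hsupp : ∃ ε > (0 : ℝ),
      ν {x : PX | projDist x (Projectivization.mk ℝ (![1, 0] : Fin 2 → ℝ)
          (by intro h; simpa using congrFun h 0)) < ε} = 0) :
    Filter.Tendsto
      (fun ξ : ℝ => ∫ x : PX, Complex.exp (Complex.I * (x.rep 0 / x.rep 1) * ξ) ∂ν)
      (Filter.cocompact ℝ) (nhds (0 : ℂ)) := by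
  exact main_result μ hmom hzd ν hstat

end
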